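/- Let H be a complex Hilbert space and let A, B be unital C*-subalgebras of B(H) acting nondegenerately, and suppose there is γ < 1/2200 such that d(Mₙ(A), Mₙ(B)) < γ for every n ∈ ℕ. If every bounded 2-quasitrace on A is a trace, then every bounded 2-quasitrace on B is a trace. -/

import Mathlib

open Filter Topology Metric ComplexOrder

variable {H : Type*} [NormedAddCommGroup H] [InnerProductSpace ℂ H] [CompleteSpace H]

/-- The Kadison–Kastler distance between two subsets of a C*-algebra: the Hausdorff
distance between their closed unit balls. -/
noncomputable def KKdist {E : Type*} [NormedAddCommGroup E] (S T : Set E) : ℝ :=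
  hausdorffDist (S ∩ closedBall 0 1) (T ∩ closedBall 0 1)

/-- A subalgebra of `B(H)` acts nondegenerately if the closed linear span of
`{a ξ : a ∈ A, ξ ∈ H}` is all of `H`. -/
def Nondegenerate (A : NonUnitalStarSubalgebra ℂ (H →L[ℂ] H)) : Prop :=
  Dense (↑(Submodule.span ℂ {v : H | ∃ a ∈ A, ∃ ξ : H, v = a ξ}) : Set H)

/-- The operator on the `n`-fold Hilbert space direct sum `Hⁿ` given by an `n × n`
matrix of operators on `H`. -/
noncomputable def matrixOp {n : ℕ} (a : Fin n → Fin n → (H →L[ℂ] H)) :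
    (PiLp 2 fun _ : Fin n => H) →L[ℂ] (PiLp 2 fun _ : Fin n => H) :=
  ((PiLp.continuousLinearEquiv 2 ℂ (fun _ : Fin n => H)).symm :
      (∀ _ : Fin n, H) →L[ℂ] PiLp 2 fun _ : Fin n => H).comp
    ((ContinuousLinearMap.pi fun i => ∑ j, (a i j).comp (ContinuousLinearMap.proj j)).comp
      ((PiLp.continuousLinearEquiv 2 ℂ (fun _ : Fin n => H) :
        (PiLp 2 fun _ : Fin n => H) →L[ℂ] ∀ _ : Fin n, H)))

/-- `Mₙ(A)`: the `n × n` matrices with entries in `A`, acting on `Hⁿ`. -/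
noncomputable def MatrixAmp (n : ℕ) (A : NonUnitalStarSubalgebra ℂ (H →L[ℂ] H)) :
    Set ((PiLp 2 fun _ : Fin n => H) →L[ℂ] (PiLp 2 fun _ : Fin n => H)) :=
  {T | ∃ a : Fin n → Fin n → (H →L[ℂ] H), (∀ i j, a i j ∈ A) ∧ T = matrixOp a}

/-- Christensen's property `D_k`: for every nondegenerate representation `π` of `A` on a
Hilbert space `K` and every `T ∈ B(K)`, the distance from `T` to the commutant `π(A)'`
is at most `k · sup{‖π(a) T − T π(a)‖ : a ∈ A, ‖a‖ ≤ 1}`. -/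
def PropertyDk (k : ℝ) (A : NonUnitalStarSubalgebra ℂ (H →L[ℂ] H)) : Prop :=
  ∀ (K : Type*) [NormedAddCommGroup K] [InnerProductSpace ℂ K] [CompleteSpace K]
    (π : A →⋆ₙₐ[ℂ] (K →L[ℂ] K)),
    Dense (↑(Submodule.span ℂ {v : K | ∃ (a : A) (ξ : K), v = π a ξ}) : Set K) →
    ∀ T : K →L[ℂ] K,
      infDist T {S : K →L[ℂ] K | ∀ a : A, π a * S = S * π a} ≤
        k * sSup {r : ℝ | ∃ a : A, ‖(a : H →L[ℂ] H)‖ ≤ 1 ∧ r = ‖π a * T - T * π a‖}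

/-- The commutant of a set of operators. -/
def commutantSet {E : Type*} [Mul E] (S : Set E) : Set E := {T | ∀ a ∈ S, a * T = T * a}

/-- Cuntz subequivalence `a ≾ b` relative to a subset `S` (a C*-subalgebra as a set):
there is a sequence `(vₙ)` in `S` with `‖vₙ b vₙ* − a‖ → 0`. -/
def CuntzBelowIn (S : Set (H →L[ℂ] H)) (a b : H →L[ℂ] H) : Prop :=
  ∃ v : ℕ → H →L[ℂ] H, (∀ n, v n ∈ S) ∧
    Tendsto (fun n => ‖v n * b * star (v n) - a‖) atTop (𝓝 0)

/-- `(a − ε)₊` via the continuous functional calculus. -/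
noncomputable def cutP (a : H →L[ℂ] H) (ε : ℝ) : H →L[ℂ] H :=
  cfc (fun t : ℝ => max (t - ε) 0) a

/-- Rapidly increasing sequence in the C*-subalgebra given by the set `S`. -/
def RapidlyIncreasingIn (S : Set (H →L[ℂ] H)) (a : ℕ → H →L[ℂ] H) : Prop :=
  ∀ n, ∃ ε > (0 : ℝ), CuntzBelowIn S (a n) (cutP (a (n + 1)) ε)

/-- Very rapidly increasing sequence in the C*-subalgebra given by the set `S`. -/
def VeryRapidlyIncreasingIn (S : Set (H →L[ℂ] H)) (a : ℕ → H →L[ℂ] H) : Prop :=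
  RapidlyIncreasingIn S a ∧
    ∀ ε > (0 : ℝ), ∀ n, ∃ m₀, ∀ m ≥ m₀,
      ∃ v ∈ S, ‖v‖ ≤ 1 ∧ ‖v * a m * star v * a n - a n‖ < ε

/-- A bounded trace on the C*-subalgebra `A`: a bounded (equivalently continuous) linear
functional `τ` with `τ(x*x) = τ(xx*) ≥ 0` for all `x`. -/
def IsBoundedTrace (A : NonUnitalStarSubalgebra ℂ (H →L[ℂ] H)) (τ : A → ℂ) : Prop :=
  (∀ x y : A, τ (x + y) = τ x + τ y) ∧ (∀ (c : ℂ) (x : A), τ (c • x) = c * τ x) ∧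
    (∀ x : A, τ (star x * x) = τ (x * star x)) ∧ (∀ x : A, 0 ≤ τ (star x * x)) ∧
    (∃ C : ℝ, ∀ x : A, ‖τ x‖ ≤ C * ‖(x : H →L[ℂ] H)‖)

/-- A quasitrace on a complex *-algebra `R`: `τ(x*x) = τ(xx*) ≥ 0` for all `x`,
`τ(a + ib) = τ(a) + iτ(b)` for self-adjoint `a, b`, and the restriction of `τ` to every
commutative *-subalgebra is linear. -/
structure IsQuasitrace {R : Type*} [NonUnitalRing R] [StarRing R] [Module ℂ R]
    (τ : R → ℂ) : Prop where
  trace_eq : ∀ x : R, τ (star x * x) = τ (x * star x)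
  nonneg : ∀ x : R, 0 ≤ τ (star x * x)
  sa_add : ∀ a b : R, IsSelfAdjoint a → IsSelfAdjoint b →
    τ (a + Complex.I • b) = τ a + Complex.I * τ b
  comm_add : ∀ S : NonUnitalStarSubalgebra ℂ R, (∀ x ∈ S, ∀ y ∈ S, x * y = y * x) →
    ∀ x ∈ S, ∀ y ∈ S, τ (x + y) = τ x + τ y
  comm_smul : ∀ S : NonUnitalStarSubalgebra ℂ R, (∀ x ∈ S, ∀ y ∈ S, x * y = y * x) →
    ∀ (c : ℂ), ∀ x ∈ S, τ (c • x) = c * τ x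

/-- A 2-quasitrace: a quasitrace which extends to a quasitrace on the 2×2 matrices,
via the embedding `x ↦ x ⊕ 0`. -/
def Is2Quasitrace {R : Type*} [NonUnitalRing R] [StarRing R] [Module ℂ R]
    (τ : R → ℂ) : Prop :=
  IsQuasitrace τ ∧ ∃ σ : Matrix (Fin 2) (Fin 2) R → ℂ, IsQuasitrace σ ∧
    ∀ x : R, σ (Matrix.single 0 0 x) = τ x

namespace QT

noncomputable def ramp (α β t : ℝ) : ℝ := max 0 (min 1 ((t - α) / (β - α)))

@[fun_prop] lemma ramp_cont (α β : ℝ) : Continuous (ramp α β) := by unfold ramp; fun_prop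
lemma ramp_nonneg (α β t : ℝ) : 0 ≤ ramp α β t := le_max_left _ _
lemma ramp_le_one (α β t : ℝ) : ramp α β t ≤ 1 := max_le zero_le_one (min_le_left _ _)
lemma ramp_zero {α β t : ℝ} (h : α < β) (ht : t ≤ α) : ramp α β t = 0 := by
  unfold ramp
  apply max_eq_left
  exact (min_le_right _ _).trans (div_nonpos_of_nonpos_of_nonneg (by linarith) (by linarith))
lemma ramp_one {α β t : ℝ} (h : α < β) (ht : β ≤ t) : ramp α β t = 1 := by
  unfold ramp
  have : 1 ≤ (t - α) / (β - α) := by rw [le_div_iff₀ (by linarith)]; linarith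
  rw [min_eq_left this]; simp

section
variable {R : Type*} [CStarAlgebra R]

lemma spec_bd {X : R} {M : ℝ} (hM : ‖X‖ ≤ M) {x : ℝ} (hx : x ∈ spectrum ℝ X) :
    x ∈ Set.Icc (-M) M := by
  have := spectrum.norm_le_norm_mul_of_mem hx
  rcases subsingleton_or_nontrivial R with h | h
  · have := Subsingleton.elim (1 : R) 0
    exact absurd hx (by simp [spectrum.of_subsingleton])
  · rw [CStarRing.norm_one, mul_one, Real.norm_eq_abs] at this
    exact abs_le.1 (this.trans hM)

lemma cmul (a : R) {f g : ℝ → ℝ} (hf : Continuous f) (hg : Continuous g) :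
    cfc f a * cfc g a = cfc (fun t => f t * g t) a :=
  (cfc_mul f g a hf.continuousOn hg.continuousOn).symm

lemma cadd (a : R) {f g : ℝ → ℝ} (hf : Continuous f) (hg : Continuous g) :
    cfc f a + cfc g a = cfc (fun t => f t + g t) a :=
  (cfc_add a f g hf.continuousOn hg.continuousOn).symm

lemma csub (a : R) {f g : ℝ → ℝ} (hf : Continuous f) (hg : Continuous g) :
    cfc f a - cfc g a = cfc (fun t => f t - g t) a :=
  (cfc_sub f g a hf.continuousOn hg.continuousOn).symm

lemma conj_cfc {a : R} (ha : IsSelfAdjoint a) {f : ℝ → ℝ} (hf : Continuous f) :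
    cfc f a * a * cfc f a = cfc (fun t => f t * t * f t) a := by
  have h : cfc (fun t : ℝ => t) a = a := cfc_id' ℝ a
  calc _ = cfc f a * cfc (fun t : ℝ => t) a * cfc f a := by rw [h]
    _ = _ := by rw [cmul a hf (by fun_prop), cmul a (by fun_prop) hf]

lemma one_sub_cfc {a : R} (ha : IsSelfAdjoint a) {f : ℝ → ℝ} (hf : Continuous f) :
    1 - cfc f a = cfc (fun t => 1 - f t) a := by
  have h : cfc (fun _ : ℝ => (1:ℝ)) a = 1 := cfc_const_one ℝ a
  rw [← h, csub a (by fun_prop) hf]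

lemma cfc_sa (f : ℝ → ℝ) (a : R) : IsSelfAdjoint (cfc f a) := cfc_predicate f a

lemma cfc_near_poly {X : R} (hX : IsSelfAdjoint X) {M : ℝ} (hM : ‖X‖ ≤ M) {f : ℝ → ℝ} (hf : Continuous f)
    {ε : ℝ} (hε : 0 < ε) {p : Polynomial ℝ} (hp : ∀ x ∈ Set.Icc (-M) M, |p.eval x - f x| < ε) :
    ‖Polynomial.aeval X p - cfc f X‖ ≤ ε := by
  rw [← cfc_polynomial p X, ← cfc_sub _ _ X]
  apply norm_cfc_le hε.le
  intro x hx
  exact (hp x (spec_bd hM hx)).le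

lemma intertwine {X Y z : R} (hX : IsSelfAdjoint X) (hY : IsSelfAdjoint Y) (h : X * z = z * Y)
    {f : ℝ → ℝ} (hf : Continuous f) : cfc f X * z = z * cfc f Y := by
  set M := max ‖X‖ ‖Y‖
  have hpoly : ∀ p : Polynomial ℝ, Polynomial.aeval X p * z = z * Polynomial.aeval Y p := by
    intro p
    induction p using Polynomial.induction_on' with
    | add p q hp hq => simp [add_mul, mul_add, hp, hq]
    | monomial n a =>
      have : X ^ n * z = z * Y ^ n := by
        induction n with
        | zero => simp
        | succ n ih => rw [pow_succ, mul_assoc, h, ← mul_assoc, ih, mul_assoc, pow_succ]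
      simp [Polynomial.aeval_monomial, Algebra.algebraMap_eq_smul_one, this]
  rw [← sub_eq_zero, ← norm_eq_zero]
  refine le_antisymm (le_of_forall_pos_le_add fun ε hε => ?_) (norm_nonneg _)
  set δ := ε / (2 * ‖z‖ + 1)
  have hδ : 0 < δ := by positivity
  obtain ⟨p, hp⟩ := exists_polynomial_near_of_continuousOn (-M) M f hf.continuousOn δ hδ
  have h1 := cfc_near_poly hX (le_max_left _ _) hf hδ hp
  have h2 := cfc_near_poly hY (le_max_right _ _) hf hδ hp
  have e : cfc f X * z - z * cfc f Y =
      -((Polynomial.aeval X p - cfc f X) * z) + z * (Polynomial.aeval Y p - cfc f Y) := by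
    rw [sub_mul, mul_sub, hpoly]; abel
  rw [e]
  calc _ ≤ δ * ‖z‖ + ‖z‖ * δ := by
        refine (norm_add_le _ _).trans (add_le_add ?_ ?_)
        · rw [norm_neg]; exact (norm_mul_le _ _).trans (by gcongr)
        · exact (norm_mul_le _ _).trans (by gcongr)
    _ = δ * (2 * ‖z‖) := by ring
    _ ≤ δ * (2 * ‖z‖ + 1) := by gcongr; linarith
    _ = 0 + ε := by rw [zero_add]; exact div_mul_cancel₀ _ (by positivity)

/-- functional calculus against an eigenvector-like element -/
lemma cfc_mul_eigen {Y y : R} (hY : IsSelfAdjoint Y) {r : ℝ} (h : Y * y = r • y)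
    {f : ℝ → ℝ} (hf : Continuous f) : cfc f Y * y = f r • y := by
  have hs : IsSelfAdjoint (algebraMap ℝ R r) := IsSelfAdjoint.algebraMap R (by rfl)
  have := intertwine (X := Y) (Y := algebraMap ℝ R r) (z := y) hY hs
    (by rw [h, Algebra.algebraMap_eq_smul_one]; simp) hf
  rw [this, cfc_algebraMap]
  simp [Algebra.algebraMap_eq_smul_one]

end

section
variable {R : Type*} [CStarAlgebra R] {σ : R → ℂ}

/-- real part of a quasitrace -/
noncomputable def q (σ : R → ℂ) (x : R) : ℝ := (σ x).re

lemma exists_comm {x y : R} (hx : IsSelfAdjoint x) (hy : IsSelfAdjoint y) (h : Commute x y) :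
    ∃ S : NonUnitalStarSubalgebra ℂ R, (∀ x ∈ S, ∀ y ∈ S, x * y = y * x) ∧ x ∈ S ∧ y ∈ S := by
  refine ⟨NonUnitalStarAlgebra.adjoin ℂ {x, y}, ?_, ?_, ?_⟩
  · have := NonUnitalStarAlgebra.isMulCommutative_adjoin (R := ℂ) (s := ({x, y} : Set R)) ?_ ?_
    · intro a ha b hb
      have := this.is_comm.comm (⟨a, ha⟩ : NonUnitalStarAlgebra.adjoin ℂ {x, y}) ⟨b, hb⟩
      exact congrArg Subtype.val this
    · rintro a (rfl | rfl) b (rfl | rfl) <;> first | rfl | exact h | exact h.symm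
    · rintro a (rfl | rfl) b (rfl | rfl) <;> simp only [hx.star_eq, hy.star_eq] <;>
        first | rfl | exact h | exact h.symm
  · exact NonUnitalStarAlgebra.subset_adjoin _ _ (by simp)
  · exact NonUnitalStarAlgebra.subset_adjoin _ _ (by simp)

lemma σ_add (hσ : IsQuasitrace σ) {x y : R} (hx : IsSelfAdjoint x) (hy : IsSelfAdjoint y)
    (h : Commute x y) : σ (x + y) = σ x + σ y := by
  obtain ⟨S, hS, h1, h2⟩ := exists_comm hx hy h
  exact hσ.comm_add S hS x h1 y h2

lemma σ_smul (hσ : IsQuasitrace σ) {x : R} (hx : IsSelfAdjoint x) (c : ℂ) :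
    σ (c • x) = c * σ x := by
  obtain ⟨S, hS, h1, h2⟩ := exists_comm hx hx (Commute.refl x)
  exact hσ.comm_smul S hS c x h1

lemma q_add (hσ : IsQuasitrace σ) {x y : R} (hx : IsSelfAdjoint x) (hy : IsSelfAdjoint y)
    (h : Commute x y) : q σ (x + y) = q σ x + q σ y := by
  simp [q, σ_add hσ hx hy h]

lemma q_smul (hσ : IsQuasitrace σ) {x : R} (hx : IsSelfAdjoint x) (c : ℝ) :
    q σ (c • x) = c * q σ x := by
  have := σ_smul hσ hx (c : ℂ)
  rw [Complex.coe_smul] at this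
  simp [q, this]

lemma q_zero (hσ : IsQuasitrace σ) : q σ 0 = 0 := by
  have := q_smul hσ (IsSelfAdjoint.zero R) 0
  simpa using this

lemma q_sub (hσ : IsQuasitrace σ) {x y : R} (hx : IsSelfAdjoint x) (hy : IsSelfAdjoint y)
    (h : Commute x y) : q σ (x - y) = q σ x - q σ y := by
  have := q_add hσ (hx.sub hy) hy (h.sub_left (Commute.refl y))
  rw [sub_add_cancel] at this
  linarith

lemma q_trace (hσ : IsQuasitrace σ) (x : R) : q σ (star x * x) = q σ (x * star x) := by
  simp [q, hσ.trace_eq]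

variable [PartialOrder R] [StarOrderedRing R]

lemma q_nonneg (hσ : IsQuasitrace σ) {x : R} (hx : 0 ≤ x) : 0 ≤ q σ x := by
  obtain ⟨y, rfl⟩ := CStarAlgebra.nonneg_iff_eq_star_mul_self.1 hx
  exact (Complex.le_def.1 (hσ.nonneg y)).1

lemma σ_real_nonneg (hσ : IsQuasitrace σ) {x : R} (hx : 0 ≤ x) : σ x = q σ x := by
  obtain ⟨y, rfl⟩ := CStarAlgebra.nonneg_iff_eq_star_mul_self.1 hx
  have := (Complex.le_def.1 (hσ.nonneg y)).2
  apply Complex.ext <;> simp [q, ← this]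

lemma q_mono (hσ : IsQuasitrace σ) {x y : R} (hx : IsSelfAdjoint x) (hy : IsSelfAdjoint y)
    (h : Commute x y) (hxy : x ≤ y) : q σ x ≤ q σ y := by
  have := q_nonneg hσ (sub_nonneg.2 hxy)
  rw [q_sub hσ hy hx h.symm] at this
  linarith

lemma q_cfc_mono (hσ : IsQuasitrace σ) {a : R} {f g : ℝ → ℝ}
    (hf : Continuous f) (hg : Continuous g) (h : ∀ x ∈ spectrum ℝ a, f x ≤ g x) :
    q σ (cfc f a) ≤ q σ (cfc g a) :=
  q_mono hσ (cfc_predicate f a) (cfc_predicate g a) (cfc_commute_cfc f g a) (cfc_mono h)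

lemma q_cfc_add (hσ : IsQuasitrace σ) (a : R) {f g : ℝ → ℝ}
    (hf : Continuous f) (hg : Continuous g) :
    q σ (cfc (fun t => f t + g t) a) = q σ (cfc f a) + q σ (cfc g a) := by
  rw [cfc_add a f g]
  exact q_add hσ (cfc_predicate f a) (cfc_predicate g a) (cfc_commute_cfc f g a)

end
end QT

namespace QT
section
open scoped ComplexStarModule
variable {R : Type*} [CStarAlgebra R] {σ : R → ℂ} [PartialOrder R] [StarOrderedRing R]

structure Adm (δ : ℝ) (f : ℝ → ℝ) : Prop where
  cont : Continuous f
  nonneg : ∀ t, 0 ≤ f t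
  le_one : ∀ t, f t ≤ 1
  zero : ∀ t, t ≤ δ → f t = 0

lemma adm_ramp {α β : ℝ} (h : α < β) : Adm α (ramp α β) :=
  ⟨ramp_cont _ _, ramp_nonneg _ _, ramp_le_one _ _, fun _ ht => ramp_zero h ht⟩

lemma spec_nonneg {b : R} (hb : 0 ≤ b) {t : ℝ} (ht : t ∈ spectrum ℝ b) : 0 ≤ t :=
  spectrum_nonneg_of_nonneg hb ht

/-- norm estimate behind polar-type decompositions -/
lemma norm_core0 {a b s : R} (hb : 0 ≤ b) (hs : IsSelfAdjoint s) (hsa : s * s = a) (hab : a ≤ b)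
    {g : ℝ → ℝ} (hg : Continuous g) {c : ℝ} (hc : 0 ≤ c) (h : ∀ t, 0 ≤ t → t * g t ^ 2 ≤ c ^ 2) :
    ‖cfc g b * s‖ ≤ c := by
  have hgs : IsSelfAdjoint (cfc g b) := cfc_predicate g b
  have hbs : IsSelfAdjoint b := .of_nonneg hb
  have h1 : ‖cfc g b * s‖ * ‖cfc g b * s‖ = ‖cfc g b * a * cfc g b‖ := by
    rw [← CStarRing.norm_self_mul_star, star_mul, hgs.star_eq, hs.star_eq, ← hsa]
    simp only [mul_assoc]
  have ha : 0 ≤ a := by rw [← hsa]; nth_rewrite 1 [← hs.star_eq]; exact star_mul_self_nonneg s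
  have h2 : cfc g b * a * cfc g b ≤ cfc g b * b * cfc g b := hgs.conjugate_le_conjugate hab
  have h3 : 0 ≤ cfc g b * a * cfc g b := hgs.conjugate_nonneg ha
  have h4 := CStarAlgebra.norm_le_norm_of_nonneg_of_le h3 h2
  have h5 : cfc g b * b * cfc g b = cfc (fun t => g t * t * g t) b := conj_cfc hbs hg
  have h6 : ‖cfc g b * b * cfc g b‖ ≤ c ^ 2 := by
    rw [h5]
    apply norm_cfc_le (by positivity)
    intro t ht
    have ht := spec_nonneg hb ht
    rw [Real.norm_eq_abs, abs_of_nonneg]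
    · linarith [h t ht]
    · have := mul_nonneg ht (sq_nonneg (g t)); linarith
  nlinarith [norm_nonneg (cfc g b * s)]

lemma norm_core {a x s : R} (hs : IsSelfAdjoint s) (hsa : s * s = a) (hax : a ≤ star x * x)
    {g : ℝ → ℝ} (hg : Continuous g) {c : ℝ} (hc : 0 ≤ c) (h : ∀ t, 0 ≤ t → |t * g t| ≤ c) :
    ‖x * cfc g (star x * x) * s‖ ≤ c := by
  set b := star x * x with hbdef
  have hb : 0 ≤ b := star_mul_self_nonneg x
  have hgs : IsSelfAdjoint (cfc g b) := cfc_predicate g b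
  have hms : IsSelfAdjoint (cfc (fun t => √t * g t) b) := cfc_predicate _ b
  have h1 : ‖x * cfc g b * s‖ * ‖x * cfc g b * s‖ =
      ‖cfc (fun t => √t * g t) b * s‖ * ‖cfc (fun t => √t * g t) b * s‖ := by
    rw [← CStarRing.norm_star_mul_self, ← CStarRing.norm_star_mul_self]
    congr 1
    have e1 : cfc (fun t => √t * g t) b * cfc (fun t => √t * g t) b = cfc g b * b * cfc g b := by
      have : cfc g b * b * cfc g b = cfc (fun t => g t * t * g t) b := conj_cfc (.of_nonneg hb) hg
      rw [this, cmul b (by fun_prop) (by fun_prop)]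
      apply cfc_congr
      intro t ht
      have ht := Real.mul_self_sqrt (spec_nonneg hb ht)
      linear_combination (g t)^2 * ht
    simp only [star_mul, hs.star_eq, hgs.star_eq, hms.star_eq]
    calc _ = s * (cfc g b * b * cfc g b) * s := by simp only [hbdef, mul_assoc]
      _ = _ := by rw [← e1]; simp only [mul_assoc]
  have h2 := norm_core0 hb hs hsa hax (g := fun t => √t * g t) (by fun_prop) hc (by
    intro t ht
    have h' := h t ht
    have : t * (√t * g t) ^ 2 = |t * g t| ^ 2 := by
      rw [mul_pow, Real.sq_sqrt ht, sq_abs]; ring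
    rw [this]
    gcongr)
  nlinarith [norm_nonneg (x * cfc g b * s), norm_nonneg (cfc (fun t => √t * g t) b * s)]

lemma exists_factor {a x : R} (ha : 0 ≤ a) (hax : a ≤ star x * x) :
    ∃ W : R, star W * W = a ∧ ∀ e, e * x = x → e * W = W := by
  set b := star x * x with hbdef
  have hb : 0 ≤ b := star_mul_self_nonneg x
  set s := cfc Real.sqrt a with hsdef
  have hs : IsSelfAdjoint s := cfc_predicate _ _
  have hsa : s * s = a := by
    rw [hsdef, ← cfc_mul ..]
    conv_rhs => rw [← cfc_id' ℝ a]
    exact cfc_congr fun t ht => Real.mul_self_sqrt (spec_nonneg ha ht)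
  let η : ℕ → ℝ := fun n => 1 / ((n : ℝ) + 1)
  have hη : ∀ n, 0 < η n := fun n => by positivity
  have hηt : Tendsto η atTop (𝓝 0) := tendsto_one_div_add_atTop_nhds_zero_nat
  let g : ℕ → ℝ → ℝ := fun n t => (max (√t) (η n))⁻¹
  have hgc : ∀ n, Continuous (g n) := fun n => by
    apply Continuous.inv₀ (by fun_prop)
    intro t; exact (lt_max_of_lt_right (hη n)).ne'
  have hg1 : ∀ n t, 0 ≤ t → |t * g n t - √t| ≤ η n := by
    intro n t ht
    simp only [g]
    have hs0 := Real.sqrt_nonneg t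
    have hss := Real.mul_self_sqrt ht
    rcases le_total (η n) (√t) with h | h
    · rw [max_eq_left h]
      have : √t ≠ 0 := ((hη n).trans_le h).ne'
      have : t * (√t)⁻¹ - √t = 0 := by field_simp; linarith
      rw [this]; simp [(hη n).le]
    · rw [max_eq_right h]
      have h1 : t * (η n)⁻¹ ≤ √t := by
        rw [← div_eq_mul_inv, div_le_iff₀ (hη n)]; nlinarith
      have h2 : 0 ≤ t * (η n)⁻¹ := mul_nonneg ht (inv_nonneg.2 (hη n).le)
      rw [abs_le]; constructor <;> linarith [hη n]
  have hg2 : ∀ n t, 0 ≤ t → 0 ≤ 1 - t * g n t ^ 2 ∧ t * (1 - t * g n t ^ 2) ≤ η n ^ 2 := by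
    intro n t ht
    simp only [g]
    have hs0 := Real.sqrt_nonneg t
    have hss := Real.mul_self_sqrt ht
    rcases le_total (η n) (√t) with h | h
    · rw [max_eq_left h]
      have : √t ≠ 0 := ((hη n).trans_le h).ne'
      have : t * (√t)⁻¹ ^ 2 = 1 := by field_simp; linarith
      rw [this]; constructor; simp; simp; positivity
    · rw [max_eq_right h]
      have h0 := hη n
      have h1 : t * (η n)⁻¹ ^ 2 ≤ 1 := by
        rw [inv_pow, ← div_eq_mul_inv, div_le_iff₀ (by positivity)]; nlinarith
      have h2 : 0 ≤ t * (η n)⁻¹ ^ 2 := by positivity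
      constructor
      · linarith
      · nlinarith
  let W : ℕ → R := fun n => x * cfc (g n) b * s
  have hcau : CauchySeq W := by
    apply cauchySeq_of_le_tendsto_0 (fun N => 2 * η N)
    · intro n m N hn hm
      have e : W n - W m = x * cfc (fun t => g n t - g m t) b * s := by
        simp only [W]
        rw [cfc_sub (g n) (g m) b (hgc n).continuousOn (hgc m).continuousOn]
        simp only [mul_sub, sub_mul]
      rw [dist_eq_norm, e]
      apply norm_core (g := fun t => g n t - g m t) hs hsa hax ((hgc n).sub (hgc m)) (by linarith [hη N])
      intro t ht
      have h1 := abs_le.1 (hg1 n t ht)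
      have h2 := abs_le.1 (hg1 m t ht)
      have h3 : η n ≤ η N := by simp only [η]; gcongr
      have h4 : η m ≤ η N := by simp only [η]; gcongr
      rw [mul_sub, abs_le]; constructor <;> linarith
    · simpa using hηt.const_mul 2
  obtain ⟨V, hV⟩ := cauchySeq_tendsto_of_complete hcau
  refine ⟨V, ?_, ?_⟩
  · have h1 : Tendsto (fun n => star (W n) * W n) atTop (𝓝 (star V * V)) := hV.star.mul hV
    have h2 : Tendsto (fun n => star (W n) * W n) atTop (𝓝 a) := by
      rw [tendsto_iff_norm_sub_tendsto_zero]
      have hb2 : ∀ n, ‖star (W n) * W n - a‖ ≤ η n * η n := by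
        intro n
        have hgs : IsSelfAdjoint (cfc (g n) b) := cfc_predicate _ b
        let r : ℝ → ℝ := fun t => √(1 - t * g n t ^ 2)
        have hrc : Continuous r := by have := hgc n; fun_prop
        have hrs : IsSelfAdjoint (cfc r b) := cfc_predicate _ b
        have e1 : cfc r b * cfc r b = 1 - cfc (g n) b * b * cfc (g n) b := by
          have hgn := hgc n
          rw [conj_cfc (.of_nonneg hb) hgn, one_sub_cfc (.of_nonneg hb) (by fun_prop), cmul b hrc hrc]
          apply cfc_congr
          intro t ht
          have := Real.mul_self_sqrt (hg2 n t (spec_nonneg hb ht)).1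
          simp only [r]
          rw [this]; ring
        have e2 : star (W n) * W n - a = -(star (cfc r b * s) * (cfc r b * s)) := by
          simp only [W, star_mul, hs.star_eq, hgs.star_eq, hrs.star_eq]
          calc _ = s * (cfc (g n) b * b * cfc (g n) b) * s - s * s := by
                rw [hsa]; simp only [hbdef, mul_assoc]
            _ = -(s * (1 - cfc (g n) b * b * cfc (g n) b) * s) := by
                simp only [mul_sub, sub_mul, mul_one]; abel
            _ = _ := by rw [← e1]; simp only [mul_assoc]
        rw [e2, norm_neg, CStarRing.norm_star_mul_self]
        have := norm_core0 hb hs hsa hax hrc (hη n).le (by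
          intro t ht
          simp only [r]
          rw [Real.sq_sqrt (hg2 n t ht).1]
          exact (hg2 n t ht).2)
        gcongr
      have : Tendsto (fun n => η n * η n) atTop (𝓝 0) := by simpa using hηt.mul hηt
      exact squeeze_zero (fun _ => norm_nonneg _) hb2 this
    exact tendsto_nhds_unique h1 h2
  · intro e he
    have h1 : Tendsto (fun n => e * W n) atTop (𝓝 (e * V)) := hV.const_mul e
    have h2 : (fun n => e * W n) = W := by
      funext n; simp only [W, ← mul_assoc, he]
    rw [h2] at h1
    exact tendsto_nhds_unique h1 hV

lemma q_swap (hσ : IsQuasitrace σ) (x : R) {δ : ℝ} (hδ : 0 < δ) {f : ℝ → ℝ} (hf : Adm δ f) :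
    q σ (cfc f (star x * x)) = q σ (cfc f (x * star x)) := by
  have hfc := hf.cont
  let h : ℝ → ℝ := fun t => √(f t / max t δ)
  have hm : ∀ t, 0 < max t δ := fun t => lt_max_of_lt_right hδ
  have hc : Continuous h := by
    apply Real.continuous_sqrt.comp
    exact hf.cont.div (by fun_prop) fun t => (hm t).ne'
  have hh : ∀ t, f t = h t * t * h t := by
    intro t
    have : h t * h t = f t / max t δ := Real.mul_self_sqrt (div_nonneg (hf.nonneg t) (hm t).le)
    rw [mul_right_comm, this]
    rcases le_total t δ with ht | ht
    · simp [hf.zero t ht]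
    · rw [max_eq_left ht]; field_simp [(hδ.trans_le ht).ne']
  have hX : IsSelfAdjoint (star x * x) := .star_mul_self x
  have hY : IsSelfAdjoint (x * star x) := .mul_star_self x
  have e1 : ∀ a : R, IsSelfAdjoint a → cfc f a = cfc h a * a * cfc h a := by
    intro a ha
    rw [conj_cfc ha hc]; congr 1; funext t; exact hh t
  have hi : cfc h (x * star x) * x = x * cfc h (star x * x) :=
    intertwine hY hX (by simp only [mul_assoc]) hc
  have hs : IsSelfAdjoint (cfc h (star x * x)) := cfc_predicate _ _
  have hs' : IsSelfAdjoint (cfc h (x * star x)) := cfc_predicate _ _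
  rw [e1 _ hX, e1 _ hY]
  have := q_trace hσ (x * cfc h (star x * x))
  rw [star_mul, hs.star_eq] at this
  calc _ = q σ (cfc h (star x * x) * star x * (x * cfc h (star x * x))) := by simp only [mul_assoc]
    _ = _ := this
    _ = _ := by
      congr 1
      have h2 : cfc h (star x * x) * star x = star x * cfc h (x * star x) := by
        have := congrArg star hi
        simpa [star_mul, hs.star_eq, hs'.star_eq] using this.symm
      rw [← hi, h2]; simp only [mul_assoc]

lemma cfc_unit {f : ℝ → ℝ} (a : R) (h0 : ∀ t, 0 ≤ f t) (h1 : ∀ t, f t ≤ 1) :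
    0 ≤ cfc f a ∧ cfc f a ≤ 1 :=
  ⟨cfc_nonneg fun t _ => h0 t, cfc_le_one f a fun t _ => h1 t⟩

/-- if `e` acts as a unit on `y` then `f(y) ≤ e` in quasitrace -/
lemma q_unit (hσ : IsQuasitrace σ) {y e : R} (hy : 0 ≤ y) (he0 : 0 ≤ e) (he1 : e ≤ 1)
    (h : e * y = y) {f : ℝ → ℝ} (hf : Continuous f) (hf0 : ∀ t, 0 ≤ f t) (hf1 : ∀ t, f t ≤ 1) (hz : f 0 = 0) :
    q σ (cfc f y) ≤ q σ e := by
  have hys : IsSelfAdjoint y := .of_nonneg hy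
  have hes : IsSelfAdjoint e := .of_nonneg he0
  have h' : y * e = y := by
    have := congrArg star h
    simpa [star_mul, hys.star_eq, hes.star_eq] using this
  have hfs : IsSelfAdjoint (cfc f y) := cfc_predicate _ _
  have e1 : cfc f y * (1 - e) = 0 := by
    have := cfc_mul_eigen (Y := y) (y := 1 - e) (r := 0) hys (by simp [mul_sub, h']) hf
    rw [this, hz, zero_smul]
  have e2 : cfc f y * e = cfc f y := by
    rw [mul_sub, mul_one, sub_eq_zero] at e1; exact e1.symm
  have e3 : e * cfc f y = cfc f y := by
    have := congrArg star e2
    simpa [star_mul, hfs.star_eq, hes.star_eq] using this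
  apply q_mono hσ hfs hes (by rw [Commute, SemiconjBy, e2, e3])
  have h1 : e * cfc f y * e ≤ e * 1 * e := hes.conjugate_le_conjugate (cfc_unit y hf0 hf1).2
  have h2 : e * e ≤ e := by
    have hq : IsSelfAdjoint (cfc Real.sqrt e) := cfc_predicate _ _
    have hqq : cfc Real.sqrt e * cfc Real.sqrt e = e := by
      rw [← cfc_mul ..]
      conv_rhs => rw [← cfc_id' ℝ e]
      exact cfc_congr fun t ht => Real.mul_self_sqrt (spec_nonneg he0 ht)
    have := hq.conjugate_le_conjugate he1
    have hcm : Commute e (cfc Real.sqrt e) := by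
      nth_rewrite 1 [← hqq]
      exact (Commute.refl _).mul_left (Commute.refl _)
    have e5 : cfc Real.sqrt e * e * cfc Real.sqrt e = e * e := by
      rw [← hcm.eq, mul_assoc, hqq]
    rw [e5, mul_one, hqq] at this
    exact this
  rw [e3, e2, mul_one] at h1
  exact h1.trans h2

/-- main comparison lemma -/
lemma q_comp (hσ : IsQuasitrace σ) {a z e : R} (ha : IsSelfAdjoint a) (he0 : 0 ≤ e) (he1 : e ≤ 1)
    (hez : e * z = z) {δ δ' : ℝ} (hδ : 0 ≤ δ) (hδ' : δ < δ') (hle : a ≤ star z * z + algebraMap ℝ R δ)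
    {f : ℝ → ℝ} (hf : Adm δ' f) : q σ (cfc f a) ≤ q σ e := by
  have hfc := hf.cont
  set p := cfc (fun t => √(max 0 (t - δ))) a with hp
  have hps : IsSelfAdjoint p := cfc_predicate _ _
  set a' := cfc (fun t => max 0 (t - δ) ^ 2) a with ha'
  have e1 : p * (a - algebraMap ℝ R δ) * p = a' := by
    have : a - algebraMap ℝ R δ = cfc (fun t => t - δ) a := by
      rw [cfc_sub .., cfc_id' .., cfc_const ..]
    rw [this, hp, ← cfc_mul .., ← cfc_mul ..]
    apply cfc_congr
    intro t _
    have h1 := Real.mul_self_sqrt (le_max_left 0 (t - δ))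
    have h2 : max 0 (t-δ) * (t - δ) = max 0 (t-δ) ^ 2 := by
      rcases le_total 0 (t-δ) with h | h
      · rw [max_eq_right h]; ring
      · rw [max_eq_left h]; simp
    simp only
    rw [mul_right_comm, h1, h2]
  have hle2 : a' ≤ star (z * p) * (z * p) := by
    rw [← e1, star_mul, hps.star_eq]
    have := hps.conjugate_le_conjugate (sub_le_iff_le_add.2 hle)
    simpa only [mul_assoc] using this
  have ha0 : 0 ≤ a' := cfc_nonneg fun t _ => by positivity
  obtain ⟨W, hW, hWe⟩ := exists_factor ha0 hle2
  have heW := hWe e (by rw [← mul_assoc, hez])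
  let ft : ℝ → ℝ := fun u => f (δ + √u)
  have hft : Adm ((δ' - δ)^2) ft := by
    refine ⟨by fun_prop, fun t => hf.nonneg _, fun t => hf.le_one _, fun t ht => hf.zero _ ?_⟩
    have : √t ≤ δ' - δ := by
      rw [← Real.sqrt_sq (sub_pos.2 hδ').le]; exact Real.sqrt_le_sqrt ht
    linarith
  have e2 : cfc f a = cfc ft a' := by
    rw [ha', ← cfc_comp' ft (fun t => max 0 (t - δ) ^ 2) a (by have := hft.cont; fun_prop)]
    apply cfc_congr
    intro t _
    simp only [ft]
    rw [Real.sqrt_sq (le_max_left _ _)]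
    rcases le_total 0 (t - δ) with h | h
    · rw [max_eq_right h]; congr 1; ring
    · rw [max_eq_left h, hf.zero t (by linarith), hf.zero _ (by linarith)]
  rw [e2, ← hW, q_swap hσ W (by have := sub_pos.2 hδ'; positivity) hft]
  refine q_unit hσ (mul_star_self_nonneg W) he0 he1 (by rw [← mul_assoc, heW]) hft.cont hft.nonneg hft.le_one (hft.zero 0 (by positivity))

end
end QT

namespace QT
section
open scoped ComplexStarModule
variable {R : Type*} [CStarAlgebra R] {σ : R → ℂ} [PartialOrder R] [StarOrderedRing R]

lemma csmul (c : ℝ) (a : R) {f : ℝ → ℝ} (hf : Continuous f) :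
    c • cfc f a = cfc (fun t => c * f t) a := by
  rw [← cfc_smul c f a hf.continuousOn]; simp only [smul_eq_mul]

lemma sq_sqrt {a : R} (ha : 0 ≤ a) : cfc Real.sqrt a * cfc Real.sqrt a = a := by
  rw [cmul a (by fun_prop) (by fun_prop)]
  conv_rhs => rw [← cfc_id' ℝ a]
  exact cfc_congr fun t ht => Real.mul_self_sqrt (spec_nonneg ha ht)

lemma conj_le {a b : R} (h : a ≤ b) (z : R) : star z * a * z ≤ star z * b * z :=
  star_left_conjugate_le_conjugate h z

lemma conj_nonneg {a : R} (h : 0 ≤ a) (z : R) : 0 ≤ star z * a * z :=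
  star_left_conjugate_nonneg h z

lemma star_mul_le (z : R) : star z * z ≤ algebraMap ℝ R (‖z‖ ^ 2) := by
  have := (IsSelfAdjoint.star_mul_self z).le_algebraMap_norm_self
  rwa [CStarRing.norm_star_mul_self, ← sq] at this

lemma alg_mono {r s : ℝ} (h : r ≤ s) : algebraMap ℝ R r ≤ algebraMap ℝ R s := by
  rw [← sub_nonneg, ← map_sub]
  exact algebraMap_nonneg R (sub_nonneg.2 h)

/-- `(a - s)_+` -/
noncomputable def cut (s : ℝ) (a : R) : R := cfc (fun t => max 0 (t - s)) a

lemma cut_nonneg (s : ℝ) (a : R) : 0 ≤ cut s a := cfc_nonneg fun t _ => le_max_left _ _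

lemma le_cut {a : R} (ha : IsSelfAdjoint a) (s : ℝ) : a ≤ cut s a + algebraMap ℝ R s := by
  have h : cfc (fun _ : ℝ => s) a = algebraMap ℝ R s := cfc_const s a
  rw [cut, ← h, cadd a (by fun_prop) (by fun_prop)]
  conv_lhs => rw [← cfc_id' ℝ a]
  refine cfc_mono (fun t _ => ?_)
  linarith [le_max_right 0 (t - s)]

lemma cfc_cut (a : R) (s : ℝ) {f : ℝ → ℝ} (hf : Continuous f) (ha : IsSelfAdjoint a) :
    cfc f (cut s a) = cfc (fun t => f (max 0 (t - s))) a :=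
  (cfc_comp' f (fun t => max 0 (t - s)) a (by fun_prop) (by fun_prop)).symm

lemma cut_cut {a : R} (ha : IsSelfAdjoint a) {s t : ℝ} (ht : 0 ≤ t) : cut t (cut s a) = cut (s + t) a := by
  rw [cut, cfc_cut a s (by fun_prop) ha, cut]
  apply cfc_congr
  intro x _
  simp only
  rcases le_total 0 (x - s) with h | h
  · rw [max_eq_right h]; congr 1; ring
  · rw [max_eq_left h, max_eq_left (by linarith), max_eq_left (by linarith)]

/-- dimension function -/
noncomputable def D (σ : R → ℂ) (a : R) : ℝ :=
  ⨆ s : {s : ℝ // 0 < s}, q σ (cfc (ramp s (2 * s)) a)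

instance : Nonempty {s : ℝ // 0 < s} := ⟨⟨1, one_pos⟩⟩

lemma q_le_one (hσ : IsQuasitrace σ) {w : R} (h0 : 0 ≤ w) (h1 : w ≤ 1) : q σ w ≤ q σ 1 :=
  q_mono hσ (.of_nonneg h0) (.one R) (Commute.one_right _) h1

lemma q1_nonneg (hσ : IsQuasitrace σ) : 0 ≤ q σ 1 := q_nonneg hσ zero_le_one

lemma D_bdd (hσ : IsQuasitrace σ) (a : R) :
    BddAbove (Set.range fun s : {s : ℝ // 0 < s} => q σ (cfc (ramp s (2 * s)) a)) := by
  refine ⟨q σ 1, ?_⟩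
  rintro _ ⟨s, rfl⟩
  have := cfc_unit a (ramp_nonneg s (2 * s)) (ramp_le_one s (2*s))
  exact q_le_one hσ this.1 this.2

lemma D_le {a : R} {c : ℝ} (h : ∀ s, 0 < s → q σ (cfc (ramp s (2 * s)) a) ≤ c) : D σ a ≤ c :=
  ciSup_le fun s => h s s.2

lemma q_adm_le_D (hσ : IsQuasitrace σ) (a : R) {δ : ℝ} (hδ : 0 < δ) {f : ℝ → ℝ} (hf : Adm δ f) :
    q σ (cfc f a) ≤ D σ a := by
  have h1 : q σ (cfc f a) ≤ q σ (cfc (ramp (δ / 2) (2 * (δ / 2))) a) := by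
    apply q_cfc_mono hσ hf.cont (ramp_cont _ _)
    intro t _
    rcases le_total t δ with h | h
    · rw [hf.zero t h]; exact ramp_nonneg _ _ _
    · rw [ramp_one (by linarith) (by linarith)]; exact hf.le_one t
  exact h1.trans (le_ciSup (D_bdd hσ a) (⟨δ / 2, by positivity⟩ : {s : ℝ // 0 < s}))

lemma q_ramp_le_D (hσ : IsQuasitrace σ) (a : R) {α β : ℝ} (hα : 0 < α) (h : α < β) :
    q σ (cfc (ramp α β) a) ≤ D σ a := q_adm_le_D hσ a hα (adm_ramp h)

lemma D_nonneg (hσ : IsQuasitrace σ) (a : R) : 0 ≤ D σ a :=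
  (q_nonneg hσ (cfc_unit a (ramp_nonneg 1 2) (ramp_le_one 1 2)).1).trans
    (q_ramp_le_D hσ a one_pos one_lt_two)

lemma D_le_one (hσ : IsQuasitrace σ) (a : R) : D σ a ≤ q σ 1 := D_le fun s _ => by
  have := cfc_unit a (ramp_nonneg s (2 * s)) (ramp_le_one s (2*s))
  exact q_le_one hσ this.1 this.2

/-- comparison with the dimension function -/
lemma q_comp_D (hσ : IsQuasitrace σ) {a b z : R} (ha : IsSelfAdjoint a) (hb : 0 ≤ b)
    {δ δ' : ℝ} (hδ : 0 ≤ δ) (hδ' : δ < δ') (hle : a ≤ star z * b * z + algebraMap ℝ R δ)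
    {f : ℝ → ℝ} (hf : Adm δ' f) : q σ (cfc f a) ≤ D σ b := by
  have hbs : IsSelfAdjoint b := .of_nonneg hb
  set η := (δ' - δ) / (2 * (‖z‖ ^ 2 + 1)) with hη
  have hη0 : 0 < η := by have := sub_pos.2 hδ'; positivity
  set e := cfc (ramp (η / 2) η) b with he
  set y := cfc Real.sqrt (cut η b) with hy
  have hys : IsSelfAdjoint y := cfc_sa _ _
  have h1 : a ≤ star (y * z) * (y * z) + algebraMap ℝ R (δ + η * ‖z‖ ^ 2) := by
    have h2 := conj_le (le_cut hbs η) z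
    have h3 : star (y * z) * (y * z) = star z * cut η b * z := by
      rw [star_mul, hys.star_eq, ← sq_sqrt (cut_nonneg η b)]; simp only [mul_assoc, hy]
    have h4 : star z * (cut η b + algebraMap ℝ R η) * z =
        star z * cut η b * z + η • (star z * z) := by
      rw [mul_add, add_mul, Algebra.algebraMap_eq_smul_one]; simp
    have h5 : η • (star z * z) ≤ algebraMap ℝ R (η * ‖z‖ ^ 2) := by
      have := smul_le_smul_of_nonneg_left (star_mul_le z) hη0.le
      rwa [map_mul, ← Algebra.smul_def]
    rw [h4] at h2
    calc a ≤ _ := hle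
      _ ≤ (star z * cut η b * z + η • (star z * z)) + algebraMap ℝ R δ := by gcongr
      _ ≤ (star z * cut η b * z + algebraMap ℝ R (η * ‖z‖ ^ 2)) + algebraMap ℝ R δ := by gcongr
      _ = _ := by rw [h3, map_add]; abel
  have hu := cfc_unit b (ramp_nonneg (η/2) η) (ramp_le_one (η/2) η)
  have hez : e * (y * z) = y * z := by
    rw [← mul_assoc]
    congr 1
    rw [he, hy, cfc_cut b η (by fun_prop) hbs, cmul b (by fun_prop) (by fun_prop)]
    apply cfc_congr
    intro t _
    simp only
    rcases le_total t η with h | h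
    · rw [max_eq_left (by linarith)]; simp
    · rw [ramp_one (by linarith) h, one_mul]
  have h6 := q_comp hσ ha hu.1 hu.2 hez (by positivity) (δ' := δ') (by
    have : η * ‖z‖ ^ 2 < δ' - δ := by
      have h0 := sub_pos.2 hδ'
      rw [hη, div_mul_eq_mul_div, div_lt_iff₀ (by positivity)]
      nlinarith [sq_nonneg ‖z‖]
    linarith) h1 hf
  exact h6.trans (q_ramp_le_D hσ b (by positivity) (by linarith))

lemma D_le_of (hσ : IsQuasitrace σ) {a b : R} (ha : IsSelfAdjoint a) (hb : 0 ≤ b)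
    (h : ∀ ε, 0 < ε → ∃ z, a ≤ star z * b * z + algebraMap ℝ R ε) : D σ a ≤ D σ b := by
  refine D_le fun s hs => ?_
  obtain ⟨z, hz⟩ := h (s / 2) (by positivity)
  exact q_comp_D hσ ha hb (by positivity) (by linarith) hz (adm_ramp (by linarith))

lemma D_mono_conj (hσ : IsQuasitrace σ) {a b : R} (ha : IsSelfAdjoint a) (hb : 0 ≤ b) (z : R)
    (h : a ≤ star z * b * z) : D σ a ≤ D σ b :=
  D_le_of hσ ha hb fun ε hε => ⟨z, h.trans (le_add_of_nonneg_right (algebraMap_nonneg R hε.le))⟩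

lemma D_mono (hσ : IsQuasitrace σ) {a b : R} (ha : IsSelfAdjoint a) (hb : 0 ≤ b)
    (h : a ≤ b) : D σ a ≤ D σ b := D_mono_conj hσ ha hb 1 (by simpa)

lemma D_mono_smul (hσ : IsQuasitrace σ) {a b : R} (ha : IsSelfAdjoint a) (hb : 0 ≤ b) {C : ℝ} (hC : 0 ≤ C)
    (h : a ≤ C • b) : D σ a ≤ D σ b :=
  D_mono_conj hσ ha hb (algebraMap ℝ R (√C)) (by
    have e : star (algebraMap ℝ R (√C)) * b * algebraMap ℝ R (√C) = C • b := by
      rw [(IsSelfAdjoint.algebraMap R (r := √C) rfl).star_eq, Algebra.algebraMap_eq_smul_one]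
      simp [smul_smul, Real.mul_self_sqrt hC]
    rwa [e])

lemma D_swap (hσ : IsQuasitrace σ) (x : R) : D σ (star x * x) = D σ (x * star x) := by
  unfold D
  congr 1; funext s
  exact q_swap hσ x s.2 (adm_ramp (by linarith [s.2]))

lemma q_le_D (hσ : IsQuasitrace σ) {w : R} (h0 : 0 ≤ w) (h1 : w ≤ 1) : q σ w ≤ D σ w := by
  have hws : IsSelfAdjoint w := .of_nonneg h0
  refine le_of_forall_pos_le_add fun ε hε => ?_
  set s := ε / (2 * (q σ 1 + 1)) with hs
  have hq := q1_nonneg hσ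
  have hs0 : 0 < s := by positivity
  have h2 : q σ w ≤ q σ (cfc (fun t => ramp s (2 * s) t + 2 * s) w) := by
    conv_lhs => rw [← cfc_id' ℝ w]
    apply q_cfc_mono hσ (by fun_prop) (by fun_prop)
    intro t ht
    have ht1 : t ≤ 1 := by
      have := (CStarAlgebra.norm_le_one_iff_of_nonneg w h0).2 h1
      exact (spec_bd this ht).2
    rcases le_total t (2 * s) with h | h
    · linarith [ramp_nonneg s (2*s) t]
    · rw [ramp_one (by linarith) h]; linarith
  rw [q_cfc_add hσ w (by fun_prop) (by fun_prop)] at h2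
  have h3 : q σ (cfc (fun _ : ℝ => 2 * s) w) = 2 * s * q σ 1 := by
    rw [cfc_const .., Algebra.algebraMap_eq_smul_one, q_smul hσ (.one R)]
  have h4 := q_ramp_le_D hσ w hs0 (by linarith : s < 2 * s)
  have h5 : 2 * s * q σ 1 ≤ ε := by
    rw [hs]; field_simp; nlinarith
  linarith

lemma cfc_orth_add {x y : R} (hx : IsSelfAdjoint x) (hy : IsSelfAdjoint y) (hxy : x * y = 0)
    {g : ℝ → ℝ} (hg : Continuous g) :
    cfc (fun t => t * g t) (x + y) = cfc (fun t => t * g t) x + cfc (fun t => t * g t) y := by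
  have hyx : y * x = 0 := by
    have := congrArg star hxy
    simpa [star_mul, hx.star_eq, hy.star_eq] using this
  have hxys := hx.add hy
  have e : ∀ a : R, IsSelfAdjoint a → cfc (fun t => t * g t) a = a * cfc g a := fun a ha => by
    rw [← cmul a (by fun_prop) hg, cfc_id' ..]
  rw [e _ hxys, e _ hx, e _ hy, add_mul]
  have h1 := intertwine hx hxys (z := x) (by simp [mul_add, hxy]) hg
  have h2 := intertwine hy hxys (z := y) (by simp [mul_add, hyx]) hg
  rw [← h1, ← h2]
  congr 1
  · exact intertwine hx hx rfl hg
  · exact intertwine hy hy rfl hg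

lemma adm_factor {δ : ℝ} (hδ : 0 < δ) {f : ℝ → ℝ} (hf : Adm δ f) :
    ∃ g : ℝ → ℝ, Continuous g ∧ f = fun t => t * g t := by
  refine ⟨fun t => f t / max t δ, hf.cont.div (by fun_prop) fun t => (lt_max_of_lt_right hδ).ne', ?_⟩
  funext t
  rcases le_total t δ with h | h
  · simp [hf.zero t h]
  · simp only [max_eq_left h]; field_simp [(hδ.trans_le h).ne']

lemma cfc_orth_mul {x y : R} (hx : IsSelfAdjoint x) (hy : IsSelfAdjoint y) (hxy : x * y = 0)
    {f g : ℝ → ℝ} (hf : Continuous f) (hg : Continuous g) (hf0 : f 0 = 0) (hg0 : g 0 = 0) :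
    cfc f x * cfc g y = 0 := by
  have h1 : cfc f x * y = 0 := by
    rw [cfc_mul_eigen (r := 0) hx (by simpa using hxy) hf, hf0, zero_smul]
  have h2 : y * cfc f x = 0 := by
    have := congrArg star h1
    simpa [star_mul, hy.star_eq, (cfc_sa f x).star_eq] using this
  have h3 : cfc g y * cfc f x = 0 := by
    rw [cfc_mul_eigen (r := 0) hy (by simpa using h2) hg, hg0, zero_smul]
  have := congrArg star h3
  simpa [star_mul, (cfc_sa g y).star_eq, (cfc_sa f x).star_eq] using this

lemma orth_comm {x y : R} (hx : IsSelfAdjoint x) (hy : IsSelfAdjoint y) (hxy : x * y = 0) :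
    Commute x y := by
  have := congrArg star hxy
  rw [star_mul, hx.star_eq, hy.star_eq, star_zero] at this
  rw [Commute, SemiconjBy, hxy, this]

lemma q_orth_add (hσ : IsQuasitrace σ) {x y : R} (hx : IsSelfAdjoint x) (hy : IsSelfAdjoint y)
    (hxy : x * y = 0) {δ : ℝ} (hδ : 0 < δ) {f : ℝ → ℝ} (hf : Adm δ f) :
    q σ (cfc f (x + y)) = q σ (cfc f x) + q σ (cfc f y) := by
  have hf0 := hf.zero 0 hδ.le
  have h := cfc_orth_mul hx hy hxy hf.cont hf.cont hf0 hf0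
  obtain ⟨g, hg, e⟩ := adm_factor hδ hf
  have e2 : cfc f (x + y) = cfc f x + cfc f y := by rw [e]; exact cfc_orth_add hx hy hxy hg
  rw [e2, q_add hσ (cfc_sa _ _) (cfc_sa _ _) (orth_comm (cfc_sa _ _) (cfc_sa _ _) h)]

lemma D_orth (hσ : IsQuasitrace σ) {x y : R} (hx : IsSelfAdjoint x) (hy : IsSelfAdjoint y)
    (hxy : x * y = 0) : D σ (x + y) = D σ x + D σ y := by
  apply le_antisymm
  · refine D_le fun s hs => ?_
    rw [q_orth_add hσ hx hy hxy hs (adm_ramp (by linarith))]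
    exact add_le_add (q_ramp_le_D hσ x hs (by linarith)) (q_ramp_le_D hσ y hs (by linarith))
  · rw [← le_sub_iff_add_le]
    refine D_le fun s hs => ?_
    rw [le_sub_iff_add_le, ← le_sub_iff_add_le']
    refine D_le fun s' hs' => ?_
    rw [le_sub_iff_add_le']
    have key : ∀ a : R, ∀ t, min s s' ≤ t → q σ (cfc (ramp t (2 * t)) a) ≤
        q σ (cfc (ramp (min s s' / 2) (min s s')) a) := by
      intro a t ht
      have h0 : 0 < min s s' := lt_min hs hs'
      apply q_cfc_mono hσ (by fun_prop) (by fun_prop)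
      intro u _
      rcases le_total u t with h | h
      · rw [ramp_zero (by linarith) h]; exact ramp_nonneg _ _ _
      · rw [ramp_one (α := min s s' / 2) (by linarith) (by linarith)]; exact ramp_le_one _ _ _
    have h0 : 0 < min s s' := lt_min hs hs'
    have h1 := q_orth_add hσ hx hy hxy (half_pos h0) (adm_ramp (half_lt_self h0))
    have h2 := q_ramp_le_D hσ (x + y) (half_pos h0) (half_lt_self h0)
    have h3 := key x s (min_le_left _ _)
    have h4 := key y s' (min_le_right _ _)
    linarith

lemma cut_zero {a : R} (ha : 0 ≤ a) : cut 0 a = a := by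
  rw [cut]
  conv_rhs => rw [← cfc_id' ℝ a]
  exact cfc_congr fun t ht => by simp [spec_nonneg ha ht]

lemma D_lsc (hσ : IsQuasitrace σ) (a : R) (ha : IsSelfAdjoint a) {c : ℝ} (h : ∀ s, 0 < s → D σ (cut s a) ≤ c) :
    D σ a ≤ c := by
  refine D_le fun s hs => ?_
  have h1 : q σ (cfc (ramp s (2 * s)) a) ≤ q σ (cfc (ramp (s/4) (s/2)) (cut (s / 2) a)) := by
    rw [cfc_cut a _ (by fun_prop) ha]
    apply q_cfc_mono hσ (by fun_prop) (by fun_prop)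
    intro t _
    rcases le_total t s with h | h
    · rw [ramp_zero (by linarith) h]; exact ramp_nonneg _ _ _
    · have : s / 2 ≤ max 0 (t - s / 2) := le_max_of_le_right (by linarith)
      rw [ramp_one (α := s/4) (by linarith) this]; exact ramp_le_one _ _ _
  exact h1.trans ((q_ramp_le_D hσ _ (by linarith) (by linarith)).trans (h _ (by linarith)))

lemma D_cut_le_q (hσ : IsQuasitrace σ) {a : R} (ha : IsSelfAdjoint a) {α β : ℝ} (h : α < β) :
    D σ (cut β a) ≤ q σ (cfc (ramp α β) a) := by
  refine D_le fun s hs => ?_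
  rw [cfc_cut a _ (by fun_prop) ha]
  apply q_cfc_mono hσ (by fun_prop) (by fun_prop)
  intro t _
  rcases le_total t β with h' | h'
  · rw [max_eq_left (by linarith), ramp_zero (by linarith) hs.le]; exact ramp_nonneg _ _ _
  · rw [ramp_one h h']; exact ramp_le_one _ _ _

lemma q_le_D_cut (hσ : IsQuasitrace σ) {a : R} (ha : IsSelfAdjoint a) {α β : ℝ} (h : α < β) :
    q σ (cfc (ramp α β) a) ≤ D σ (cut α a) := by
  have hu := cfc_unit a (ramp_nonneg α β) (ramp_le_one α β)
  refine (q_le_D hσ hu.1 hu.2).trans ?_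
  refine D_mono_smul hσ (cfc_sa _ _) (cut_nonneg _ _) (C := (β - α)⁻¹) (by have := sub_pos.2 h; positivity) ?_
  rw [cut, ← cfc_smul ..]
  refine cfc_mono fun t _ => ?_
  have := sub_pos.2 h
  simp only [ramp, smul_eq_mul]
  rw [mul_max_of_nonneg _ _ (by positivity), mul_zero]
  refine max_le_max le_rfl ((min_le_right _ _).trans (le_of_eq ?_))
  field_simp

lemma D_cut_anti (hσ : IsQuasitrace σ) {a : R} (ha : IsSelfAdjoint a) {s t : ℝ} (h : s ≤ t) :
    D σ (cut t a) ≤ D σ (cut s a) := by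
  refine D_mono hσ (.of_nonneg (cut_nonneg _ _)) (cut_nonneg _ _) ?_
  exact cfc_mono fun x _ => max_le_max le_rfl (by linarith)

lemma D_cut_le (hσ : IsQuasitrace σ) {a : R} (ha : 0 ≤ a) {s : ℝ} (h : 0 ≤ s) :
    D σ (cut s a) ≤ D σ a := by
  have := D_cut_anti hσ (.of_nonneg ha) h
  rwa [cut_zero ha] at this

/-- layer decomposition of a positive contraction -/
lemma riemann_sum {x : R} (h0 : 0 ≤ x) (h1 : x ≤ 1) {n : ℕ} (hn : 0 < n) :
    x = ∑ k ∈ Finset.range n, (1 / (n : ℝ)) • cfc (ramp ((k : ℝ) / n) (((k : ℝ) + 1) / n)) x := by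
  have hxs : IsSelfAdjoint x := .of_nonneg h0
  have hn' : (0 : ℝ) < n := by exact_mod_cast hn
  have e : ∀ m : ℕ, ∑ k ∈ Finset.range m, (1 / (n : ℝ)) • cfc (ramp ((k : ℝ) / n) (((k : ℝ) + 1) / n)) x
      = cfc (fun t => min (max (0:ℝ) t) ((m : ℝ) / n)) x := by
    intro m
    induction m with
    | zero =>
      have : (fun t : ℝ => min (max 0 t) (((0:ℕ):ℝ) / n)) = fun _ => 0 := by funext t; simp
      rw [this]; simp
    | succ m ih =>
      rw [Finset.sum_range_succ, ih, csmul _ x (by fun_prop), cadd x (by fun_prop) (by fun_prop)]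
      apply cfc_congr
      intro t _
      simp only [ramp]
      have hd : ((m:ℝ) + 1) / n - m / n = 1 / n := by field_simp; ring
      have : (1 / (n:ℝ)) * max 0 (min 1 ((t - m / n) / (((m:ℝ) + 1) / n - m / n))) =
          max 0 (min (1 / (n:ℝ)) (t - m / n)) := by
        rw [hd, mul_max_of_nonneg _ _ (by positivity), mul_zero, mul_min_of_nonneg _ _ (by positivity)]
        congr 2
        · ring
        · rw [mul_div_cancel₀ _ (by positivity)]
      rw [this]
      have hm : (0:ℝ) ≤ m / n := by positivity
      have h1n : (0:ℝ) < 1 / n := by positivity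
      have h2 : ((m + 1 : ℕ) : ℝ) / n = m / n + 1 / n := by push_cast; ring
      rw [h2]
      generalize (m:ℝ)/n = a at *
      generalize (1:ℝ)/n = b at *
      rcases le_total t a with ht | ht
      · rw [max_eq_left (a := (0:ℝ)) (b := min b (t - a)) ((min_le_right _ _).trans (by linarith)),
          min_eq_left (max_le hm ht), min_eq_left (max_le (by linarith) (by linarith)), add_zero]
      · rw [max_eq_right (hm.trans ht), min_eq_right ht,
          max_eq_right (le_min h1n.le (by linarith))]
        rcases le_total t (a + b) with h | h
        · rw [min_eq_left h, min_eq_right (by linarith)]; ring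
        · rw [min_eq_right h, min_eq_left (by linarith)]
  rw [e n]
  conv_lhs => rw [← cfc_id' ℝ x]
  apply cfc_congr
  intro t ht
  have h2 : t ≤ 1 := (spec_bd ((CStarAlgebra.norm_le_one_iff_of_nonneg x h0).2 h1) ht).2
  have h3 := spec_nonneg h0 ht
  simp only
  rw [div_self hn'.ne', max_eq_right h3, min_eq_left h2]

end
end QT

namespace QT
section
open scoped ComplexStarModule
variable {R : Type*} [CStarAlgebra R] {σ : R → ℂ} [PartialOrder R] [StarOrderedRing R]

lemma D_cut_comp (hσ : IsQuasitrace σ) {a b z : R} (ha : IsSelfAdjoint a) (hb : 0 ≤ b)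
    {δ δ' : ℝ} (hδ : 0 ≤ δ) (hδ' : δ < δ') (hle : a ≤ star z * b * z + algebraMap ℝ R δ) :
    D σ (cut δ' a) ≤ D σ b := by
  refine (D_cut_le_q hσ ha (α := (δ + δ') / 2) (by linarith)).trans ?_
  exact q_comp_D hσ ha hb hδ (by linarith) hle (adm_ramp (by linarith))

lemma D_cut_swap (hσ : IsQuasitrace σ) (x : R) {s : ℝ} (hs : 0 ≤ s) :
    D σ (cut s (star x * x)) = D σ (cut s (x * star x)) := by
  unfold D
  congr 1; funext t
  have ht := t.2
  rw [cfc_cut _ _ (by fun_prop) (.star_mul_self x), cfc_cut _ _ (by fun_prop) (.mul_star_self x)]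
  refine q_swap hσ x ht ⟨by fun_prop, fun _ => ramp_nonneg _ _ _, fun _ => ramp_le_one _ _ _, ?_⟩
  intro u hu
  exact ramp_zero (by linarith) (max_le ht.le (by linarith))

lemma sum_sq_le (u v : R) :
    star (u + v) * (u + v) ≤ (2:ℝ) • (star u * u) + (2:ℝ) • (star v * v) := by
  have h := star_mul_self_nonneg (u - v)
  rw [← sub_nonneg]
  convert h using 1
  simp only [star_add, star_sub, two_smul]
  noncomm_ring

structure Corner (P Q w : R) : Prop where
  ww : star w * w = P
  ww' : w * star w = Q
  add : P + Q = 1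
  PP : P * P = P

namespace Corner
variable {P Q w : R}
lemma Ps (h : Corner P Q w) : IsSelfAdjoint P := h.ww ▸ .star_mul_self w
lemma Qs (h : Corner P Q w) : IsSelfAdjoint Q := h.ww' ▸ .mul_star_self w
lemma P0 (h : Corner P Q w) : 0 ≤ P := h.ww ▸ star_mul_self_nonneg w
lemma Q0 (h : Corner P Q w) : 0 ≤ Q := h.ww' ▸ mul_star_self_nonneg w
lemma Qeq (h : Corner P Q w) : Q = 1 - P := eq_sub_of_add_eq' h.add
lemma QQ (h : Corner P Q w) : Q * Q = Q := by rw [h.Qeq]; simp [mul_sub, sub_mul, h.PP]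
lemma PQ (h : Corner P Q w) : P * Q = 0 := by rw [h.Qeq]; simp [mul_sub, h.PP]
lemma QP (h : Corner P Q w) : Q * P = 0 := by rw [h.Qeq]; simp [sub_mul, h.PP]
lemma symm (h : Corner P Q w) : Corner Q P (star w) :=
  ⟨by rw [star_star, h.ww'], by rw [star_star, h.ww], by rw [add_comm, h.add], h.QQ⟩
lemma wQ (h : Corner P Q w) : w * Q = 0 := by
  rw [← CStarRing.star_mul_self_eq_zero_iff, star_mul, h.Qs.star_eq]
  calc _ = Q * (star w * w) * Q := by simp only [mul_assoc]
    _ = 0 := by rw [h.ww, h.QP, zero_mul]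
lemma wP (h : Corner P Q w) : w * P = w := by
  have := h.wQ
  rw [h.Qeq, mul_sub, mul_one, sub_eq_zero] at this; exact this.symm
lemma Pw (h : Corner P Q w) : P * w = 0 := by
  have := congrArg star h.symm.wQ
  simpa [h.Ps.star_eq] using this
lemma Qw (h : Corner P Q w) : Q * w = w := by
  have := congrArg star h.symm.wP
  simpa [h.Qs.star_eq] using this
lemma P1 (h : Corner P Q w) : P ≤ 1 := by rw [← h.add]; exact le_add_of_nonneg_right h.Q0
lemma Q1 (h : Corner P Q w) : Q ≤ 1 := h.symm.P1

lemma orth (h : Corner P Q w) {x y : R} (hx : x * P = x) (hy : Q * y = y) : x * y = 0 := by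
  rw [← hx, ← hy, mul_assoc, ← mul_assoc P, h.PQ]; simp

end Corner

lemma eigen_cfc {x p : R} (hx : IsSelfAdjoint x) (hxp : x * p = x) {f : ℝ → ℝ} (hf : Continuous f) (h0 : f 0 = 0) :
    cfc f x * p = cfc f x := by
  have := cfc_mul_eigen (Y := x) (y := 1 - p) (r := 0) hx (by simp [mul_sub, hxp]) hf
  rw [h0, zero_smul, mul_sub, mul_one, sub_eq_zero] at this
  exact this.symm

lemma star_eq_of {x p : R} (hx : IsSelfAdjoint x) (hp : IsSelfAdjoint p) (h : x * p = x) : p * x = x := by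
  have := congrArg star h
  simpa [star_mul, hx.star_eq, hp.star_eq] using this

variable {P Q w : R}

lemma D_add_corner (hσ : IsQuasitrace σ) (h : Corner P Q w) {x y : R} (hx : 0 ≤ x) (hy : 0 ≤ y)
    (hxP : x * P = x) (hyP : y * P = y) : D σ (x + y) ≤ D σ x + D σ y := by
  set u := cfc Real.sqrt x with hu
  set v := cfc Real.sqrt y with hv
  have hxs : IsSelfAdjoint x := .of_nonneg hx
  have hys : IsSelfAdjoint y := .of_nonneg hy
  have hus : IsSelfAdjoint u := cfc_sa _ _
  have hvs : IsSelfAdjoint v := cfc_sa _ _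
  have huu : u * u = x := sq_sqrt hx
  have hvv : v * v = y := sq_sqrt hy
  have huP : u * P = u := eigen_cfc hxs hxP (by fun_prop) (by simp)
  have hvP : v * P = v := eigen_cfc hys hyP (by fun_prop) (by simp)
  have hPv := star_eq_of hvs h.Ps hvP
  have huw : u * w = 0 := by rw [← huP, mul_assoc, h.Pw, mul_zero]
  have hwu : star w * u = 0 := by
    have := congrArg star huw; simpa [hus.star_eq] using this
  set z := u + v * star w with hz
  have hzs : star z = u + w * v := by simp [hz, hus.star_eq, hvs.star_eq]
  have e1 : z * star z = x + y := by
    rw [hzs, hz, add_mul, mul_add, mul_add, huu, ← mul_assoc u w v, huw, mul_assoc v _ u, hwu,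
      mul_assoc v, ← mul_assoc (star w), h.ww, hPv, hvv]
    simp
  have e2 : star z * z ≤ (2:ℝ) • (x + w * y * star w) := by
    have := sum_sq_le u (v * star w)
    rw [hus.star_eq, huu, star_mul, star_star, hvs.star_eq] at this
    have e : w * v * (v * star w) = w * y * star w := by rw [← hvv]; simp only [mul_assoc]
    rw [e, ← smul_add] at this
    exact this
  have hwy : 0 ≤ w * y * star w := by
    have := conj_nonneg hy (star w); rwa [star_star] at this
  have hxw : x * (w * y * star w) = 0 := by
    rw [← huu]; simp only [← mul_assoc]; rw [mul_assoc u u w, huw]; simp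
  rw [← e1, ← D_swap hσ]
  calc _ ≤ D σ (x + w * y * star w) :=
        D_mono_smul hσ (.star_mul_self z) (add_nonneg hx hwy) (by norm_num) e2
    _ = D σ x + D σ (w * y * star w) := D_orth hσ hxs (.of_nonneg hwy) hxw
    _ ≤ D σ x + D σ y := by
        gcongr
        exact D_mono_conj hσ (.of_nonneg hwy) hy (star w) (by rw [star_star])

noncomputable def hfun (ε t : ℝ) : ℝ := ε / (max t 0 + ε)
lemma hfun_cont {ε : ℝ} (hε : 0 < ε) : Continuous (hfun ε) := by
  unfold hfun
  apply Continuous.div (by fun_prop) (by fun_prop)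
  intro t; have := le_max_right t 0; linarith

/-- approximate Schur complement -/
noncomputable def Sch (P Q : R) (ε : ℝ) (z : R) : R :=
  P * cfc Real.sqrt z * cfc (hfun ε) (cfc Real.sqrt z * Q * cfc Real.sqrt z) * cfc Real.sqrt z * P

lemma hfun_nonneg {ε : ℝ} (hε : 0 < ε) (t : ℝ) : 0 ≤ hfun ε t :=
  div_nonneg hε.le (by have := le_max_right t 0; linarith)
lemma hfun_le_one {ε : ℝ} (hε : 0 < ε) (t : ℝ) : hfun ε t ≤ 1 := by
  have := le_max_right t 0
  rw [hfun, div_le_one (by linarith)]; linarith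

lemma Sch_nonneg (h : Corner P Q w) {ε : ℝ} (hε : 0 < ε) (z : R) : 0 ≤ Sch P Q ε z := by
  have h1 : 0 ≤ cfc (hfun ε) (cfc Real.sqrt z * Q * cfc Real.sqrt z) :=
    cfc_nonneg fun t _ => hfun_nonneg hε t
  have := conj_nonneg h1 (cfc Real.sqrt z * P)
  rw [star_mul, h.Ps.star_eq, (cfc_sa Real.sqrt z).star_eq] at this
  simpa only [Sch, mul_assoc] using this

lemma Sch_P (h : Corner P Q w) (ε : ℝ) (z : R) : Sch P Q ε z * P = Sch P Q ε z := by
  simp only [Sch, mul_assoc, h.PP]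

lemma gauss_upper (hσ : IsQuasitrace σ) (h : Corner P Q w) {z s' : R} (hz : 0 ≤ z) (hs' : 0 ≤ s')
    (hsP : s' * P = s') {ε η δ' : ℝ} (hε : 0 < ε) (hη : 0 < η) (hδ' : 2 * η < δ')
    {f : ℝ → ℝ} (hf : Adm δ' f) :
    q σ (cfc f (z + s')) ≤ D σ (Q * z * Q) + D σ (cut η (Sch P Q ε z)) + D σ s' := by
  have hsps : P * s' = s' := star_eq_of (.of_nonneg hs') h.Ps hsP
  set T := cfc Real.sqrt z with hT
  have hTs : IsSelfAdjoint T := cfc_sa _ _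
  have hTT : T * T = z := sq_sqrt hz
  set y := T * Q * T with hy
  have hy0 : 0 ≤ y := by have := conj_nonneg h.Q0 T; rwa [hTs.star_eq] at this
  have hys : IsSelfAdjoint y := .of_nonneg hy0
  set k := cfc (fun t => (max t 0 + ε)⁻¹) y with hk
  have hkc : Continuous fun t : ℝ => (max t 0 + ε)⁻¹ := by
    apply Continuous.inv₀ (by fun_prop)
    intro t; have := le_max_right t 0; linarith
  set hh := cfc (hfun ε) y with hhh
  have hhs : IsSelfAdjoint hh := cfc_sa _ _
  have e1 : y * k + hh = 1 := by
    have : y * k = cfc (fun t => t * (max t 0 + ε)⁻¹) y := by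
      rw [hk, ← cmul y (by fun_prop) hkc, cfc_id' ..]
    rw [this, hhh, cadd y (by fun_prop) (hfun_cont hε), ← cfc_const_one ℝ y]
    apply cfc_congr
    intro t ht
    have ht := spec_nonneg hy0 ht
    simp only [hfun, max_eq_left ht]
    field_simp
  set K := Q * T * k * T * P with hK
  set U := T * Q * (1 + K) with hU
  set V := hh * T * P with hV
  have e2 : T = U + V := by
    have e3 : T * Q * K = y * k * (T * P) := by
      simp only [hK, hy, mul_assoc]; rw [← mul_assoc Q Q, h.QQ]
    have e4 : T = T * Q + T * P := by rw [← mul_add, add_comm, h.add, mul_one]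
    rw [hU, mul_add, mul_one, e3, hV]
    calc T = T * Q + (y * k + hh) * (T * P) := by rw [e1, one_mul]; exact e4
      _ = _ := by noncomm_ring
  have hVV : star V * V ≤ Sch P Q ε z := by
    have h1 : hh * hh ≤ hh := by
      rw [hhh, cmul y (hfun_cont hε) (hfun_cont hε)]
      refine cfc_mono (fun t _ => ?_) (by have := hfun_cont hε; fun_prop) (by have := hfun_cont hε; fun_prop)
      have := hfun_nonneg hε t; have := hfun_le_one hε t
      nlinarith
    have h2 := conj_le h1 (T * P)
    rw [star_mul, h.Ps.star_eq, hTs.star_eq] at h2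
    have e3 : Sch P Q ε z = P * T * hh * (T * P) := by simp only [Sch, hhh, hy, hT, mul_assoc]
    rw [e3]
    simpa only [hV, star_mul, h.Ps.star_eq, hTs.star_eq, hhs.star_eq, mul_assoc] using h2
  set S := Sch P Q ε z with hS
  have hS0 : 0 ≤ S := Sch_nonneg h hε z
  have hSs : IsSelfAdjoint S := .of_nonneg hS0
  set s2 := cut η S + s' with hs2
  have hcP : cut η S * P = cut η S :=
    eigen_cfc hSs (Sch_P h ε z) (by fun_prop) (by simp [hη.le])
  have hs2P : s2 * P = s2 := by rw [hs2, add_mul, hcP, hsP]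
  have hs20 : 0 ≤ s2 := add_nonneg (cut_nonneg _ _) hs'
  have hPs2 := star_eq_of (.of_nonneg hs20) h.Ps hs2P
  have hs2K : s2 * K = 0 := h.orth hs2P (by simp only [hK, ← mul_assoc, h.QQ])
  have hKs2 : star K * s2 = 0 := by
    have := congrArg star hs2K; rwa [star_mul, (IsSelfAdjoint.of_nonneg hs20).star_eq, star_zero] at this
  have e5 : star U * U + s2 = star (1 + K) * (Q * z * Q + s2) * (1 + K) := by
    have : star (1 + K) * s2 * (1 + K) = s2 := by
      rw [star_add, star_one, add_mul, hKs2, one_mul, add_zero, mul_add, mul_one, hs2K, add_zero]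
    rw [mul_add (star (1 + K)) (Q * z * Q) s2, add_mul (star (1 + K) * (Q * z * Q)), this, hU, star_mul, star_mul, h.Qs.star_eq, hTs.star_eq, ← hTT]
    simp only [mul_assoc]
  have hQz : 0 ≤ Q * z * Q := by have := conj_nonneg hz Q; rwa [h.Qs.star_eq] at this
  have h6 : z + s' ≤ star ((√2 : ℝ) • (1 + K)) * (Q * z * Q + s2) * ((√2:ℝ) • (1 + K)) +
      algebraMap ℝ R (2 * η) := by
    have e6 : star ((√2 : ℝ) • (1 + K)) * (Q * z * Q + s2) * ((√2:ℝ) • (1 + K)) =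
        (2:ℝ) • (star U * U + s2) := by
      rw [e5, star_smul, star_trivial, smul_mul_assoc, smul_mul_assoc, mul_smul_comm, smul_smul,
        Real.mul_self_sqrt (by norm_num)]
    have h7 : z ≤ (2:ℝ) • (star U * U) + (2:ℝ) • (star V * V) := by
      have := sum_sq_le U V
      rwa [← e2, hTs.star_eq, hTT] at this
    have h8 : (2:ℝ) • (star V * V) ≤ (2:ℝ) • (cut η S + algebraMap ℝ R η) :=
      smul_le_smul_of_nonneg_left (hVV.trans (le_cut hSs η)) (by norm_num)
    have h9 : s' ≤ (2:ℝ) • s' := by rw [two_smul]; exact le_add_of_nonneg_right hs'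
    calc z + s' ≤ ((2:ℝ) • (star U * U) + (2:ℝ) • (cut η S + algebraMap ℝ R η)) + (2:ℝ) • s' := by
          refine add_le_add (h7.trans ?_) h9
          gcongr
      _ = _ := by
          rw [e6, hs2, map_mul, ← Algebra.smul_def]
          simp only [smul_add]; abel
  have h10 := q_comp_D hσ (.of_nonneg (add_nonneg hz hs')) (add_nonneg hQz hs20) (by positivity) hδ' h6 hf
  have h11 : D σ (s2 + Q * z * Q) = D σ s2 + D σ (Q * z * Q) :=
    D_orth hσ (.of_nonneg hs20) (.of_nonneg hQz) (h.orth hs2P (by simp only [← mul_assoc, h.QQ]))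
  rw [add_comm (Q * z * Q) s2, h11] at h10
  have h12 := D_add_corner hσ h (cut_nonneg η S) hs' hcP hsP
  linarith

lemma gauss_lower (hσ : IsQuasitrace σ) (h : Corner P Q w) {z : R} (hz : 0 ≤ z)
    {ε η s : ℝ} (hε : 0 < ε) (hs : 0 < s) (hsm : 2 * ε / s * ‖z‖ < η) :
    D σ (cut s (Q * z * Q)) + D σ (cut η (Sch P Q ε z)) ≤ D σ z := by
  set T := cfc Real.sqrt z with hT
  have hTs : IsSelfAdjoint T := cfc_sa _ _
  have hTT : T * T = z := sq_sqrt hz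
  set y := T * Q * T with hy
  have hy0 : 0 ≤ y := by have := conj_nonneg h.Q0 T; rwa [hTs.star_eq] at this
  have hys : IsSelfAdjoint y := .of_nonneg hy0
  obtain ⟨k, hkc, hk⟩ := adm_factor (half_pos hs) (adm_ramp (half_lt_self hs))
  set g := cfc (fun t => 1 - ramp (s / 2) s t) y with hg
  have hgs : IsSelfAdjoint g := cfc_sa _ _
  have hg1 : g = 1 - y * cfc k y := by
    have : y * cfc k y = cfc (ramp (s/2) s) y := by
      rw [hk, ← cmul y (by fun_prop) hkc, cfc_id' ..]
    rw [this, one_sub_cfc hys (by fun_prop)]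
  set m := 1 - Q * T * cfc k y * T with hm
  have hgT : g * T = T * m := by
    rw [hg1, hm, hy]; noncomm_ring
  set V := g * T * P with hV
  set E1 := cut s y with hE1
  set E2 := V * star V with hE2
  have hE20 : 0 ≤ E2 := mul_star_self_nonneg V
  have e12 : E1 * E2 = 0 := by
    have : E1 * g = 0 := by
      rw [hE1, hg, cut, cmul y (by fun_prop) (by fun_prop)]
      have : (fun t => max 0 (t - s) * (1 - ramp (s/2) s t)) = fun _ => (0:ℝ) := by
        funext t
        rcases le_total t s with ht | ht
        · rw [max_eq_left (by linarith), zero_mul]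
        · rw [ramp_one (by linarith) ht]; simp
      rw [this]; simp
    rw [hE2, hV]; simp only [← mul_assoc]; rw [this]; simp
  have hE1z : E1 ≤ z := by
    have h1 : E1 ≤ y := by
      conv_rhs => rw [← cfc_id' ℝ y]
      refine cfc_mono fun t ht => max_le (spec_nonneg hy0 ht) (by linarith)
    have h2 := conj_le h.Q1 T
    rw [hTs.star_eq, mul_one, hTT] at h2
    exact h1.trans h2
  have hE2z : E2 ≤ (‖star m‖ ^ 2) • z := by
    have h1 : E2 ≤ (g * T) * star (g * T) := by
      have := conj_le h.P1 (star (g * T))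
      rw [star_star, mul_one] at this
      have e : E2 = g * T * P * star (g * T) := by
        rw [hE2, hV, star_mul _ P, h.Ps.star_eq, ← mul_assoc, mul_assoc _ P P, h.PP]
      rwa [e]
    have h2 := conj_le (star_mul_le (star m)) T
    rw [star_star, hTs.star_eq, Algebra.algebraMap_eq_smul_one] at h2
    simp only [mul_smul_comm, smul_mul_assoc, mul_one, hTT] at h2
    rw [hgT, star_mul, hTs.star_eq] at h1
    refine h1.trans ?_
    simpa only [mul_assoc] using h2
  have h1 : D σ (E1 + E2) ≤ D σ z := by
    refine D_mono_smul hσ ((IsSelfAdjoint.of_nonneg (cut_nonneg _ _)).add (.of_nonneg hE20)) hz (C := 1 + ‖star m‖ ^ 2)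
      (by positivity) ?_
    rw [add_smul, one_smul]; exact add_le_add hE1z hE2z
  rw [D_orth hσ (.of_nonneg (cut_nonneg _ _)) (.of_nonneg hE20) e12] at h1
  have h2 : D σ (cut s (Q * z * Q)) = D σ E1 := by
    have := D_cut_swap hσ (T * Q) hs.le
    rw [star_mul, hTs.star_eq, h.Qs.star_eq] at this
    have e1 : Q * T * (T * Q) = Q * z * Q := by rw [← hTT]; simp only [mul_assoc]
    have e2 : T * Q * (Q * T) = y := by rw [hy]; simp only [mul_assoc]; rw [← mul_assoc Q Q, h.QQ]
    rw [e1, e2] at this; exact this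
  have h3 : D σ (cut η (Sch P Q ε z)) ≤ D σ (star V * V) := by
    have hle : Sch P Q ε z ≤ star (1:R) * (star V * V) * 1 + algebraMap ℝ R (2 * ε / s * ‖z‖) := by
      have h4 : cfc (hfun ε) y ≤ g * g + algebraMap ℝ R (2 * ε / s) := by
        have h5 : cfc (fun _ : ℝ => 2 * ε / s) y = algebraMap ℝ R (2 * ε / s) := cfc_const _ y
        rw [hg, cmul y (by fun_prop) (by fun_prop), ← h5, cadd y (by fun_prop) (by fun_prop)]
        refine cfc_mono (fun t ht => ?_) (hfun_cont hε).continuousOn (by fun_prop)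
        have ht := spec_nonneg hy0 ht
        rcases le_total t (s/2) with h' | h'
        · rw [ramp_zero (by linarith) h']
          have := hfun_le_one hε t
          have : 0 ≤ 2 * ε / s := by positivity
          linarith
        · have : hfun ε t ≤ 2 * ε / s := by
            rw [hfun, max_eq_left ht, div_le_div_iff₀ (by linarith) hs]
            nlinarith
          nlinarith [sq_nonneg (1 - ramp (s/2) s t)]
      have h5 := conj_le h4 (T * P)
      rw [mul_add, add_mul, star_mul, h.Ps.star_eq, hTs.star_eq] at h5
      have e1 : P * T * (g * g) * (T * P) = star V * V := by
        simp only [hV, star_mul, h.Ps.star_eq, hTs.star_eq, hgs.star_eq, mul_assoc]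
      have e2 : P * T * algebraMap ℝ R (2 * ε / s) * (T * P) = (2 * ε / s) • (P * z * P) := by
        rw [Algebra.algebraMap_eq_smul_one, ← hTT]; simp [mul_assoc]
      have e3 : (2 * ε / s) • (P * z * P) ≤ algebraMap ℝ R (2 * ε / s * ‖z‖) := by
        rw [map_mul, ← Algebra.smul_def]
        refine smul_le_smul_of_nonneg_left ?_ (by positivity)
        have h6 := conj_le ((IsSelfAdjoint.of_nonneg hz).le_algebraMap_norm_self) P
        rw [h.Ps.star_eq, Algebra.algebraMap_eq_smul_one] at h6
        simp only [mul_smul_comm, smul_mul_assoc, mul_one, h.PP] at h6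
        refine h6.trans ?_
        rw [Algebra.algebraMap_eq_smul_one]
        exact smul_le_smul_of_nonneg_left h.P1 (norm_nonneg _)
      rw [star_one, one_mul, mul_one]
      calc Sch P Q ε z = P * T * cfc (hfun ε) y * (T * P) := by simp only [Sch, mul_assoc, hy, hT]
        _ ≤ _ := h5
        _ ≤ _ := by rw [e1, e2]; gcongr
    exact D_cut_comp hσ (.of_nonneg (Sch_nonneg h hε z)) (star_mul_self_nonneg V) (by positivity) hsm hle
  rw [D_swap hσ V] at h3
  rw [h2]
  linarith

end
end QT

namespace QT
section
open scoped ComplexStarModule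
variable {R : Type*} [CStarAlgebra R] {σ : R → ℂ} [PartialOrder R] [StarOrderedRing R]
variable {P Q w : R}

lemma D_lsc_exists (hσ : IsQuasitrace σ) {a : R} (ha : IsSelfAdjoint a) {θ : ℝ} (hθ : 0 < θ) :
    ∃ s₀, 0 < s₀ ∧ ∀ s, s ≤ s₀ → D σ a ≤ D σ (cut s a) + θ := by
  by_contra hcon
  push Not at hcon
  have : D σ a ≤ D σ a - θ := by
    refine D_lsc hσ a ha fun s hs => ?_
    obtain ⟨s', h1, h2⟩ := hcon s hs
    have := D_cut_anti hσ ha h1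
    linarith
  linarith

lemma D_add_P (hσ : IsQuasitrace σ) (h : Corner P Q w) {z s' : R} (hz : 0 ≤ z) (hs' : 0 ≤ s')
    (hsP : s' * P = s') : D σ (z + s') ≤ D σ z + D σ s' := by
  refine le_of_forall_pos_le_add fun θ hθ => ?_
  refine D_le fun s hs => ?_
  have hQz : 0 ≤ Q * z * Q := by have := conj_nonneg hz Q; rwa [h.Qs.star_eq] at this
  obtain ⟨s₁, hs₁, h1⟩ := D_lsc_exists hσ (.of_nonneg hQz) hθ
  have h1 := h1 s₁ le_rfl
  set ε := s / 4 * s₁ / (2 * (‖z‖ + 1)) / 2 with hε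
  have hε0 : 0 < ε := by positivity
  have hsm : 2 * ε / s₁ * ‖z‖ < s / 4 := by
    have : 2 * ε / s₁ * ‖z‖ = s / 4 * (‖z‖ / (2 * (‖z‖ + 1))) := by rw [hε]; field_simp
    rw [this]
    have h2 : ‖z‖ / (2 * (‖z‖ + 1)) < 1 := by
      rw [div_lt_one (by positivity)]; linarith [norm_nonneg z]
    nlinarith
  have h2 := gauss_lower hσ h hz hε0 hs₁ hsm
  have h3 := gauss_upper hσ h hz hs' hsP hε0 (by positivity : 0 < s / 4) (δ' := s) (by linarith)
    (adm_ramp (by linarith : s < 2 * s))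
  linarith

lemma D_smul_le (hσ : IsQuasitrace σ) {a : R} (ha : 0 ≤ a) {C : ℝ} (hC : 0 ≤ C) :
    D σ (C • a) ≤ D σ a :=
  D_mono_smul hσ (.of_nonneg (smul_nonneg hC ha)) ha hC le_rfl

lemma D_add_two (hσ : IsQuasitrace σ) (h : Corner P Q w) {z y : R} (hz : 0 ≤ z) (hy : 0 ≤ y) :
    D σ (z + y) ≤ D σ z + 2 * D σ y := by
  have hPy : 0 ≤ P * y * P := by have := conj_nonneg hy P; rwa [h.Ps.star_eq] at this
  have hQy : 0 ≤ Q * y * Q := by have := conj_nonneg hy Q; rwa [h.Qs.star_eq] at this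
  have h1 : y ≤ (2:ℝ) • (P * y * P) + (2:ℝ) • (Q * y * Q) := by
    set T := cfc Real.sqrt y with hT
    have hTs : IsSelfAdjoint T := cfc_sa _ _
    have hTT : T * T = y := sq_sqrt hy
    have := sum_sq_le (T * P) (T * Q)
    rw [← mul_add, h.add, mul_one, star_mul, star_mul, h.Ps.star_eq, h.Qs.star_eq, hTs.star_eq, hTT] at this
    convert this using 3
    · rw [← hTT]; simp only [mul_assoc]
    · rw [← hTT]; simp only [mul_assoc]
  have a1 : 0 ≤ (2:ℝ) • (P * y * P) := smul_nonneg (by norm_num) hPy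
  have a2 : 0 ≤ (2:ℝ) • (Q * y * Q) := smul_nonneg (by norm_num) hQy
  have h2 : D σ (z + y) ≤ D σ ((z + (2:ℝ) • (P * y * P)) + (2:ℝ) • (Q * y * Q)) := by
    refine D_mono hσ (.of_nonneg (add_nonneg hz hy)) (add_nonneg (add_nonneg hz a1) a2) ?_
    rw [add_assoc]; gcongr
  have h3 := D_add_P hσ h.symm (add_nonneg hz a1) a2 (by simp only [smul_mul_assoc, mul_assoc, h.QQ])
  have h4 := D_add_P hσ h hz a1 (by simp only [smul_mul_assoc, mul_assoc, h.PP])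
  have h5 := D_smul_le hσ hPy (zero_le_two (α := ℝ))
  have h6 := D_smul_le hσ hQy (zero_le_two (α := ℝ))
  have h7 : D σ (P * y * P) ≤ D σ y := D_mono_conj hσ (.of_nonneg hPy) hy P (by rw [h.Ps.star_eq])
  have h8 : D σ (Q * y * Q) ≤ D σ y := D_mono_conj hσ (.of_nonneg hQy) hy Q (by rw [h.Qs.star_eq])
  linarith

/-- subadditivity of the dimension function -/
lemma D_subadd (hσ : IsQuasitrace σ) (h : Corner P Q w) {z y : R} (hz : 0 ≤ z) (hy : 0 ≤ y) :
    D σ (z + y) ≤ D σ z + D σ y := by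
  have hzs : IsSelfAdjoint z := .of_nonneg hz
  refine le_of_forall_pos_le_add fun θ hθ => ?_
  refine D_le fun s0 hs0 => ?_
  obtain ⟨s₁, hs₁, h1⟩ := D_lsc_exists hσ hzs (half_pos hθ)
  set s := min (s0 / 2) (s₁ / 3) with hs
  have hsp : 0 < s := lt_min (by linarith) (by linarith)
  have hs2 : s ≤ s0 / 2 := min_le_left _ _
  have hs3 : s ≤ s₁ / 3 := min_le_right _ _
  have h1 := h1 (3 * s) (by linarith)
  set f := cfc (ramp s (2 * s)) z with hf
  set r := cfc (fun t => 1 - ramp s (2 * s) t) z with hr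
  have hrf : r = 1 - f := (one_sub_cfc hzs (by fun_prop)).symm
  have hrs : IsSelfAdjoint r := cfc_sa _ _
  have hfs : IsSelfAdjoint f := cfc_sa _ _
  set bmp := cfc (fun t => ramp s (2 * s) t * (1 - ramp (5 * s / 2) (3 * s) t)) z with hb
  have hb0 : 0 ≤ bmp := cfc_nonneg fun t _ => mul_nonneg (ramp_nonneg _ _ _) (sub_nonneg.2 (ramp_le_one _ _ _))
  set N := ‖y‖ with hN
  have hN0 : 0 ≤ N := norm_nonneg y
  set C := 3 + 4 * N / s + 2 * s + 2 * N with hC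
  have hNs : 0 ≤ 4 * N / s := by positivity
  have hC2 : 2 ≤ C := by rw [hC]; linarith
  have hry : 0 ≤ r * y * r := by have := conj_nonneg hy r; rwa [hrs.star_eq] at this
  -- y ≤ 2 ryr + 2 N f²
  have hyle : y ≤ (2:ℝ) • (r * y * r) + (2 * N) • (f * f) := by
    set T := cfc Real.sqrt y with hT
    have hTs : IsSelfAdjoint T := cfc_sa _ _
    have hTT : T * T = y := sq_sqrt hy
    have := sum_sq_le (T * r) (T * f)
    rw [← mul_add, hrf, sub_add_cancel, mul_one, ← hrf, star_mul, star_mul, hrs.star_eq, hfs.star_eq, hTs.star_eq, hTT] at this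
    have e1 : r * T * (T * r) = r * y * r := by rw [← hTT]; simp only [mul_assoc]
    have e2 : f * T * (T * f) = f * y * f := by rw [← hTT]; simp only [mul_assoc]
    rw [e1, e2] at this
    refine this.trans ?_
    gcongr
    rw [mul_smul]
    refine smul_le_smul_of_nonneg_left ?_ (by norm_num)
    have h6 := conj_le ((IsSelfAdjoint.of_nonneg hy).le_algebraMap_norm_self) f
    rw [hfs.star_eq, Algebra.algebraMap_eq_smul_one] at h6
    simpa only [mul_smul_comm, smul_mul_assoc, mul_one] using h6
  have hzle : z + (2 * N) • (f * f) ≤ C • (cut (2 * s) z + bmp) + algebraMap ℝ R s := by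
    have h5 : cfc (fun _ : ℝ => s) z = algebraMap ℝ R s := cfc_const s z
    rw [hf, cmul z (by fun_prop) (by fun_prop), csmul _ z (by fun_prop), hb, cut, cadd z (by fun_prop) (by fun_prop),
      csmul _ z (by fun_prop), ← h5, cadd z (by fun_prop) (by fun_prop)]
    conv_lhs => enter [1]; rw [← cfc_id' ℝ z]
    rw [cadd z (by fun_prop) (by fun_prop)]
    refine cfc_mono fun t ht => ?_
    have ht := spec_nonneg hz ht
    have r0 := ramp_nonneg s (2 * s) t
    have r1 := ramp_le_one s (2 * s) t
    have b0 := ramp_nonneg (5 * s / 2) (3 * s) t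
    have b1 := ramp_le_one (5 * s / 2) (3 * s) t
    have m0 := le_max_left 0 (t - 2 * s)
    have m1 := le_max_right 0 (t - 2 * s)
    rcases le_total t (2 * s) with h2 | h2
    · rw [ramp_zero (α := 5 * s / 2) (by linarith) (by linarith), max_eq_left (by linarith)]
      have e : t - s ≤ s * ramp s (2 * s) t := by
        rcases le_total t s with h3 | h3
        · nlinarith
        · have : ramp s (2*s) t = (t - s) / s := by
            unfold ramp
            have e1 : 2 * s - s = s := by ring
            rw [e1, min_eq_right (by rw [div_le_one hsp]; linarith), max_eq_right (by apply div_nonneg <;> linarith)]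
          rw [this, mul_div_cancel₀ _ hsp.ne']
      have : ramp s (2*s) t * ramp s (2*s) t ≤ ramp s (2*s) t := by nlinarith
      have h7 : (2 * N) * (ramp s (2*s) t * ramp s (2*s) t) ≤ 2 * N * ramp s (2*s) t := by gcongr
      have h8 : (s + 2 * N) * ramp s (2*s) t ≤ C * ramp s (2*s) t := by
        gcongr; rw [hC]; linarith
      nlinarith
    · rw [ramp_one (α := s) (by linarith) h2]
      rcases le_total t (5 * s / 2) with h3 | h3
      · rw [ramp_zero (α := 5 * s / 2) (by linarith) h3]
        have h9 : 0 ≤ C * max 0 (t - 2 * s) := by positivity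
        have : 2 * s + 2 * N ≤ C := by rw [hC]; linarith
        nlinarith
      · rw [max_eq_right (by linarith)]
        have h9 : 0 ≤ C * (1 * (1 - ramp (5 * s / 2) (3 * s) t)) := by
          have : 0 ≤ 1 - ramp (5 * s / 2) (3 * s) t := by linarith
          positivity
        have h10 : (3 + 4 * N / s) * (t - 2 * s) ≤ C * (t - 2 * s) := by
          apply mul_le_mul_of_nonneg_right _ (by linarith); rw [hC]; linarith
        have h11 : 2 * N ≤ 4 * N / s * (t - 2 * s) := by
          calc 2 * N = 4 * N / s * (s / 2) := by field_simp; ring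
            _ ≤ _ := by gcongr; linarith
        nlinarith
  have hX0 : 0 ≤ r * y * r + cut (2 * s) z := add_nonneg hry (cut_nonneg _ _)
  have hle : z + y ≤ star (algebraMap ℝ R (√C)) * ((r * y * r + cut (2 * s) z) + bmp) * algebraMap ℝ R (√C)
      + algebraMap ℝ R s := by
    have e : star (algebraMap ℝ R (√C)) * ((r * y * r + cut (2 * s) z) + bmp) * algebraMap ℝ R (√C) =
        C • ((r * y * r + cut (2 * s) z) + bmp) := by
      rw [(IsSelfAdjoint.algebraMap R (r := √C) rfl).star_eq, Algebra.algebraMap_eq_smul_one]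
      rw [smul_mul_assoc, one_mul, mul_smul_comm, mul_one, smul_smul, Real.mul_self_sqrt (by linarith)]
    rw [e]
    have h2 : (2:ℝ) • (r * y * r) ≤ C • (r * y * r) := smul_le_smul_of_nonneg_right hC2 hry
    calc z + y ≤ z + ((2:ℝ) • (r * y * r) + (2 * N) • (f * f)) := by gcongr
      _ = (2:ℝ) • (r * y * r) + (z + (2 * N) • (f * f)) := by abel
      _ ≤ C • (r * y * r) + (C • (cut (2 * s) z + bmp) + algebraMap ℝ R s) := by gcongr
      _ = _ := by simp only [smul_add]; abel
  have h2 := q_comp_D hσ (.of_nonneg (add_nonneg hz hy)) (add_nonneg hX0 hb0) hsp.le (δ' := s0) (by linarith) hle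
    (adm_ramp (by linarith : s0 < 2 * s0))
  have h3 := D_add_two hσ h hX0 hb0
  have h4 : D σ (r * y * r + cut (2 * s) z) = D σ (r * y * r) + D σ (cut (2 * s) z) := by
    refine D_orth hσ (.of_nonneg hry) (.of_nonneg (cut_nonneg _ _)) ?_
    have : r * cut (2 * s) z = 0 := by
      rw [hr, cut, cmul z (by fun_prop) (by fun_prop)]
      have : (fun t => (1 - ramp s (2 * s) t) * max 0 (t - 2 * s)) = fun _ => (0:ℝ) := by
        funext t
        rcases le_total t (2 * s) with ht | ht
        · rw [max_eq_left (by linarith), mul_zero]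
        · rw [ramp_one (by linarith) ht]; simp
      rw [this]; simp
    rw [mul_assoc, this, mul_zero]
  have h5 : D σ (r * y * r) ≤ D σ y := D_mono_conj hσ (.of_nonneg hry) hy r (by rw [hrs.star_eq])
  have h6 := D_cut_le hσ hz (s := 2 * s) (by linarith)
  have h7 : D σ bmp + D σ (cut (3 * s) z) ≤ D σ z := by
    rw [← D_orth hσ (.of_nonneg hb0) (.of_nonneg (cut_nonneg _ _))]
    · refine D_mono_smul hσ (.of_nonneg (add_nonneg hb0 (cut_nonneg _ _))) hz (C := 1 / s + 1) (by positivity) ?_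
      rw [hb, cut, cadd z (by fun_prop) (by fun_prop)]
      conv_rhs => rw [← cfc_id' ℝ z]
      rw [csmul _ z (by fun_prop)]
      refine cfc_mono fun t ht => ?_
      have ht := spec_nonneg hz ht
      have r0 := ramp_nonneg s (2 * s) t
      have r1 := ramp_le_one s (2 * s) t
      have b0 := ramp_nonneg (5 * s / 2) (3 * s) t
      have b1 := ramp_le_one (5 * s / 2) (3 * s) t
      have e1 : max 0 (t - 3 * s) ≤ t := max_le ht (by linarith)
      have e2 : ramp s (2 * s) t * (1 - ramp (5 * s / 2) (3 * s) t) ≤ 1 / s * t := by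
        rcases le_total t s with h3 | h3
        · rw [ramp_zero (α := s) (by linarith) h3, zero_mul]; positivity
        · have : 1 ≤ 1 / s * t := by rw [one_div, ← div_eq_inv_mul, le_div_iff₀ hsp]; linarith
          nlinarith
      linarith
    · rw [hb, cut, cmul z (by fun_prop) (by fun_prop)]
      have : (fun t => ramp s (2 * s) t * (1 - ramp (5 * s / 2) (3 * s) t) * max 0 (t - 3 * s)) = fun _ => (0:ℝ) := by
        funext t
        rcases le_total t (3 * s) with ht | ht
        · rw [max_eq_left (by linarith), mul_zero]
        · rw [ramp_one (α := 5 * s / 2) (by linarith) ht]; simp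
      rw [this]; simp
  linarith

lemma D_Q_w (hσ : IsQuasitrace σ) (h : Corner P Q w) {z : R} (hz : 0 ≤ z) {s : ℝ} (hs : 0 ≤ s) :
    D σ (cut s (Q * z * Q)) = D σ (cut s (star w * z * w)) := by
  set T := cfc Real.sqrt z with hT
  have hTs : IsSelfAdjoint T := cfc_sa _ _
  have hTT : T * T = z := sq_sqrt hz
  have e1 : Q * z * Q = star (T * Q) * (T * Q) := by
    rw [star_mul, hTs.star_eq, h.Qs.star_eq, ← hTT]; simp only [mul_assoc]
  have e2 : star w * z * w = star (T * w) * (T * w) := by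
    rw [star_mul, hTs.star_eq, ← hTT]; simp only [mul_assoc]
  have e3 : T * Q * star (T * Q) = T * w * star (T * w) := by
    rw [star_mul, star_mul, hTs.star_eq, h.Qs.star_eq]
    calc _ = T * (Q * Q) * T := by simp only [mul_assoc]
      _ = T * (w * star w) * T := by rw [h.QQ, h.ww']
      _ = _ := by simp only [mul_assoc]
  rw [e1, e2, D_cut_swap hσ _ hs, D_cut_swap hσ _ hs, e3]

/-- comparison of dimension functions from the corner to the whole algebra -/
lemma D_compare {τ : R → ℂ} (hσ : IsQuasitrace σ) (hτ : IsQuasitrace τ) (h : Corner P Q w)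
    (hc : ∀ x : R, 0 ≤ x → x * P = x → D τ x ≤ D σ x) {z : R} (hz : 0 ≤ z) : D τ z ≤ D σ z := by
  refine le_of_forall_pos_le_add fun θ hθ => ?_
  refine D_le fun s hs => ?_
  have hQz : 0 ≤ Q * z * Q := by have := conj_nonneg hz Q; rwa [h.Qs.star_eq] at this
  have hwz : 0 ≤ star w * z * w := conj_nonneg hz w
  obtain ⟨s₁, hs₁, h1⟩ := D_lsc_exists hτ (.of_nonneg hQz) hθ
  have h1 := h1 s₁ le_rfl
  set ε := s / 4 * s₁ / (2 * (‖z‖ + 1)) / 2 with hε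
  have hε0 : 0 < ε := by positivity
  have hsm : 2 * ε / s₁ * ‖z‖ < s / 4 := by
    have : 2 * ε / s₁ * ‖z‖ = s / 4 * (‖z‖ / (2 * (‖z‖ + 1))) := by rw [hε]; field_simp
    rw [this]
    have h2 : ‖z‖ / (2 * (‖z‖ + 1)) < 1 := by
      rw [div_lt_one (by positivity)]; linarith [norm_nonneg z]
    nlinarith
  have h2 := gauss_lower hσ h hz hε0 hs₁ hsm
  have h3 := gauss_upper hτ h hz le_rfl (s' := 0) (by simp) hε0 (by positivity : 0 < s / 4) (δ' := s) (by linarith)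
    (adm_ramp (by linarith : s < 2 * s))
  have h4 : D τ (cut s₁ (Q * z * Q)) ≤ D σ (cut s₁ (Q * z * Q)) := by
    rw [D_Q_w hσ h hz hs₁.le, D_Q_w hτ h hz hs₁.le]
    refine hc _ (cut_nonneg _ _) ?_
    exact eigen_cfc (.of_nonneg hwz) (by rw [mul_assoc, h.wP]) (by fun_prop) (by simp [hs₁.le])
  have h5 := hc (cut (s / 4) (Sch P Q ε z)) (cut_nonneg _ _)
    (eigen_cfc (.of_nonneg (Sch_nonneg h hε0 z)) (Sch_P h ε z) (by fun_prop) (by simp; linarith))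
  have h6 : D τ (0 : R) ≤ 0 := by
    refine D_le fun s hs => ?_
    have : cfc (ramp s (2 * s)) (0 : R) = 0 := by
      rw [cfc_apply_zero, ramp_zero (by linarith) hs.le]; simp
    rw [this, q_zero hτ]
  rw [add_zero] at h3
  linarith

/-- from dimension functions to values; `φ` additive functional on layers -/
lemma riemann_compare (hσ : IsQuasitrace σ) {x : R} (h0 : 0 ≤ x) (h1 : x ≤ 1) {φ : R → ℝ} {C K : ℝ}
    (hadd : ∀ n : ℕ, 0 < n → φ x = ∑ k ∈ Finset.range n,
      (1 / (n : ℝ)) * φ (cfc (ramp ((k : ℝ) / n) (((k : ℝ) + 1) / n)) x))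
    (hK : ∀ y : R, 0 ≤ y → y ≤ 1 → φ y ≤ K)
    (hD : ∀ y : R, 0 ≤ y → y ≤ 1 → φ y ≤ C * D σ y) (hC : 0 ≤ C) : φ x ≤ C * q σ x := by
  have hxs : IsSelfAdjoint x := .of_nonneg h0
  have hqx := q_nonneg hσ h0
  have key : ∀ n : ℕ, φ x ≤ C * q σ x + |K| * (1 / ((n : ℝ) + 1)) := by
    intro n
    rw [hadd (n + 1) (Nat.succ_pos n), Finset.sum_range_succ']
    have hn : (0 : ℝ) < ((n + 1 : ℕ) : ℝ) := by positivity
    set N : ℝ := ((n + 1 : ℕ) : ℝ) with hN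
    have hu : ∀ k : ℕ, _ := fun k : ℕ => cfc_unit x (ramp_nonneg ((k : ℝ) / N) (((k : ℝ) + 1) / N)) (ramp_le_one _ _)
    have hlt : ∀ k : ℝ, k / N < (k + 1) / N := fun k => by gcongr; linarith
    have h2 : ∑ k ∈ Finset.range n, (1 / N) * φ (cfc (ramp (((k + 1 : ℕ) : ℝ) / N) ((((k + 1 : ℕ) : ℝ) + 1) / N)) x)
        ≤ C * q σ x := by
      have h3 : ∀ k ∈ Finset.range n, (1 / N) * φ (cfc (ramp (((k + 1 : ℕ) : ℝ) / N) ((((k + 1 : ℕ) : ℝ) + 1) / N)) x)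
          ≤ C * ((1 / N) * q σ (cfc (ramp ((k : ℝ) / N) (((k : ℝ) + 1) / N)) x)) := by
        intro k _
        have h4 := hD _ (hu (k + 1)).1 (hu (k + 1)).2
        have h5 : D σ (cfc (ramp (((k + 1 : ℕ) : ℝ) / N) ((((k + 1 : ℕ) : ℝ) + 1) / N)) x) ≤
            q σ (cfc (ramp ((k : ℝ) / N) (((k : ℝ) + 1) / N)) x) := by
          push_cast
          refine le_trans ?_ (D_cut_le_q hσ hxs (hlt k))
          have hl := hlt (k + 1)
          refine D_mono_smul hσ (cfc_sa _ _) (cut_nonneg _ _) (C := (((k : ℝ) + 1 + 1) / N - (k + 1) / N)⁻¹)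
            (by have := sub_pos.2 hl; positivity) ?_
          rw [cut, csmul _ x (by fun_prop)]
          refine cfc_mono fun t _ => ?_
          have := sub_pos.2 hl
          simp only [ramp]
          rw [mul_max_of_nonneg _ _ (by positivity), mul_zero]
          refine max_le_max le_rfl ((min_le_right _ _).trans (le_of_eq ?_))
          rw [div_eq_inv_mul]
        have : φ (cfc (ramp (((k + 1 : ℕ) : ℝ) / N) ((((k + 1 : ℕ) : ℝ) + 1) / N)) x) ≤
            C * q σ (cfc (ramp ((k : ℝ) / N) (((k : ℝ) + 1) / N)) x) := h4.trans (by gcongr)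
        calc _ ≤ 1 / N * (C * q σ (cfc (ramp ((k : ℝ) / N) (((k : ℝ) + 1) / N)) x)) := by gcongr
          _ = _ := by ring
      refine (Finset.sum_le_sum h3).trans ?_
      rw [← Finset.mul_sum]
      gcongr
      have h6 : ∀ m : ℕ, q σ (∑ k ∈ Finset.range m, (1 / N) • cfc (ramp ((k : ℝ) / N) (((k : ℝ) + 1) / N)) x) =
          ∑ k ∈ Finset.range m, (1 / N) * q σ (cfc (ramp ((k : ℝ) / N) (((k : ℝ) + 1) / N)) x) := by
        intro m
        induction m with
        | zero => simp [q_zero hσ]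
        | succ m ih =>
          rw [Finset.sum_range_succ, Finset.sum_range_succ, q_add hσ, ih, q_smul hσ (cfc_sa _ _)]
          · refine isSelfAdjoint_sum _ fun k _ => ?_
            exact IsSelfAdjoint.smul (by rfl) (cfc_sa _ _)
          · exact IsSelfAdjoint.smul (by rfl) (cfc_sa _ _)
          · refine Commute.sum_left _ _ _ fun k _ => ?_
            exact ((cfc_commute_cfc _ _ x).smul_left _).smul_right _
      have h7 : q σ x = ∑ k ∈ Finset.range (n + 1), (1 / N) * q σ (cfc (ramp ((k : ℝ) / N) (((k : ℝ) + 1) / N)) x) := by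
        rw [← h6]; congr 1; exact riemann_sum h0 h1 (Nat.succ_pos n)
      rw [h7, Finset.sum_range_succ]
      exact le_add_of_nonneg_right (mul_nonneg (by positivity) (q_nonneg hσ (hu n).1))
    have h8 : (1 / N) * φ (cfc (ramp (((0:ℕ):ℝ) / N) ((((0:ℕ):ℝ) + 1) / N)) x) ≤ |K| * (1 / ((n:ℝ) + 1)) := by
      have h9 := (hK _ (hu 0).1 (hu 0).2).trans (le_abs_self K)
      have h10 : N = (n:ℝ) + 1 := by rw [hN]; push_cast; rfl
      rw [← h10, mul_comm |K|]
      gcongr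
    linarith
  have ht : Tendsto (fun n : ℕ => C * q σ x + |K| * (1 / ((n : ℝ) + 1))) atTop (𝓝 (C * q σ x + |K| * 0)) :=
    (tendsto_one_div_add_atTop_nhds_zero_nat.const_mul _).const_add _
  rw [mul_zero, add_zero] at ht
  exact ge_of_tendsto' ht key

end
end QT

namespace QT
section
open scoped ComplexStarModule
variable {R : Type*} [CStarAlgebra R] {σ : R → ℂ} [PartialOrder R] [StarOrderedRing R]

lemma norm_unit {a : R} (h0 : 0 ≤ a) (h1 : a ≤ 1) : ‖a‖ ≤ 1 :=
  (CStarAlgebra.norm_le_one_iff_of_nonneg a h0).2 h1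

lemma norm_one_sub {a : R} (h0 : 0 ≤ a) (h1 : a ≤ 1) : ‖1 - a‖ ≤ 1 :=
  norm_unit (sub_nonneg.2 h1) (sub_le_self _ h0)

lemma dbl {x x' y y' : R} {d e : ℝ} (hx : ‖x - x'‖ ≤ d) (hy : ‖y - y'‖ ≤ e) (h1 : ‖y‖ ≤ 1) (h2 : ‖x'‖ ≤ 1) :
    ‖x * y - x' * y'‖ ≤ d + e := by
  have : x * y - x' * y' = (x - x') * y + x' * (y - y') := by noncomm_ring
  rw [this]
  refine (norm_add_le _ _).trans (add_le_add ?_ ?_)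
  · refine (norm_mul_le _ _).trans ?_
    have := norm_nonneg (x - x')
    nlinarith [norm_nonneg y]
  · refine (norm_mul_le _ _).trans ?_
    have := norm_nonneg (y - y')
    nlinarith [norm_nonneg x']

lemma nmul1 {x y : R} (hx : ‖x‖ ≤ 1) (hy : ‖y‖ ≤ 1) : ‖x * y‖ ≤ 1 :=
  (norm_mul_le _ _).trans (mul_le_one₀ hx (norm_nonneg _) hy)

lemma le_alg {x : R} (hx : IsSelfAdjoint x) {d : ℝ} (h : ‖x‖ ≤ d) : x ≤ algebraMap ℝ R d :=
  hx.le_algebraMap_norm_self.trans (alg_mono h)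

lemma neg_le_alg {x : R} (hx : IsSelfAdjoint x) {d : ℝ} (h : ‖x‖ ≤ d) : -algebraMap ℝ R d ≤ x := by
  refine le_trans ?_ hx.neg_algebraMap_norm_le_self
  exact neg_le_neg (alg_mono h)

lemma norm_cfc_sub_le {b v : R} (hb0 : 0 ≤ b) (hb1 : b ≤ 1) {g h : ℝ → ℝ} (hg : Continuous g) (hh : Continuous h)
    {c : ℝ} (hc : 0 ≤ c) (H : ∀ t, 0 ≤ t → t ≤ 1 → |g t| ≤ c * |h t|) : ‖cfc g b * v‖ ≤ c * ‖cfc h b * v‖ := by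
  have hsq : star (cfc g b * v) * (cfc g b * v) ≤ star (c • (cfc h b * v)) * (c • (cfc h b * v)) := by
    have e1 : star (cfc g b * v) * (cfc g b * v) = star v * cfc (fun t => g t * g t) b * v := by
      rw [star_mul, (cfc_sa g b).star_eq, ← cmul b hg hg]; simp only [mul_assoc]
    have e2 : star (c • (cfc h b * v)) * (c • (cfc h b * v)) = star v * cfc (fun t => c ^ 2 * (h t * h t)) b * v := by
      rw [star_smul, star_mul, (cfc_sa h b).star_eq, ← csmul (f := fun t => h t * h t) _ b (by fun_prop), ← cmul b hh hh, star_trivial]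
      simp only [mul_assoc, smul_mul_assoc, mul_smul_comm, smul_smul, pow_two]
    rw [e1, e2]
    refine conj_le (cfc_mono fun t ht => ?_) v
    have := spec_bd (norm_unit hb0 hb1) ht
    have := H t (spec_nonneg hb0 ht) this.2
    have h2 : |g t| ^ 2 ≤ (c * |h t|) ^ 2 := by gcongr
    rw [mul_pow, sq_abs, sq_abs] at h2
    nlinarith
  have := CStarAlgebra.norm_le_norm_of_nonneg_of_le (star_mul_self_nonneg _) hsq
  rw [CStarRing.norm_star_mul_self, CStarRing.norm_star_mul_self, norm_smul, Real.norm_of_nonneg hc] at this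
  exact abs_le_of_sq_le_sq' (by nlinarith) (by positivity) |>.2

/-- comparison lemma CB -/
lemma CB (hσ : IsQuasitrace σ) {x b w : R} (hx0 : 0 ≤ x) (hx1 : x ≤ 1) (hb0 : 0 ≤ b) (hb1 : b ≤ 1) (hw : ‖w‖ ≤ 1)
    {ε₁ ε₂ δ' : ℝ} (h1 : ‖(1 - b) * (w * x)‖ ≤ ε₁) (h2 : ‖(1 - star w * w) * x‖ ≤ ε₂) (hδ : 8 * ε₁ + ε₂ < δ')
    {f h : ℝ → ℝ} (hf : Adm δ' f) (hh : Adm (1/8) h) (hh1 : ∀ t, 5/8 ≤ t → h t = 1) :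
    q σ (cfc f (x * x)) ≤ q σ (cfc h b) := by
  set k := cfc (ramp (5/8) (3/4)) b with hk
  have hks : IsSelfAdjoint k := cfc_sa _ _
  have hxs : IsSelfAdjoint x := .of_nonneg hx0
  obtain ⟨k0, k1⟩ := cfc_unit b (ramp_nonneg (5/8) (3/4)) (ramp_le_one (5/8) (3/4))
  rw [← hk] at k0 k1
  have hb : IsSelfAdjoint b := .of_nonneg hb0
  have e0 := norm_nonneg ((1 - b) * (w * x))
  have e0' := norm_nonneg ((1 - star w * w) * x)
  have n1 : ‖(1 - k) * (w * x)‖ ≤ 4 * ‖(1 - b) * (w * x)‖ := by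
    have e1 : 1 - k = cfc (fun t => 1 - ramp (5/8) (3/4) t) b := one_sub_cfc hb (ramp_cont _ _)
    have e2 : 1 - b = cfc (fun t : ℝ => 1 - t) b := by
      conv_lhs => rw [← cfc_id' ℝ b]
      exact one_sub_cfc hb continuous_id
    rw [e1, e2]
    refine norm_cfc_sub_le hb0 hb1 (by have := ramp_cont (5/8) (3/4); fun_prop) (by fun_prop) (by norm_num) fun t h0 h1 => ?_
    have r0 := ramp_nonneg (5/8) (3/4) t
    have r1 := ramp_le_one (5/8) (3/4) t
    rw [abs_of_nonneg (by linarith), abs_of_nonneg (by linarith)]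
    rcases le_total t (3/4) with h | h
    · linarith
    · rw [ramp_one (by norm_num) h]; linarith
  have n2 : ‖(1 - k * k) * (w * x)‖ ≤ 8 * ‖(1 - b) * (w * x)‖ := by
    have : (1 - k * k) * (w * x) = (1 - k) * (w * x) + k * ((1 - k) * (w * x)) := by noncomm_ring
    rw [this]
    refine (norm_add_le _ _).trans ?_
    have := norm_mul_le k ((1 - k) * (w * x))
    have := norm_unit k0 k1
    nlinarith [norm_nonneg ((1 - k) * (w * x)), norm_nonneg k]
  set z := k * (w * x) with hz
  have hez : cfc h b * z = z := by
    rw [hz, ← mul_assoc, hk, cmul b hh.cont (ramp_cont _ _)]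
    congr 2
    refine funext fun t => ?_
    rcases le_total t (5/8) with h | h
    · rw [ramp_zero (by norm_num) h, mul_zero]
    · rw [hh1 t h, one_mul]
  obtain ⟨c0, c1⟩ := cfc_unit b hh.nonneg hh.le_one
  refine q_comp hσ (by simpa [hxs.star_eq] using IsSelfAdjoint.star_mul_self x) c0 c1 hez
    (δ := 8 * ‖(1 - b) * (w * x)‖ + ‖(1 - star w * w) * x‖) (by positivity) (by linarith) ?_ hf
  have hzz : x * x - star z * z = x * (1 - star w * w) * x + star (w * x) * ((1 - k * k) * (w * x)) := by
    rw [hz, star_mul, star_mul, hxs.star_eq, hks.star_eq]; noncomm_ring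
  have hsa : IsSelfAdjoint (x * x - star z * z) :=
    (by simpa [hxs.star_eq] using IsSelfAdjoint.star_mul_self x : IsSelfAdjoint (x * x)).sub (.star_mul_self z)
  rw [← sub_le_iff_le_add']
  refine le_alg hsa ?_
  rw [hzz]
  refine (norm_add_le _ _).trans ?_
  have nx := norm_unit hx0 hx1
  have nwx : ‖star (w * x)‖ ≤ 1 := by rw [norm_star]; exact nmul1 hw nx
  have a1 := norm_mul_le x ((1 - star w * w) * x)
  have a2 := norm_mul_le (star (w * x)) ((1 - k * k) * (w * x))
  rw [mul_assoc x]
  nlinarith [norm_nonneg x, norm_nonneg (star (w * x)), norm_nonneg ((1 - k * k) * (w * x))]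

lemma cfc_sq {x : R} (hx : 0 ≤ x) {f : ℝ → ℝ} (hf : Continuous f) : cfc f x = cfc (fun t => f (Real.sqrt t)) (x * x) := by
  have hxs : IsSelfAdjoint x := .of_nonneg hx
  have : x * x = cfc (fun t : ℝ => t * t) x := by
    rw [← cmul (f := fun t => t) (g := fun t => t) x (by fun_prop) (by fun_prop), cfc_id' ℝ x]
  rw [this, ← cfc_comp' (fun t => f (Real.sqrt t)) (fun t : ℝ => t * t) x (by fun_prop) (by fun_prop)]
  refine cfc_congr fun t ht => ?_
  simp only [Real.sqrt_mul_self (spec_nonneg hx ht)]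

lemma adm_sqrt {δ : ℝ} (hδ : 0 ≤ δ) {f : ℝ → ℝ} (hf : Adm δ f) : Adm (δ * δ) (fun t => f (Real.sqrt t)) where
  cont := hf.cont.comp Real.continuous_sqrt
  nonneg t := hf.nonneg _
  le_one t := hf.le_one _
  zero t ht := hf.zero _ (by
    have := Real.sqrt_le_sqrt ht
    rwa [Real.sqrt_mul_self hδ] at this)

lemma CB' (hσ : IsQuasitrace σ) {x b w : R} (hx0 : 0 ≤ x) (hx1 : x ≤ 1) (hb0 : 0 ≤ b) (hb1 : b ≤ 1) (hw : ‖w‖ ≤ 1)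
    {ε₁ ε₂ δ' : ℝ} (h1 : ‖(1 - b) * (w * x)‖ ≤ ε₁) (h2 : ‖(1 - star w * w) * x‖ ≤ ε₂) (hδ'0 : 0 ≤ δ')
    (hδ : 8 * ε₁ + ε₂ < δ' * δ')
    {f h : ℝ → ℝ} (hf : Adm δ' f) (hh : Adm (1/8) h) (hh1 : ∀ t, 5/8 ≤ t → h t = 1) :
    q σ (cfc f x) ≤ q σ (cfc h b) := by
  rw [cfc_sq hx0 hf.cont]
  exact CB hσ hx0 hx1 hb0 hb1 hw h1 h2 hδ (adm_sqrt hδ'0 hf) hh hh1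

/-- `e` is way below `a`. -/
def WB (e a : R) : Prop := 0 ≤ e ∧ e ≤ 1 ∧ ∃ s : ℝ, 0 < s ∧
  ∀ ψ : ℝ → ℝ, Continuous ψ → (∀ t, s ≤ t → ψ t = 1) → cfc ψ a * e = e

lemma WB.intro {e a : R} (h0 : 0 ≤ e) (h1 : e ≤ 1) {s : ℝ} (hs : 0 < s) {φ : ℝ → ℝ} (hφ : Adm s φ)
    (h : cfc φ a * e = e) : WB e a := by
  refine ⟨h0, h1, s, hs, fun ψ hψ h1 => ?_⟩
  conv_lhs => rw [← h, ← mul_assoc, cmul a hψ hφ.cont]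
  conv_rhs => rw [← h]
  congr 2
  funext t
  rcases le_total t s with h | h
  · rw [hφ.zero t h, mul_zero]
  · rw [h1 t h, one_mul]

lemma WB.cut {e a : R} (ha : IsSelfAdjoint a) (h : WB e a) : ∃ δ > 0, WB e (cut δ a) := by
  obtain ⟨h0, h1, s, hs, h⟩ := h
  refine ⟨s / 2, by positivity, h0, h1, s / 2, by positivity, fun ψ hψ h1 => ?_⟩
  rw [cfc_cut a _ hψ ha]
  refine h _ (by fun_prop) fun t ht => h1 _ ?_
  exact le_max_of_le_right (by linarith)

lemma WB.exists_mid {e a : R} (h : WB e a) : ∃ f, WB f a ∧ f * e = e := by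
  obtain ⟨h0, h1, s, hs, h⟩ := h
  obtain ⟨c0, c1⟩ := cfc_unit a (ramp_nonneg (s/2) s) (ramp_le_one (s/2) s)
  refine ⟨cfc (ramp (s/2) s) a, WB.intro c0 c1 (s := s / 4) (by positivity) (adm_ramp (β := s/2) (by linarith)) ?_, ?_⟩
  · rw [cmul a (ramp_cont _ _) (ramp_cont _ _)]
    refine congrArg (fun g => cfc g a) (funext fun t => ?_)
    rcases le_total t (s/2) with h | h
    · rw [ramp_zero (α := s/2) (by linarith) h, mul_zero]
    · rw [ramp_one (α := s/4) (by linarith) h, one_mul]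
  · exact h _ (ramp_cont _ _) fun t ht => ramp_one (by linarith) ht

end
end QT

namespace QT
section
open scoped ComplexStarModule
variable {R : Type*} [CStarAlgebra R] {σ : R → ℂ} [PartialOrder R] [StarOrderedRing R]
variable {A : Type*} [CStarAlgebra A] [PartialOrder A] [StarOrderedRing A]
variable {E : Type*} [CStarAlgebra E] [PartialOrder E] [StarOrderedRing E]
variable {i : A →⋆ₐ[ℂ] E} {j : R →⋆ₐ[ℂ] E}

lemma map_cfc' (j : R →⋆ₐ[ℂ] E) {f : ℝ → ℝ} (hf : Continuous f) {y : R} (hy : IsSelfAdjoint y) :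
    j (cfc f y) = cfc f (j y) := by
  have hc : Continuous j := map_continuous j
  exact StarAlgHomClass.map_cfc (R := ℝ) (S := ℂ) j f y (by fun_prop) hc hy (hy.map j)

lemma reflect (hj : Function.Injective j) {y : R} (hy : IsSelfAdjoint y) (h : 0 ≤ j y) : 0 ≤ y := by
  have e1 : j (cfc (fun t : ℝ => max 0 (-t)) y) = 0 := by
    rw [map_cfc' j (by fun_prop) hy, ← cfc_zero (R := ℝ) (a := j y)]
    refine cfc_congr fun t ht => ?_
    have := spec_nonneg h ht
    simp [this]
  have e2 : cfc (fun t : ℝ => max 0 (-t)) y = 0 := hj (by rw [e1, map_zero])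
  have e3 : y = cfc (fun t : ℝ => max 0 t) y - cfc (fun t : ℝ => max 0 (-t)) y := by
    rw [csub y (by fun_prop) (by fun_prop)]
    conv_lhs => rw [← cfc_id' ℝ y]
    refine congrArg (fun g => cfc g y) (funext fun t => ?_)
    rcases le_total 0 t with h | h
    · rw [max_eq_right h, max_eq_left (by linarith)]; ring
    · rw [max_eq_left h, max_eq_right (by linarith)]; ring
  rw [e3, e2, sub_zero]
  exact cfc_nonneg fun t _ => le_max_left _ _

lemma map_alg (j : R →⋆ₐ[ℂ] E) (r : ℝ) : j (algebraMap ℝ R r) = algebraMap ℝ E r := by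
  rw [IsScalarTower.algebraMap_apply ℝ ℂ R, IsScalarTower.algebraMap_apply ℝ ℂ E]
  exact AlgHomClass.commutes j _

lemma map_nn (j : R →⋆ₐ[ℂ] E) {x : R} (h : 0 ≤ x) : 0 ≤ j x := by
  obtain ⟨y, rfl⟩ := CStarAlgebra.nonneg_iff_eq_star_mul_self.1 h
  rw [map_mul, map_star]; exact star_mul_self_nonneg _

lemma map_le (j : R →⋆ₐ[ℂ] E) {x y : R} (h : x ≤ y) : j x ≤ j y := by
  have := map_nn j (sub_nonneg.2 h)
  rwa [map_sub, sub_nonneg] at this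

structure Close (i : A →⋆ₐ[ℂ] E) (j : R →⋆ₐ[ℂ] E) : Prop where
  ni : ∀ x, ‖i x‖ = ‖x‖
  nj : ∀ x, ‖j x‖ = ‖x‖
  con : ∀ x, ‖x‖ ≤ 1 → ∃ y, ‖y‖ ≤ 1 ∧ ‖i x - j y‖ ≤ 1 / 1100
  pos : ∀ x, 0 ≤ x → x ≤ 1 → ∃ y, 0 ≤ y ∧ y ≤ 1 ∧ ‖i x - j y‖ ≤ 1 / 1100

lemma Close.inj (h : Close i j) : Function.Injective j := by
  refine (injective_iff_map_eq_zero j).2 fun x hx => ?_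
  rw [← norm_eq_zero, ← h.nj, hx, norm_zero]

def Near (i : A →⋆ₐ[ℂ] E) (j : R →⋆ₐ[ℂ] E) (e : A) (b : R) : Prop :=
  0 ≤ b ∧ b ≤ 1 ∧ ‖i e - j b‖ ≤ 1 / 1100

noncomputable abbrev GG : ℝ → ℝ := ramp (1/2) (5/8)

lemma GG_adm : Adm (1/8) GG := ⟨ramp_cont _ _, ramp_nonneg _ _, ramp_le_one _ _, fun t ht => ramp_zero (by norm_num) (by linarith)⟩

lemma adm_weaken {δ δ' : ℝ} (h : δ ≤ δ') {f : ℝ → ℝ} (hf : Adm δ' f) : Adm δ f :=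
  ⟨hf.cont, hf.nonneg, hf.le_one, fun t ht => hf.zero t (ht.trans h)⟩

lemma CLgen (hc : Close i j) (hσ : IsQuasitrace σ) {e f v : A} {be bf : R} (he0 : 0 ≤ e) (he1 : e ≤ 1)
    (hf0 : 0 ≤ f) (hf1 : f ≤ 1) (hv : ‖v‖ ≤ 1) (h1 : star v * v * e = e) (h2 : f * (v * e) = v * e)
    (hbe : Near i j e be) (hbf : Near i j f bf) {δ : ℝ} (hδ0 : 0 ≤ δ) (hδ : 28 / 1100 < δ * δ) {F h : ℝ → ℝ}
    (hF : Adm δ F) (hh : Adm (1/8) h) (hh1 : ∀ t, 5/8 ≤ t → h t = 1) :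
    q σ (cfc F be) ≤ q σ (cfc h bf) := by
  obtain ⟨w, hw, hvw⟩ := hc.con v hv
  have hvw' : ‖j w - i v‖ ≤ 1 / 1100 := by rw [norm_sub_rev]; exact hvw
  have hee : ‖j be - i e‖ ≤ 1 / 1100 := by rw [norm_sub_rev]; exact hbe.2.2
  have nbe : ‖j be‖ ≤ 1 := by rw [hc.nj]; exact norm_unit hbe.1 hbe.2.1
  have nw : ‖j w‖ ≤ 1 := by rw [hc.nj]; exact hw
  have nv : ‖i v‖ ≤ 1 := by rw [hc.ni]; exact hv
  have nf : ‖i (1 - f)‖ ≤ 1 := by rw [hc.ni]; exact norm_one_sub hf0 hf1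
  refine CB' hσ hbe.1 hbe.2.1 hbf.1 hbf.2.1 hw (ε₁ := 3 / 1100) (ε₂ := 4 / 1100) ?_ ?_ hδ0 (by linarith) hF hh hh1
  · rw [← hc.nj]
    have z : i ((1 - f) * (v * e)) = 0 := by rw [sub_mul, one_mul, h2, sub_self, map_zero]
    have : ‖j ((1 - bf) * (w * be)) - i ((1 - f) * (v * e))‖ ≤ 1 / 1100 + (1 / 1100 + 1 / 1100) := by
      simp only [map_mul]
      refine dbl ?_ (dbl hvw' hee nbe nv) (nmul1 nw nbe) nf
      rw [map_sub, map_sub, map_one, map_one]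
      have : (1 - j bf) - (1 - i f) = i f - j bf := by abel
      rw [this]; exact hbf.2.2
    rw [z, sub_zero] at this
    linarith
  · rw [← hc.nj]
    have hs : ‖j (star w) - i (star v)‖ ≤ 1 / 1100 := by
      rw [map_star, map_star, ← star_sub, norm_star]; exact hvw'
    have nsv : ‖i (star v)‖ ≤ 1 := by rw [map_star, norm_star]; exact nv
    have : ‖j (star w * (w * be)) - i (star v * (v * e))‖ ≤ 1 / 1100 + (1 / 1100 + 1 / 1100) := by
      simp only [map_mul]
      exact dbl hs (dbl hvw' hee nbe nv) (nmul1 nw nbe) nsv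
    have k : (1 - star w * w) * be = be - star w * (w * be) := by noncomm_ring
    have e4 : star v * (v * e) = e := by rw [← mul_assoc, h1]
    rw [e4] at this
    have e5 : j ((1 - star w * w) * be) = (j be - i e) - (j (star w * (w * be)) - i e) := by
      rw [k, map_sub]; abel
    rw [e5]
    exact (norm_sub_le _ _).trans (by linarith)

lemma CL (hc : Close i j) (hσ : IsQuasitrace σ) {e f v : A} {be bf : R} (he0 : 0 ≤ e) (he1 : e ≤ 1)
    (hf0 : 0 ≤ f) (hf1 : f ≤ 1) (hv : ‖v‖ ≤ 1) (h1 : star v * v * e = e) (h2 : f * (v * e) = v * e)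
    (hbe : Near i j e be) (hbf : Near i j f bf) : q σ (cfc GG be) ≤ q σ (cfc GG bf) :=
  CLgen hc hσ he0 he1 hf0 hf1 hv h1 h2 hbe hbf (δ := 1/2) (by norm_num) (by norm_num) (adm_ramp (by norm_num))
    GG_adm fun t ht => ramp_one (by norm_num) ht

def DSet (σ : R → ℂ) (i : A →⋆ₐ[ℂ] E) (j : R →⋆ₐ[ℂ] E) (a : A) : Set ℝ :=
  {x | ∃ e b, WB e a ∧ Near i j e b ∧ x = q σ (cfc GG b)}

/-- the transported dimension function -/
noncomputable def DA (σ : R → ℂ) (i : A →⋆ₐ[ℂ] E) (j : R →⋆ₐ[ℂ] E) (a : A) : ℝ := sSup (DSet σ i j a)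

lemma WB_zero (a : A) : WB 0 a := ⟨le_rfl, zero_le_one, 1, one_pos, fun _ _ _ => mul_zero _⟩

lemma DSet_zero (a : A) (hσ : IsQuasitrace σ) : (0:ℝ) ∈ DSet σ i j a := by
  refine ⟨0, 0, WB_zero a, ⟨le_rfl, zero_le_one, by simp⟩, ?_⟩
  have : cfc GG (0:R) = 0 := by
    rw [cfc_apply_zero, GG, ramp_zero (by norm_num) (by norm_num), map_zero]
  rw [this, q_zero hσ]

lemma DSet_bdd (a : A) (hσ : IsQuasitrace σ) : BddAbove (DSet σ i j a) := by
  refine ⟨q σ 1, ?_⟩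
  rintro x ⟨e, b, -, -, rfl⟩
  exact q_le_one hσ (cfc_unit b GG_adm.nonneg GG_adm.le_one).1 (cfc_unit b GG_adm.nonneg GG_adm.le_one).2

lemma le_DA (hσ : IsQuasitrace σ) {a e : A} {b : R} (h : WB e a) (hb : Near i j e b) :
    q σ (cfc GG b) ≤ DA σ i j a := le_csSup (DSet_bdd a hσ) ⟨e, b, h, hb, rfl⟩

lemma DA_le (hσ : IsQuasitrace σ) {a : A} {c : ℝ} (h : ∀ e b, WB e a → Near i j e b → q σ (cfc GG b) ≤ c) :
    DA σ i j a ≤ c := csSup_le ⟨0, DSet_zero a hσ⟩ (by rintro x ⟨e, b, h1, h2, rfl⟩; exact h e b h1 h2)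

lemma DA_nonneg (hσ : IsQuasitrace σ) (a : A) : 0 ≤ DA σ i j a := le_csSup (DSet_bdd a hσ) (DSet_zero a hσ)

lemma DA_le_one (hσ : IsQuasitrace σ) (a : A) : DA σ i j a ≤ q σ 1 := DA_le hσ fun e b _ _ =>
  q_le_one hσ (cfc_unit b GG_adm.nonneg GG_adm.le_one).1 (cfc_unit b GG_adm.nonneg GG_adm.le_one).2

lemma DA_mono (hσ : IsQuasitrace σ) {a a' : A} (h : ∀ e, WB e a → WB e a') : DA σ i j a ≤ DA σ i j a' :=
  DA_le hσ fun e b h1 h2 => le_DA hσ (h e h1) h2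

lemma DA_lsc (hσ : IsQuasitrace σ) {a : A} (ha : IsSelfAdjoint a) {c : ℝ} (h : ∀ s, 0 < s → DA σ i j (cut s a) ≤ c) :
    DA σ i j a ≤ c := DA_le hσ fun e b h1 h2 => by
  obtain ⟨δ, hδ, h'⟩ := h1.cut ha
  exact (le_DA hσ h' h2).trans (h δ hδ)

lemma DA_swap_le (hc : Close i j) (hσ : IsQuasitrace σ) (x : A) :
    DA σ i j (star x * x) ≤ DA σ i j (x * star x) := DA_le hσ fun e b he hb => by
  obtain ⟨he0, he1, s, hs, h⟩ := he
  set X := star x * x with hX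
  have hXs : IsSelfAdjoint X := .star_mul_self x
  have hX0 : 0 ≤ X := star_mul_self_nonneg x
  set Y := x * star x with hY
  have hYs : IsSelfAdjoint Y := .mul_star_self x
  set h1 : ℝ → ℝ := fun t => (Real.sqrt (max t s))⁻¹ with hh1
  have hpos : ∀ t, 0 < Real.sqrt (max t s) := fun t => Real.sqrt_pos.2 (lt_max_of_lt_right hs)
  have c1 : Continuous h1 := (by fun_prop : Continuous fun t => Real.sqrt (max t s)).inv₀ fun t => (hpos t).ne'
  set v := x * cfc h1 X with hv
  have vv : star v * v = cfc (fun t => h1 t * t * h1 t) X := by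
    rw [hv, star_mul, (cfc_sa h1 X).star_eq, ← cmul (f := fun t => h1 t * t) X (by fun_prop) c1,
      ← cmul (g := fun t => t) X c1 (by fun_prop), cfc_id' ℝ X, hX]
    simp only [mul_assoc]
  have key : ∀ t, h1 t * t * h1 t = t / max t s := fun t => by
    have := Real.mul_self_sqrt (le_max_of_le_right hs.le : 0 ≤ max t s)
    have h2 := (hpos t).ne'
    rw [hh1]
    field_simp
    rw [pow_two, this, mul_comm]
  have nv : ‖v‖ ≤ 1 := by
    have : ‖star v * v‖ ≤ 1 := by
      rw [vv]
      refine norm_cfc_le (by norm_num) fun t ht => ?_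
      have ht := spec_nonneg hX0 ht
      rw [key, Real.norm_of_nonneg (div_nonneg ht (le_max_of_le_left ht))]
      exact div_le_one_of_le₀ (le_max_left _ _) (le_max_of_le_left ht)
    rw [CStarRing.norm_star_mul_self] at this
    nlinarith [norm_nonneg v]
  have hve : star v * v * e = e := by
    rw [vv]
    refine h _ (by fun_prop) fun t ht => ?_
    rw [key, max_eq_left ht, div_self (by linarith)]
  set f := cfc (ramp (s/2) s) Y with hf
  obtain ⟨f0, f1⟩ := cfc_unit Y (ramp_nonneg (s/2) s) (ramp_le_one (s/2) s)
  have hfv : f * (v * e) = v * e := by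
    have a1 : f * x = x * cfc (ramp (s/2) s) X := intertwine hYs hXs (by rw [hX, hY, mul_assoc]) (ramp_cont _ _)
    have a2 : cfc (ramp (s/2) s) X * cfc h1 X = cfc h1 X * cfc (ramp (s/2) s) X := by
      rw [cmul X (ramp_cont _ _) c1, cmul X c1 (ramp_cont _ _)]
      simp only [mul_comm]
    have a3 : cfc (ramp (s/2) s) X * e = e := h _ (ramp_cont _ _) fun t ht => ramp_one (by linarith) ht
    calc f * (v * e) = (f * x) * (cfc h1 X * e) := by rw [hv]; simp only [mul_assoc]
      _ = x * (cfc (ramp (s/2) s) X * cfc h1 X) * e := by rw [a1]; simp only [mul_assoc]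
      _ = x * cfc h1 X * (cfc (ramp (s/2) s) X * e) := by rw [a2]; simp only [mul_assoc]
      _ = v * e := by rw [a3]
  have wf : WB f Y := by
    refine WB.intro f0 f1 (s := s / 4) (by positivity) (adm_ramp (β := s/2) (by linarith)) ?_
    rw [hf, cmul Y (ramp_cont _ _) (ramp_cont _ _)]
    refine congrArg (fun g => cfc g Y) (funext fun t => ?_)
    rcases le_total t (s/2) with h | h
    · rw [ramp_zero (α := s/2) (by linarith) h, mul_zero]
    · rw [ramp_one (α := s/4) (by linarith) h, one_mul]
  obtain ⟨bf, b0, b1, b2⟩ := hc.pos f f0 f1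
  exact (CL hc hσ he0 he1 f0 f1 nv hve hfv hb ⟨b0, b1, b2⟩).trans (le_DA hσ wf ⟨b0, b1, b2⟩)

lemma DA_swap (hc : Close i j) (hσ : IsQuasitrace σ) (x : A) :
    DA σ i j (star x * x) = DA σ i j (x * star x) := by
  refine le_antisymm (DA_swap_le hc hσ x) ?_
  have := DA_swap_le hc hσ (star x)
  rwa [star_star] at this

end
end QT

namespace QT
section
open scoped ComplexStarModule
variable {R : Type*} [CStarAlgebra R] {σ : R → ℂ} [PartialOrder R] [StarOrderedRing R]
variable {A : Type*} [CStarAlgebra A] [PartialOrder A] [StarOrderedRing A]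
variable {E : Type*} [CStarAlgebra E] [PartialOrder E] [StarOrderedRing E]
variable {i : A →⋆ₐ[ℂ] E} {j : R →⋆ₐ[ℂ] E}

lemma DA_cut_swap (hc : Close i j) (hσ : IsQuasitrace σ) (x : A) {s : ℝ} (hs : 0 < s) :
    DA σ i j (cut s (star x * x)) = DA σ i j (cut s (x * star x)) := by
  set X := star x * x with hX
  have hXs : IsSelfAdjoint X := .star_mul_self x
  set Y := x * star x with hY
  have hYs : IsSelfAdjoint Y := .mul_star_self x
  set h : ℝ → ℝ := fun t => Real.sqrt (max 0 (t - s) / max t s) with hh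
  have hp : ∀ t, 0 < max t s := fun t => lt_max_of_lt_right hs
  have c1 : Continuous h := by
    refine Continuous.sqrt (Continuous.div (by fun_prop) (by fun_prop) fun t => (hp t).ne')
  have key : ∀ t, h t * h t * t = max 0 (t - s) := fun t => by
    rw [hh]
    simp only
    rw [Real.mul_self_sqrt (div_nonneg (le_max_left _ _) (hp t).le)]
    rcases le_total t s with h | h
    · rw [max_eq_left (by linarith : t - s ≤ 0)]; simp
    · rw [max_eq_left h, div_mul_cancel₀ _ (by linarith)]
  have := DA_swap hc hσ (x * cfc h X)
  have e1 : star (x * cfc h X) * (x * cfc h X) = cut s X := by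
    rw [cut, star_mul, (cfc_sa h X).star_eq]
    have : cfc (fun t => max 0 (t - s)) X = cfc h X * X * cfc h X := by
      conv_rhs => enter [1, 2]; rw [← cfc_id' ℝ X]
      rw [cmul X c1 (by fun_prop), cmul X (by fun_prop) c1]
      refine congrArg (fun g => cfc g X) (funext fun t => ?_)
      rw [← key]; ring
    rw [this, hX]; simp only [mul_assoc]
  have e2 : x * cfc h X * star (x * cfc h X) = cut s Y := by
    have i1 : cfc (fun t => h t * h t) Y * x = x * cfc (fun t => h t * h t) X :=
      intertwine hYs hXs (by rw [hX, hY, mul_assoc]) (by fun_prop)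
    have : cfc (fun t => max 0 (t - s)) Y = cfc (fun t => h t * h t) Y * Y := by
      conv_rhs => enter [2]; rw [← cfc_id' ℝ Y]
      rw [cmul Y (by fun_prop) (by fun_prop)]
      refine congrArg (fun g => cfc g Y) (funext fun t => ?_)
      rw [← key]
    rw [cut, this, hY, ← mul_assoc, ← hY, i1, star_mul, (cfc_sa h X).star_eq, ← cmul X c1 c1]
    simp only [mul_assoc]
  rwa [e1, e2] at this

lemma cfc_mul_of {a : A} {f g : ℝ → ℝ} (hf : Continuous f) (hg : Continuous g) (h : ∀ t, f t * g t = g t) :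
    cfc f a * cfc g a = cfc g a := by
  rw [cmul a hf hg]
  exact congrArg (fun g => cfc g a) (funext h)

lemma ramp_ramp {α β γ δ : ℝ} (h1 : α < β) (h2 : β ≤ γ) (h3 : γ < δ) (t : ℝ) :
    ramp α β t * ramp γ δ t = ramp γ δ t := by
  rcases le_total t γ with h | h
  · rw [ramp_zero h3 h, mul_zero]
  · rw [ramp_one h1 (by linarith), one_mul]

lemma ramp_ramp_zero {α β γ : ℝ} (h1 : α < β) (t : ℝ) (f : ℝ → ℝ) (hf : ∀ t, α ≤ t → f t = 0) :
    ramp α β t * f t = 0 := by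
  rcases le_total t α with h | h
  · rw [ramp_zero h1 h, zero_mul]
  · rw [hf t h, mul_zero]

lemma sum_orth_le_one {y y' : R} (h0 : 0 ≤ y) (h1 : y ≤ 1) (h0' : 0 ≤ y') (h1' : y' ≤ 1) (h : y * y' = 0) :
    y + y' ≤ 1 := by
  have hs : IsSelfAdjoint y := .of_nonneg h0
  have hs' : IsSelfAdjoint y' := .of_nonneg h0'
  have h' : y' * y = 0 := by rw [← (orth_comm hs hs' h).eq, h]
  have sq : ∀ z : R, 0 ≤ z → z ≤ 1 → z * z ≤ z := fun z z0 z1 => by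
    have := conj_le z1 (cfc Real.sqrt z)
    have k := conj_nonneg (sub_nonneg.2 z1) z
    have hz : IsSelfAdjoint z := .of_nonneg z0
    have : z * z = cfc (fun t : ℝ => t * t) z := by
      rw [← cmul (f := fun t => t) (g := fun t => t) z (by fun_prop) (by fun_prop), cfc_id' ℝ z]
    rw [this]
    conv_rhs => rw [← cfc_id' ℝ z]
    refine cfc_mono fun t ht => ?_
    have a := spec_nonneg z0 ht
    have b := (spec_bd (norm_unit z0 z1) ht).2
    nlinarith
  have e : star (y + y') * (y + y') ≤ y + y' := by
    rw [star_add, hs.star_eq, hs'.star_eq]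
    have : (y + y') * (y + y') = y * y + y' * y' := by
      simp only [add_mul, mul_add, h, h']; abel
    rw [this]
    exact add_le_add (sq y h0 h1) (sq y' h0' h1')
  have e2 := CStarAlgebra.norm_le_norm_of_nonneg_of_le (star_mul_self_nonneg _) e
  rw [CStarRing.norm_star_mul_self] at e2
  have : ‖y + y'‖ ≤ 1 := by nlinarith [norm_nonneg (y + y')]
  exact (CStarAlgebra.norm_le_one_iff_of_nonneg _ (add_nonneg h0 h0')).1 this

lemma DA_super_core (hc : Close i j) (hσ : IsQuasitrace σ) {e f e' F : A} {b β b' bF : R}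
    (he0 : 0 ≤ e) (he1 : e ≤ 1) (hf0 : 0 ≤ f) (hf1 : f ≤ 1) (he0' : 0 ≤ e') (he1' : e' ≤ 1) (hF0 : 0 ≤ F) (hF1 : F ≤ 1)
    (hfe : f * e = e) (hfe' : f * e' = 0) (hFf : F * f = f) (hFe' : F * e' = e')
    (hb : Near i j e b) (hβ : Near i j f β) (hb' : Near i j e' b') (hbF : Near i j F bF) :
    q σ (cfc GG b) + q σ (cfc GG b') ≤ q σ (cfc GG bF) := by
  have hβs : IsSelfAdjoint β := .of_nonneg hβ.1
  have hbs' : IsSelfAdjoint b' := .of_nonneg hb'.1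
  have nb' : ‖j b'‖ ≤ 1 := by rw [hc.nj]; exact norm_unit hb'.1 hb'.2.1
  have nβ : ‖j β‖ ≤ 1 := by rw [hc.nj]; exact norm_unit hβ.1 hβ.2.1
  have nf : ‖i f‖ ≤ 1 := by rw [hc.ni]; exact norm_unit hf0 hf1
  have n1F : ‖i (1 - F)‖ ≤ 1 := by rw [hc.ni]; exact norm_one_sub hF0 hF1
  have hβf : ‖j β - i f‖ ≤ 1 / 1100 := by rw [norm_sub_rev]; exact hβ.2.2
  have hbe' : ‖j b' - i e'‖ ≤ 1 / 1100 := by rw [norm_sub_rev]; exact hb'.2.2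
  have hbFF : ‖j (1 - bF) - i (1 - F)‖ ≤ 1 / 1100 := by
    have : j (1 - bF) - i (1 - F) = i F - j bF := by simp only [map_sub, map_one]; abel
    rw [this]; exact hbF.2.2
  have m1 : ‖β * b'‖ ≤ 2 / 1100 := by
    have := dbl hβf hbe' nb' nf
    rw [← map_mul, ← map_mul, hfe', map_zero, sub_zero, hc.nj] at this
    linarith
  have m2 : ‖(1 - bF) * β‖ ≤ 2 / 1100 := by
    have := dbl hbFF hβf nβ n1F
    rw [← map_mul, ← map_mul, sub_mul 1 F, one_mul, hFf, sub_self, map_zero, sub_zero, hc.nj] at this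
    linarith
  have m3 : ‖(1 - bF) * b'‖ ≤ 2 / 1100 := by
    have := dbl hbFF hbe' nb' n1F
    rw [← map_mul, ← map_mul, sub_mul 1 F, one_mul, hFe', sub_self, map_zero, sub_zero, hc.nj] at this
    linarith
  set rf : ℝ → ℝ := fun t => 1 - min (2 * t) 1 with hrf
  set r0 : ℝ → ℝ := fun t => max 0 (rf t) ⊓ 1 with hr0
  have cr0 : Continuous r0 := by rw [hr0, hrf]; fun_prop
  set r := cfc r0 β with hr
  have hrs : IsSelfAdjoint r := cfc_sa _ _
  obtain ⟨r0', r1'⟩ := cfc_unit (f := r0) β (fun t => le_min (le_max_left _ _) zero_le_one) (fun t => min_le_right _ _)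
  rw [← hr] at r0' r1'
  have nr : ‖r‖ ≤ 1 := norm_unit r0' r1'
  have m4 : ‖(1 - r) * b'‖ ≤ 4 / 1100 := by
    have e1 : 1 - r = cfc (fun t => 1 - r0 t) β := one_sub_cfc hβs cr0
    have := norm_cfc_sub_le (v := b') hβ.1 hβ.2.1 (g := fun t => 1 - r0 t) (h := fun t => t) (by fun_prop) (by fun_prop)
      (c := 2) (by norm_num) fun t h0 h1 => by
        have k1 : 0 ≤ min (2 * t) 1 := le_min (by linarith) zero_le_one
        have k2 : min (2 * t) 1 ≤ 1 := min_le_right _ _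
        have : r0 t = 1 - min (2 * t) 1 := by
          rw [hr0, hrf]; simp only
          rw [max_eq_right (by linarith), min_eq_left (by linarith)]
        rw [this, abs_of_nonneg (by linarith), abs_of_nonneg h0]
        have := min_le_left (2 * t) 1
        linarith
    rw [← e1, cfc_id' ℝ β] at this
    linarith
  set x2 := r * b' * r with hx2
  have hx20 : 0 ≤ x2 := by have := conj_nonneg hb'.1 r; rwa [hrs.star_eq] at this
  have hx2s : IsSelfAdjoint x2 := .of_nonneg hx20
  have m5 : ‖b' - x2‖ ≤ 8 / 1100 := by
    have e1 : b' - x2 = (1 - r) * b' + r * star ((1 - r) * b') := by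
      rw [hx2, star_mul, star_sub, hrs.star_eq, hbs'.star_eq, star_one]; noncomm_ring
    rw [e1]
    refine (norm_add_le _ _).trans ?_
    have := norm_mul_le r (star ((1 - r) * b'))
    rw [norm_star] at this
    nlinarith [norm_nonneg ((1 - r) * b'), norm_nonneg r]
  have hx21 : x2 ≤ 1 := by
    have := conj_le hb'.2.1 r
    rw [hrs.star_eq, mul_one] at this
    refine this.trans ?_
    have : ‖r * r‖ ≤ 1 := nmul1 nr nr
    have h2 : 0 ≤ r * r := by have := star_mul_self_nonneg r; rwa [hrs.star_eq] at this
    exact (CStarAlgebra.norm_le_one_iff_of_nonneg _ h2).1 this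
  have hG : ∀ α β' : ℝ, 1/2 ≤ α → α < β' → cfc (ramp α β') β * x2 = 0 := fun α β' h1 h2 => by
    have : cfc (ramp α β') β * r = 0 := by
      rw [hr, cmul β (ramp_cont _ _) cr0, ← cfc_zero (R := ℝ) (a := β)]
      refine congrArg (fun g => cfc g β) (funext fun t => ?_)
      refine ramp_ramp_zero (γ := 0) h2 t r0 fun t ht => ?_
      rw [hr0, hrf]; simp only
      rw [min_eq_right (a := 2 * t) (by linarith)]; simp
    rw [hx2, ← mul_assoc, ← mul_assoc, this, zero_mul, zero_mul]
  have hGx : ∀ α β' γ' δ' : ℝ, 1/2 ≤ α → α < β' → 0 ≤ γ' → γ' < δ' → cfc (ramp α β') β * cfc (ramp γ' δ') x2 = 0 :=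
    fun α β' γ' δ' h1 h2 h3 h4 => by
    have := cfc_orth_mul (cfc_sa (ramp α β') β) hx2s (hG α β' h1 h2) continuous_id (ramp_cont γ' δ') rfl
      (ramp_zero h4 h3)
    rwa [cfc_id ℝ _ (cfc_sa (ramp α β') β)] at this
  have hxG : ∀ α β' γ' δ' : ℝ, 1/2 ≤ α → α < β' → 0 ≤ γ' → γ' < δ' → cfc (ramp γ' δ') x2 * cfc (ramp α β') β = 0 :=
    fun α β' γ' δ' h1 h2 h3 h4 => by
    rw [← (orth_comm (cfc_sa _ _) (cfc_sa _ _) (hGx α β' γ' δ' h1 h2 h3 h4)).eq]; exact hGx α β' γ' δ' h1 h2 h3 h4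
  set u := cfc (ramp (9/16) (5/8)) β with hu
  set u' := cfc (ramp (5/16) (3/8)) x2 with hu'
  set U := cfc (ramp (1/2) (9/16)) β with hU
  set U' := cfc (ramp (1/4) (5/16)) x2 with hU'
  have huu' : u * u' = 0 := hGx _ _ _ _ (by norm_num) (by norm_num) (by norm_num) (by norm_num)
  have hUu' : U * u' = 0 := hGx _ _ _ _ (by norm_num) (by norm_num) (by norm_num) (by norm_num)
  have hU'u : U' * u = 0 := hxG _ _ _ _ (by norm_num) (by norm_num) (by norm_num) (by norm_num)
  have hUU' : U * U' = 0 := hGx _ _ _ _ (by norm_num) (by norm_num) (by norm_num) (by norm_num)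
  have hUu : U * u = u := cfc_mul_of (ramp_cont _ _) (ramp_cont _ _) (ramp_ramp (by norm_num) (by norm_num) (by norm_num))
  have hU'u' : U' * u' = u' := cfc_mul_of (ramp_cont _ _) (ramp_cont _ _) (ramp_ramp (by norm_num) (by norm_num) (by norm_num))
  have un : ∀ (α β' : ℝ) (x : R), 0 ≤ cfc (ramp α β') x ∧ cfc (ramp α β') x ≤ 1 := fun α β' x =>
    cfc_unit x (ramp_nonneg _ _) (ramp_le_one _ _)
  set Y := U + U' with hY
  have hY0 : 0 ≤ Y := add_nonneg (un _ _ _).1 (un _ _ _).1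
  have hY1 : Y ≤ 1 := sum_orth_le_one (un _ _ _).1 (un _ _ _).2 (un _ _ _).1 (un _ _ _).2 hUU'
  have hYy : Y * (u + u') = u + u' := by
    rw [hY]; simp only [add_mul, mul_add, hUu, hUu', hU'u, hU'u']; abel
  -- the four estimates
  have q1 : q σ (cfc GG b) ≤ q σ u :=
    CLgen hc hσ (v := 1) he0 he1 hf0 hf1 (by simpa using norm_unit (zero_le_one (α := A)) le_rfl) (by simp) (by simp [hfe]) hb hβ
      (δ := 1/2) (by norm_num) (by norm_num) (adm_ramp (by norm_num)) (adm_weaken (by norm_num) (adm_ramp (by norm_num)))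
      fun t ht => ramp_one (by norm_num) ht
  have q2 : q σ (cfc GG b') ≤ q σ u' := by
    have hs0 := cut_nonneg (3/8) x2
    set S := cfc Real.sqrt (cut (3/8) x2) with hS
    have hSs : IsSelfAdjoint S := cfc_sa _ _
    refine q_comp hσ hbs' (un _ _ _).1 (un _ _ _).2 (z := S) ?_ (δ := 3/8 + 8/1100) (by norm_num) (by norm_num) ?_
      (adm_ramp (α := 1/2) (by norm_num))
    · rw [hS, cfc_cut _ _ Real.continuous_sqrt hx2s, cmul x2 (ramp_cont _ _) (by fun_prop)]
      refine congrArg (fun g => cfc g x2) (funext fun t => ?_)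
      rcases le_total t (3/8) with h | h
      · rw [max_eq_left (by linarith)]; simp
      · rw [ramp_one (by norm_num) h, one_mul]
    · rw [hSs.star_eq, hS, sq_sqrt hs0, map_add, ← add_assoc]
      have a1 := le_cut hx2s (3/8)
      have a2 := le_alg (hbs'.sub hx2s) m5
      rw [sub_le_iff_le_add'] at a2
      exact a2.trans (by gcongr)
  have q3 : q σ (u + u') = q σ u + q σ u' :=
    q_add hσ (cfc_sa _ _) (cfc_sa _ _) (orth_comm (cfc_sa _ _) (cfc_sa _ _) huu')
  have nn1 : ‖(1 - bF) * U‖ ≤ 4 / 1100 := by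
    have : ‖U * (1 - bF)‖ ≤ 2 * ‖cfc (fun t : ℝ => t) β * (1 - bF)‖ := by
      refine norm_cfc_sub_le hβ.1 hβ.2.1 (ramp_cont _ _) (by fun_prop) (by norm_num) fun t h0 h1 => ?_
      rw [abs_of_nonneg (ramp_nonneg _ _ _), abs_of_nonneg h0]
      rcases le_total t (1/2) with h | h
      · rw [ramp_zero (by norm_num) h]; linarith
      · have := ramp_le_one (1/2) (9/16) t; linarith
    rw [cfc_id' ℝ β, ← norm_star, ← norm_star (β * _)] at this
    rw [star_mul, star_mul, (cfc_sa _ _).star_eq, hβs.star_eq, star_sub, star_one, (IsSelfAdjoint.of_nonneg hbF.1).star_eq] at this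
    linarith
  have nn2 : ‖(1 - bF) * U'‖ ≤ 40 / 1100 := by
    have : ‖U' * (1 - bF)‖ ≤ 4 * ‖cfc (fun t : ℝ => t) x2 * (1 - bF)‖ := by
      refine norm_cfc_sub_le hx20 hx21 (ramp_cont _ _) (by fun_prop) (by norm_num) fun t h0 h1 => ?_
      rw [abs_of_nonneg (ramp_nonneg _ _ _), abs_of_nonneg h0]
      rcases le_total t (1/4) with h | h
      · rw [ramp_zero (by norm_num) h]; linarith
      · have := ramp_le_one (1/4) (5/16) t; linarith
    rw [cfc_id' ℝ x2, ← norm_star, ← norm_star (x2 * _)] at this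
    rw [star_mul, star_mul, (cfc_sa _ _).star_eq, hx2s.star_eq, star_sub, star_one, (IsSelfAdjoint.of_nonneg hbF.1).star_eq] at this
    have e1 : (1 - bF) * x2 = (1 - bF) * b' - (1 - bF) * (b' - x2) := by noncomm_ring
    have e2 : ‖(1 - bF) * x2‖ ≤ 10 / 1100 := by
      rw [e1]
      refine (norm_sub_le _ _).trans ?_
      have := norm_mul_le (1 - bF) (b' - x2)
      have := norm_one_sub hbF.1 hbF.2.1
      nlinarith [norm_nonneg (b' - x2)]
    linarith
  have nnY : ‖(1 - bF) * (1 * Y)‖ ≤ 44 / 1100 := by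
    rw [one_mul, hY, mul_add]
    exact (norm_add_le _ _).trans (by linarith)
  have q4 : q σ (cfc (ramp (3/8) (1/2)) (Y * Y)) ≤ q σ (cfc GG bF) :=
    CB hσ hY0 hY1 hbF.1 hbF.2.1 (by simpa using norm_unit (zero_le_one (α := R)) le_rfl) nnY
      (ε₂ := 0) (by simp) (by norm_num) (adm_ramp (by norm_num)) GG_adm fun t ht => ramp_one (by norm_num) ht
  have hYs : IsSelfAdjoint Y := .of_nonneg hY0
  have hYYs : IsSelfAdjoint (Y * Y) := by simpa [hYs.star_eq] using IsSelfAdjoint.star_mul_self Y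
  have q5 : q σ (u + u') ≤ q σ (cfc (ramp (3/8) (1/2)) (Y * Y)) := by
    have hy0 : 0 ≤ u + u' := add_nonneg (un _ _ _).1 (un _ _ _).1
    have hy1 : u + u' ≤ 1 := sum_orth_le_one (un _ _ _).1 (un _ _ _).2 (un _ _ _).1 (un _ _ _).2 huu'
    have := q_unit hσ (y := u + u') (e := cfc (ramp (3/8) (1/2)) (Y * Y)) (f := fun t => min (max 0 t) 1) hy0 (un _ _ _).1 (un _ _ _).2 ?_
      (by fun_prop) (fun t => le_min (le_max_left _ _) zero_le_one) (fun t => min_le_right _ _) (by simp)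
    · convert this using 2
      conv_lhs => rw [← cfc_id' ℝ (u + u') (IsSelfAdjoint.of_nonneg hy0)]
      refine cfc_congr fun t ht => ?_
      have a := spec_nonneg hy0 ht
      have b := (spec_bd (norm_unit hy0 hy1) ht).2
      rw [max_eq_right a, min_eq_left b]
    · have := cfc_mul_eigen (r := 1) (y := u + u') hYYs (by rw [mul_assoc, hYy, hYy, one_smul]) (ramp_cont (3/8) (1/2))
      rw [this, ramp_one (by norm_num) (by norm_num), one_smul]
  linarith

lemma DA_super (hc : Close i j) (hσ : IsQuasitrace σ) {a a' : A} (ha : 0 ≤ a) (ha' : 0 ≤ a') (h : a * a' = 0) :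
    DA σ i j a + DA σ i j a' ≤ DA σ i j (a + a') := by
  have has : IsSelfAdjoint a := .of_nonneg ha
  have has' : IsSelfAdjoint a' := .of_nonneg ha'
  have h' : a' * a = 0 := by rw [← (orth_comm has has' h).eq, h]
  have : ∀ e b, WB e a → Near i j e b → ∀ e' b', WB e' a' → Near i j e' b' →
      q σ (cfc GG b) + q σ (cfc GG b') ≤ DA σ i j (a + a') := by
    rintro e b ⟨he0, he1, s, hs, he⟩ hb e' b' ⟨he0', he1', s', hs', he'⟩ hb'
    obtain ⟨f0, f1⟩ := cfc_unit a (ramp_nonneg (s/2) s) (ramp_le_one (s/2) s)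
    set f := cfc (ramp (s/2) s) a with hf
    have hfe : f * e = e := he _ (ramp_cont _ _) fun t ht => ramp_one (by linarith) ht
    have hfe1 : cfc (ramp (s'/2) s') a' * e' = e' := he' _ (ramp_cont _ _) fun t ht => ramp_one (by linarith) ht
    have hfe' : f * e' = 0 := by
      rw [← hfe1, ← mul_assoc, hf, cfc_orth_mul has has' h (ramp_cont _ _) (ramp_cont _ _) (ramp_zero (by linarith) (by linarith))
        (ramp_zero (by linarith) (by linarith)), zero_mul]
    set r := min (s/2) (s'/2) with hr
    have hr0 : 0 < r := lt_min (by linarith) (by linarith)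
    have hrs : r ≤ s/2 := min_le_left _ _
    have hrs' : r ≤ s'/2 := min_le_right _ _
    have key : ∀ α β, 0 < α → α < β → β ≤ r → cfc (ramp α β) (a + a') * f = f ∧ cfc (ramp α β) (a + a') * e' = e' := by
      intro α β h1 h2 h3
      obtain ⟨g, hg, hg2⟩ := adm_factor h1 (adm_ramp h2)
      have e1 : cfc (ramp α β) (a + a') = cfc (ramp α β) a + cfc (ramp α β) a' := by
        rw [hg2]; exact cfc_orth_add has has' h hg
      rw [e1, add_mul, add_mul]
      constructor
      · rw [hf, cfc_orth_mul has' has h' (ramp_cont _ _) (ramp_cont _ _) (ramp_zero h2 h1.le) (ramp_zero (by linarith) (by linarith)), add_zero]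
        exact cfc_mul_of (ramp_cont _ _) (ramp_cont _ _) (ramp_ramp h2 (by linarith) (by linarith))
      · have z : cfc (ramp α β) a * e' = 0 := by
          rw [← hfe1, ← mul_assoc, cfc_orth_mul has has' h (ramp_cont _ _) (ramp_cont _ _) (ramp_zero h2 h1.le)
            (ramp_zero (by linarith) (by linarith)), zero_mul]
        rw [z, zero_add]
        exact he' _ (ramp_cont _ _) fun t ht => ramp_one h2 (by linarith)
    obtain ⟨F0, F1⟩ := cfc_unit (a + a') (ramp_nonneg (r/2) r) (ramp_le_one (r/2) r)
    obtain ⟨k1, k2⟩ := key (r/2) r (by linarith) (by linarith) le_rfl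
    set F := cfc (ramp (r/2) r) (a + a') with hF
    have wF : WB F (a + a') := by
      refine WB.intro F0 F1 (s := r / 4) (by positivity) (adm_ramp (β := r/2) (by linarith)) ?_
      exact cfc_mul_of (ramp_cont _ _) (ramp_cont _ _) (ramp_ramp (by linarith) (by linarith) (by linarith))
    obtain ⟨bF, b0, b1, b2⟩ := hc.pos F F0 F1
    obtain ⟨bf, b3, b4, b5⟩ := hc.pos f f0 f1
    exact (DA_super_core hc hσ he0 he1 f0 f1 he0' he1' F0 F1 hfe hfe' k1 k2 hb ⟨b3, b4, b5⟩ hb' ⟨b0, b1, b2⟩).trans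
      (le_DA hσ wF ⟨b0, b1, b2⟩)
  have h1 : DA σ i j a ≤ DA σ i j (a + a') - DA σ i j a' := by
    refine DA_le hσ fun e b he hb => ?_
    have : DA σ i j a' ≤ DA σ i j (a + a') - q σ (cfc GG b) := by
      refine DA_le hσ fun e' b' he' hb' => ?_
      have := this e b he hb e' b' he' hb'
      linarith
    linarith
  linarith

end
end QT

namespace QT
section
open scoped ComplexStarModule
variable {R : Type*} [CStarAlgebra R] {σ : R → ℂ} [PartialOrder R] [StarOrderedRing R]
variable {A : Type*} [CStarAlgebra A] [PartialOrder A] [StarOrderedRing A]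
variable {E : Type*} [CStarAlgebra E] [PartialOrder E] [StarOrderedRing E]
variable {i : A →⋆ₐ[ℂ] E} {j : R →⋆ₐ[ℂ] E} {P Q w : R}

lemma le_sum_of {e f g : A} (he0 : 0 ≤ e) (he1 : e ≤ 1) (hf0 : 0 ≤ f) (hf1 : f ≤ 1) (hg0 : 0 ≤ g) (hg1 : g ≤ 1)
    (hfg : Commute f g) (h : (1 - f) * (1 - g) * e = 0) : e ≤ f + g := by
  have hes : IsSelfAdjoint e := .of_nonneg he0
  have c1 : Commute (1 - f) (1 - g) := ((Commute.one_left _).sub_left ((Commute.one_right f).sub_right hfg))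
  have k0 : 0 ≤ (1 - f) * (1 - g) := c1.mul_nonneg (sub_nonneg.2 hf1) (sub_nonneg.2 hg1)
  set p := 1 - (1 - f) * (1 - g) with hp
  have c2 : Commute (1 - f) g := (Commute.one_left _).sub_left hfg
  have hp0 : 0 ≤ p := by
    have : p = f + (1 - f) * g := by rw [hp]; noncomm_ring
    rw [this]
    exact add_nonneg hf0 (c2.mul_nonneg (sub_nonneg.2 hf1) hg0)
  have hps : IsSelfAdjoint p := .of_nonneg hp0
  have hpe : p * e = e := by rw [hp, sub_mul, h, one_mul, sub_zero]
  have hep : e * p = e := by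
    have := congrArg star hpe
    rwa [star_mul, hes.star_eq, hps.star_eq] at this
  have e1 : e ≤ p * p := by
    have := conj_le he1 p
    rwa [hps.star_eq, hpe, hep, mul_one] at this
  have e2 : p * p ≤ p := by
    have c3 : Commute p (1 - p) := (Commute.one_right p).sub_right (Commute.refl p)
    have := c3.mul_nonneg hp0 (by rw [hp]; simpa using k0)
    rwa [mul_sub, mul_one, sub_nonneg] at this
  have e3 : p ≤ f + g := by
    have : p = f + g - f * g := by rw [hp]; noncomm_ring
    rw [this]
    exact sub_le_self _ (hfg.mul_nonneg hf0 hg0)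
  exact e1.trans (e2.trans e3)

lemma DA_sub_core (hc : Close i j) (hσ : IsQuasitrace σ) (hcor : Corner P Q w) {e f g a a' : A} {b : R}
    (he0 : 0 ≤ e) (he1 : e ≤ 1) (hf : WB f a) (hg : WB g a')
    (hfg : Commute f g) (h : (1 - f) * (1 - g) * e = 0) (hb : Near i j e b) :
    q σ (cfc GG b) ≤ DA σ i j a + DA σ i j a' := by
  have hle := le_sum_of he0 he1 hf.1 hf.2.1 hg.1 hg.2.1 hfg h
  obtain ⟨bf, bf0, bf1, bfn⟩ := hc.pos f hf.1 hf.2.1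
  obtain ⟨bg, bg0, bg1, bgn⟩ := hc.pos g hg.1 hg.2.1
  have hbs : IsSelfAdjoint b := .of_nonneg hb.1
  have hbfs : IsSelfAdjoint bf := .of_nonneg bf0
  have hbgs : IsSelfAdjoint bg := .of_nonneg bg0
  have s1 : b ≤ bf + bg + algebraMap ℝ R (3 / 1100) := by
    rw [← sub_nonneg]
    refine reflect hc.inj (((hbfs.add hbgs).add (.algebraMap R (.all _))).sub hbs) ?_
    rw [map_sub, map_add, map_add, map_alg]
    have h1 := map_le i hle
    rw [map_add] at h1
    have hes : IsSelfAdjoint e := .of_nonneg he0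
    have hfs : IsSelfAdjoint f := .of_nonneg hf.1
    have hgs : IsSelfAdjoint g := .of_nonneg hg.1
    have n1 := le_alg ((hfs.map i).sub (hbfs.map j)) bfn
    have n2 := le_alg ((hgs.map i).sub (hbgs.map j)) bgn
    have n3 := neg_le_alg ((hes.map i).sub (hbs.map j)) hb.2.2
    have t : algebraMap ℝ E (3 / 1100) = algebraMap ℝ E (1 / 1100) + algebraMap ℝ E (1 / 1100) + algebraMap ℝ E (1 / 1100) := by
      rw [← map_add, ← map_add]; norm_num
    rw [t]
    have := add_nonneg (add_nonneg (sub_nonneg.2 n1) (sub_nonneg.2 n2)) (add_nonneg (sub_nonneg.2 n3) (sub_nonneg.2 h1))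
    convert this using 1
    abel
  have s2 : b ≤ star (1:R) * (cut (6/25) bf + cut (6/25) bg) * 1 + algebraMap ℝ R (12/25 + 3/1100) := by
    have t : algebraMap ℝ R (12/25 + 3 / 1100) = algebraMap ℝ R (6 / 25) + algebraMap ℝ R (6/25) + algebraMap ℝ R (3 / 1100) := by
      rw [← map_add, ← map_add]; norm_num
    rw [t, star_one, one_mul, mul_one]
    refine s1.trans ?_
    have h1 := le_cut hbfs (6/25)
    have h2 := le_cut hbgs (6/25)
    calc bf + bg + algebraMap ℝ R (3 / 1100) ≤ (cut (6/25) bf + algebraMap ℝ R (6/25)) + (cut (6/25) bg + algebraMap ℝ R (6/25)) + algebraMap ℝ R (3 / 1100) := by gcongr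
      _ = _ := by abel
  have s3 : q σ (cfc GG b) ≤ D σ (cut (6/25) bf + cut (6/25) bg) :=
    q_comp_D hσ hbs (add_nonneg (cut_nonneg _ _) (cut_nonneg _ _)) (by norm_num) (δ' := 1/2) (by norm_num) s2 (adm_ramp (by norm_num))
  have s4 := D_subadd hσ hcor (cut_nonneg (6/25) bf) (cut_nonneg (6/25) bg)
  have gen : ∀ {f : A} {a : A} {bf : R}, WB f a → Near i j f bf → D σ (cut (6/25) bf) ≤ DA σ i j a := by
    intro f a bf hf hbf
    obtain ⟨f', hf', hff⟩ := hf.exists_mid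
    obtain ⟨b', b0, b1, b2⟩ := hc.pos f' hf'.1 hf'.2.1
    have t1 := D_cut_le_q hσ (IsSelfAdjoint.of_nonneg hbf.1) (by norm_num : (1/5:ℝ) < 6/25)
    have t2 : q σ (cfc (ramp (1/5) (6/25)) bf) ≤ q σ (cfc GG b') :=
      CLgen hc hσ (v := 1) hf.1 hf.2.1 hf'.1 hf'.2.1 (by simpa using norm_unit (zero_le_one (α := A)) le_rfl) (by simp) (by simp [hff]) hbf
        ⟨b0, b1, b2⟩ (δ := 1/5) (by norm_num) (by norm_num) (adm_ramp (by norm_num)) GG_adm fun t ht => ramp_one (by norm_num) ht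
    exact t1.trans (t2.trans (le_DA hσ hf' ⟨b0, b1, b2⟩))
  have s5 := gen hf ⟨bf0, bf1, bfn⟩
  have s6 := gen hg ⟨bg0, bg1, bgn⟩
  linarith

lemma DA_near (hc : Close i j) (hσ : IsQuasitrace σ) {a : A} {b : R} (ha0 : 0 ≤ a) (ha1 : a ≤ 1) (hb0 : 0 ≤ b)
    (hb1 : b ≤ 1) (hab : ‖i a - j b‖ ≤ 1 / 1100) {s : ℝ} (hs0 : 0 ≤ s) (hs1 : s ≤ 1) :
    DA σ i j (cut s a) ≤ D σ (cut (s - 13 / 1100) b) := DA_le hσ fun e x he hx => by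
  obtain ⟨he0, he1, r, hr, he⟩ := he
  have has : IsSelfAdjoint a := .of_nonneg ha0
  have hbs : IsSelfAdjoint b := .of_nonneg hb0
  have hes : IsSelfAdjoint e := .of_nonneg he0
  have hxs : IsSelfAdjoint x := .of_nonneg hx.1
  have hce := he (ramp (r/2) r) (ramp_cont _ _) fun t ht => ramp_one (by linarith) ht
  rw [cfc_cut a _ (ramp_cont _ _) has] at hce
  set c0 : ℝ → ℝ := fun t => ramp (r/2) r (max 0 (t - s)) with hc0
  have cc : Continuous c0 := (ramp_cont _ _).comp (by fun_prop)
  set as := a - algebraMap ℝ A s with has'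
  have eas : as = cfc (fun t : ℝ => t - s) a := by
    rw [← csub (f := fun t => t) (g := fun _ => s) a (by fun_prop) (by fun_prop), cfc_id' ℝ a, cfc_const s a]
  have ec : e * cfc c0 a = e := by
    have := congrArg star hce
    rwa [star_mul, hes.star_eq, (cfc_sa c0 a).star_eq] at this
  have p1 : 0 ≤ e * as * e := by
    have : 0 ≤ cfc c0 a * as * cfc c0 a := by
      rw [eas, cmul a cc (by fun_prop), cmul a (by fun_prop) cc]
      refine cfc_nonneg fun t _ => ?_
      rcases le_total t s with h | h
      · have : c0 t = 0 := by
          rw [hc0]; simp only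
          rw [max_eq_left (by linarith)]; exact ramp_zero (by linarith) (by linarith)
        rw [this]; simp
      · have : 0 ≤ c0 t := ramp_nonneg _ _ _
        have : 0 ≤ t - s := by linarith
        positivity
    have := conj_nonneg this e
    rw [hes.star_eq] at this
    convert this using 1
    calc e * as * e = (e * cfc c0 a) * as * (cfc c0 a * e) := by rw [ec, hce]
      _ = _ := by simp only [mul_assoc]
  have nas : ‖as‖ ≤ 1 := by
    rw [eas]
    refine norm_cfc_le zero_le_one fun t ht => ?_
    have h1 := spec_nonneg ha0 ht
    have h2 := (spec_bd (norm_unit ha0 ha1) ht).2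
    rw [Real.norm_eq_abs, abs_le]; constructor <;> linarith
  set bs := b - algebraMap ℝ R s with hbs'
  have hbss : IsSelfAdjoint bs := hbs.sub (.algebraMap R (.all _))
  have p2 : -algebraMap ℝ R (3 / 1100) ≤ x * bs * x := by
    rw [← sub_nonneg, sub_neg_eq_add]
    have hsx : IsSelfAdjoint (x * bs * x) := by have := hbss.conjugate' x; rwa [hxs.star_eq] at this
    refine reflect hc.inj (hsx.add (.algebraMap R (.all _))) ?_
    have hxe : ‖j x - i e‖ ≤ 1 / 1100 := by rw [norm_sub_rev]; exact hx.2.2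
    have hbb : ‖j bs - i as‖ ≤ 1 / 1100 := by
      rw [norm_sub_rev]
      have e9 : i as - j bs = i a - j b := by
        rw [has', hbs', map_sub, map_sub, map_alg, map_alg]; abel
      rw [e9]; exact hab
    have n1 : ‖i e‖ ≤ 1 := by rw [hc.ni]; exact norm_unit he0 he1
    have n2 : ‖j x‖ ≤ 1 := by rw [hc.nj]; exact norm_unit hx.1 hx.2.1
    have n3 : ‖i as‖ ≤ 1 := by rw [hc.ni]; exact nas
    have n4 : ‖j bs‖ ≤ 1 := by
      have eb : bs = cfc (fun t : ℝ => t - s) b := by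
        rw [← csub (f := fun t => t) (g := fun _ => s) b (by fun_prop) (by fun_prop), cfc_id' ℝ b, cfc_const s b]
      rw [hc.nj, eb]
      refine norm_cfc_le zero_le_one fun t ht => ?_
      have h1 := spec_nonneg hb0 ht
      have h2 := (spec_bd (norm_unit hb0 hb1) ht).2
      rw [Real.norm_eq_abs, abs_le]; constructor <;> linarith
    have := dbl (dbl hxe hbb n4 n1) hxe n2 (nmul1 n1 n3)
    have hse : IsSelfAdjoint (e * as * e) := .of_nonneg p1
    rw [← map_mul, ← map_mul, ← map_mul, ← map_mul] at this
    have l1 := neg_le_alg ((hsx.map j).sub (hse.map i)) this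
    have l2 := map_nn i p1
    rw [map_add, map_alg]
    have l3 := add_nonneg (sub_nonneg.2 l1) l2
    convert l3 using 1
    rw [show (3 / 1100 : ℝ) = 1/1100 + 1/1100 + 1/1100 by norm_num]
    abel
  set bd := cut (s - 13 / 1100) b with hbd
  have p3 : bs + algebraMap ℝ R (13 / 1100) ≤ bd := by
    have := le_cut hbs (s - 13 / 1100)
    rw [map_sub, ← sub_le_iff_le_add] at this
    convert this using 1
    rw [hbs']; abel
  have p4 := conj_le p3 x
  rw [hxs.star_eq] at p4
  have p5 : x * (bs + algebraMap ℝ R (13 / 1100)) * x = x * bs * x + (13 / 1100 : ℝ) • (x * x) := by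
    rw [mul_add, add_mul, ← Algebra.commutes, mul_assoc (algebraMap ℝ R _), Algebra.smul_def]
  have p6 : x * x ≤ star x * ((1100 / 13 : ℝ) • bd) * x + algebraMap ℝ R (3 / 13) := by
    rw [p5] at p4
    have h1 : (13 / 1100 : ℝ) • (x * x) ≤ x * bd * x + algebraMap ℝ R (3 / 1100) := by
      have := add_le_add p4 (sub_nonneg.2 p2)
      rw [← sub_nonneg] at this ⊢
      convert this using 1
      abel
    have h2 := smul_le_smul_of_nonneg_left h1 (by norm_num : (0:ℝ) ≤ 1100 / 13)
    rw [smul_smul, smul_add] at h2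
    norm_num at h2
    rw [hxs.star_eq]
    convert h2 using 2
    · rw [mul_smul_comm, smul_mul_assoc]
    · rw [Algebra.algebraMap_eq_smul_one, Algebra.algebraMap_eq_smul_one, smul_smul]; norm_num
  have hbd0 : 0 ≤ bd := cut_nonneg _ _
  have h8 : 0 ≤ (1100 / 13 : ℝ) • bd := smul_nonneg (by norm_num) hbd0
  have fin : q σ (cfc GG x) ≤ D σ ((1100 / 13 : ℝ) • bd) := by
    rw [cfc_sq hx.1 (ramp_cont _ _)]
    exact q_comp_D hσ (by simpa [hxs.star_eq] using IsSelfAdjoint.star_mul_self x) h8 (by norm_num)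
      (δ' := 1/2 * (1/2)) (by norm_num) p6 (adm_sqrt (by norm_num) (adm_ramp (by norm_num)))
  exact fin.trans (D_smul_le hσ hbd0 (by norm_num))

end
end QT

namespace QT
section
open scoped ComplexStarModule
variable {R : Type*} [CStarAlgebra R] {σ : R → ℂ} [PartialOrder R] [StarOrderedRing R]
variable {A : Type*} [CStarAlgebra A] [PartialOrder A] [StarOrderedRing A]
variable {E : Type*} [CStarAlgebra E] [PartialOrder E] [StarOrderedRing E]
variable {i : A →⋆ₐ[ℂ] E} {j : R →⋆ₐ[ℂ] E} {P Q w : R}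

/-- real functions of a normal element -/
noncomputable def FN (N : A) (f : ℂ → ℝ) : A := cfc (fun z : ℂ => ((f z : ℝ) : ℂ)) N

section
variable {N : A} [IsStarNormal N] {f g : ℂ → ℝ}

lemma FN_mul (hf : Continuous f) (hg : Continuous g) : FN N f * FN N g = FN N (fun z => f z * g z) := by
  unfold FN
  rw [← cfc_mul _ _ N (by fun_prop) (by fun_prop)]
  simp only [Complex.ofReal_mul]

lemma FN_add (hf : Continuous f) (hg : Continuous g) : FN N f + FN N g = FN N (fun z => f z + g z) := by
  unfold FN
  rw [← cfc_add N _ _ (by fun_prop) (by fun_prop)]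
  simp only [Complex.ofReal_add]

lemma FN_smul (c : ℝ) (hf : Continuous f) : c • FN N f = FN N (fun z => c * f z) := by
  unfold FN
  have := cfc_const_mul (c : ℂ) (fun z : ℂ => ((f z : ℝ) : ℂ)) N (by fun_prop)
  simp only [Complex.ofReal_mul]
  rw [this, Complex.coe_smul]

lemma FN_const (c : ℝ) : FN N (fun _ => c) = algebraMap ℝ A c := by
  unfold FN
  rw [cfc_const _ N, IsScalarTower.algebraMap_apply ℝ ℂ A]
  rfl

lemma FN_sa : IsSelfAdjoint (FN N f) := by
  unfold FN
  rw [isSelfAdjoint_iff, ← cfc_star]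
  simp

lemma FN_nonneg (h : ∀ z, 0 ≤ f z) : 0 ≤ FN N f :=
  cfc_nonneg fun z _ => by simpa using h z

lemma FN_congr (h : ∀ z ∈ spectrum ℂ N, f z = g z) : FN N f = FN N g :=
  cfc_congr fun z hz => by simp only [h z hz]

lemma FN_cfc {ψ : ℝ → ℝ} (hψ : Continuous ψ) (hf : Continuous f) : cfc ψ (FN N f) = FN N (fun z => ψ (f z)) := by
  rw [cfc_real_eq_complex ψ FN_sa]
  unfold FN
  rw [← cfc_comp' (fun x : ℂ => ((ψ x.re : ℝ) : ℂ)) _ N (by fun_prop) (by fun_prop)]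
  simp only [Complex.ofReal_re]

lemma FN_cut (s : ℝ) (hf : Continuous f) : cut s (FN N f) = FN N (fun z => max 0 (f z - s)) :=
  FN_cfc (ψ := fun t => max 0 (t - s)) (by fun_prop) hf

lemma FN_WB_mono (hf : Continuous f) (hg : Continuous g)
    (h : ∀ z ∈ spectrum ℂ N, 0 < f z → 0 < g z) {e : A} (he : WB e (FN N f)) : WB e (FN N g) := by
  obtain ⟨h0, h1, s, hs, he⟩ := he
  have hce := he (ramp (s/2) s) (ramp_cont _ _) fun t ht => ramp_one (by linarith) ht
  obtain ⟨t, ht, htg⟩ : ∃ t > 0, ∀ z ∈ spectrum ℂ N, s / 2 ≤ f z → t ≤ g z := by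
    have hK : IsCompact (spectrum ℂ N ∩ {z | s / 2 ≤ f z}) :=
      (spectrum.isCompact N).inter_right (isClosed_le continuous_const hf)
    rcases (spectrum ℂ N ∩ {z | s / 2 ≤ f z}).eq_empty_or_nonempty with h3 | h3
    · refine ⟨1, one_pos, fun z hz hz' => ?_⟩
      have : z ∈ spectrum ℂ N ∩ {z | s / 2 ≤ f z} := ⟨hz, hz'⟩
      rw [h3] at this; exact this.elim
    · obtain ⟨x, hx, hm⟩ := hK.exists_isMinOn h3 hg.continuousOn
      exact ⟨g x, h x hx.1 (by have : s / 2 ≤ f x := hx.2; linarith), fun z hz hz' => hm ⟨hz, hz'⟩⟩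
  refine ⟨h0, h1, t, ht, fun ψ hψ h1 => ?_⟩
  conv_lhs => rw [← hce]
  conv_rhs => rw [← hce]
  have cr := ramp_cont (s/2) s
  rw [← mul_assoc, FN_cfc hψ hg, FN_cfc cr hf, FN_mul (by fun_prop) (by fun_prop)]
  congr 1
  refine FN_congr fun z hz => ?_
  rcases le_total (f z) (s/2) with h2 | h2
  · rw [ramp_zero (by linarith) h2, mul_zero]
  · rw [h1 _ (htg z hz h2), one_mul]

lemma FN_DA_mono (hσ : IsQuasitrace σ) (hf : Continuous f) (hg : Continuous g)
    (h : ∀ z ∈ spectrum ℂ N, 0 < f z → 0 < g z) : DA σ i j (FN N f) ≤ DA σ i j (FN N g) :=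
  DA_mono hσ fun e he => FN_WB_mono hf hg h he

lemma FN_DA_sub (hc : Close i j) (hσ : IsQuasitrace σ) (hcor : Corner P Q w) (hf : Continuous f) (hg : Continuous g) :
    DA σ i j (FN N (fun z => f z + g z)) ≤ DA σ i j (FN N f) + DA σ i j (FN N g) := DA_le hσ fun e b he hb => by
  obtain ⟨h0, h1, s, hs, he⟩ := he
  have hce := he (ramp (s/2) s) (ramp_cont _ _) fun t ht => ramp_one (by linarith) ht
  have cr := ramp_cont (s/2) s
  have cr' := ramp_cont (s/8) (s/4)
  have key : ∀ {f : ℂ → ℝ}, Continuous f → WB (FN N fun z => ramp (s/8) (s/4) (f z)) (FN N f) := fun {f} hf => by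
    rw [← FN_cfc cr' hf]
    obtain ⟨c0, c1⟩ := cfc_unit (FN N f) (ramp_nonneg (s/8) (s/4)) (ramp_le_one (s/8) (s/4))
    refine WB.intro c0 c1 (s := s / 16) (by positivity) (adm_ramp (β := s/8) (by linarith)) ?_
    rw [cmul _ (ramp_cont _ _) (ramp_cont _ _)]
    refine congrArg (fun g => cfc g _) (funext fun t => ?_)
    rcases le_total t (s/8) with h | h
    · rw [ramp_zero (α := s/8) (by linarith) h, mul_zero]
    · rw [ramp_one (α := s/16) (by linarith) h, one_mul]
  refine DA_sub_core hc hσ hcor h0 h1 (key hf) (key hg) ?_ ?_ hb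
  · rw [Commute, SemiconjBy, FN_mul (by fun_prop) (by fun_prop), FN_mul (by fun_prop) (by fun_prop)]
    simp only [mul_comm]
  · have e1 : ∀ {h : ℂ → ℝ}, Continuous h → 1 - FN N h = FN N fun z => 1 - h z := fun {h} hh => by
      have : FN N (fun z => 1 - h z) + FN N h = 1 := by
        rw [FN_add (by fun_prop) hh]
        simp only [sub_add_cancel]
        rw [FN_const, map_one]
      rw [← this]; abel
    rw [e1 (by fun_prop), e1 (by fun_prop), ← hce, ← mul_assoc, FN_cfc cr (by fun_prop),
      FN_mul (by fun_prop) (by fun_prop), FN_mul (by fun_prop) (by fun_prop)]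
    have : FN N (fun z => (1 - ramp (s/8) (s/4) (f z)) * (1 - ramp (s/8) (s/4) (g z)) * ramp (s/2) s (f z + g z)) = 0 := by
      rw [show (0:A) = algebraMap ℝ A 0 by rw [map_zero], ← FN_const (N := N)]
      refine FN_congr fun z hz => ?_
      rcases le_total (f z + g z) (s/2) with h2 | h2
      · rw [ramp_zero (α := s/2) (by linarith) h2, mul_zero]
      · rcases le_total (s/4) (f z) with h3 | h3
        · rw [ramp_one (α := s/8) (t := f z) (by linarith) h3]; ring
        · rw [ramp_one (α := s/8) (t := g z) (by linarith) (by linarith)]; ring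
    rw [this, zero_mul]

def LSet (σ : R → ℂ) (i : A →⋆ₐ[ℂ] E) (j : R →⋆ₐ[ℂ] E) (N : A) (K : Set ℂ) : Set ℝ :=
  {x | ∃ f : ℂ → ℝ, Continuous f ∧ (∀ z, 0 ≤ f z) ∧ (∀ z ∈ K, 0 < f z) ∧ x = DA σ i j (FN N f)}

noncomputable def lam (σ : R → ℂ) (i : A →⋆ₐ[ℂ] E) (j : R →⋆ₐ[ℂ] E) (N : A) (K : Set ℂ) : ℝ :=
  sInf (LSet σ i j N K)

lemma lam_le (hσ : IsQuasitrace σ) {K : Set ℂ} (hf : Continuous f) (h0 : ∀ z, 0 ≤ f z) (h : ∀ z ∈ K, 0 < f z) :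
    lam σ i j N K ≤ DA σ i j (FN N f) := by
  refine csInf_le ⟨0, ?_⟩ ⟨f, hf, h0, h, rfl⟩
  rintro x ⟨f, -, -, -, rfl⟩
  exact DA_nonneg hσ _

lemma le_lam (hσ : IsQuasitrace σ) {K : Set ℂ} {c : ℝ} (h : ∀ f : ℂ → ℝ, Continuous f → (∀ z, 0 ≤ f z) →
    (∀ z ∈ K, 0 < f z) → c ≤ DA σ i j (FN N f)) : c ≤ lam σ i j N K := by
  refine le_csInf ⟨_, fun _ => 1, continuous_const, fun _ => zero_le_one, fun _ _ => one_pos, rfl⟩ ?_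
  rintro x ⟨f, h1, h2, h3, rfl⟩
  exact h f h1 h2 h3

lemma lam_nonneg (hσ : IsQuasitrace σ) (K : Set ℂ) : 0 ≤ lam σ i j N K := le_lam hσ fun _ _ _ _ => DA_nonneg hσ _

lemma lam_mono (hσ : IsQuasitrace σ) {K K' : Set ℂ} (h : K ⊆ K') : lam σ i j N K ≤ lam σ i j N K' :=
  le_lam hσ fun f h1 h2 h3 => lam_le hσ h1 h2 fun z hz => h3 z (h hz)

lemma lam_sub (hc : Close i j) (hσ : IsQuasitrace σ) (hcor : Corner P Q w) (K K' : Set ℂ) :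
    lam σ i j N (K ∪ K') ≤ lam σ i j N K + lam σ i j N K' := by
  rw [← sub_le_iff_le_add]
  refine le_lam hσ fun f h1 h2 h3 => ?_
  rw [sub_le_comm]
  refine le_lam hσ fun g h1' h2' h3' => ?_
  rw [sub_le_iff_le_add']
  refine le_trans ?_ (FN_DA_sub hc hσ hcor h1 h1')
  refine lam_le hσ (by fun_prop) (fun z => add_nonneg (h2 z) (h2' z)) fun z hz => ?_
  rcases hz with hz | hz
  · linarith [h3 z hz, h2' z]
  · linarith [h3' z hz, h2 z]

lemma lam_super (hc : Close i j) (hσ : IsQuasitrace σ) {K K' : Set ℂ} (hK : IsClosed K) (hK' : IsClosed K')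
    (hd : Disjoint K K') : lam σ i j N K + lam σ i j N K' ≤ lam σ i j N (K ∪ K') := by
  refine le_lam hσ fun f h1 h2 h3 => ?_
  obtain ⟨u, hu0, hu1, -⟩ := exists_continuous_zero_one_of_isClosed hK hK' hd
  have cu : Continuous fun z => u z := u.continuous
  set f1 : ℂ → ℝ := fun z => f z * max 0 (1 / 2 - u z)
  set f2 : ℂ → ℝ := fun z => f z * max 0 (u z - 1 / 2)
  have c1 : Continuous f1 := by fun_prop
  have c2 : Continuous f2 := by fun_prop
  have n1 : ∀ z, 0 ≤ f1 z := fun z => mul_nonneg (h2 z) (le_max_left _ _)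
  have n2 : ∀ z, 0 ≤ f2 z := fun z => mul_nonneg (h2 z) (le_max_left _ _)
  have l1 : lam σ i j N K ≤ DA σ i j (FN N f1) := lam_le hσ c1 n1 fun z hz =>
    mul_pos (h3 z (.inl hz)) (lt_max_of_lt_right (by rw [hu0 hz]; norm_num))
  have l2 : lam σ i j N K' ≤ DA σ i j (FN N f2) := lam_le hσ c2 n2 fun z hz =>
    mul_pos (h3 z (.inr hz)) (lt_max_of_lt_right (by rw [hu1 hz]; norm_num))
  have l3 := DA_super hc hσ (FN_nonneg (N := N) n1) (FN_nonneg (N := N) n2) (by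
    rw [FN_mul c1 c2, show (0:A) = algebraMap ℝ A 0 by rw [map_zero], ← FN_const (N := N)]
    refine FN_congr fun z _ => ?_
    simp only [f1, f2]
    rcases le_total (u z) (1/2) with h | h
    · rw [max_eq_left (a := (0:ℝ)) (b := u z - 1/2) (by linarith)]; ring
    · rw [max_eq_left (a := (0:ℝ)) (b := 1/2 - u z) (by linarith)]; ring)
  rw [FN_add c1 c2] at l3
  refine (add_le_add l1 l2).trans (l3.trans (FN_DA_mono hσ (by fun_prop) h1 fun z _ hz => ?_))
  by_contra hn
  have : f z = 0 := le_antisymm (not_lt.1 hn) (h2 z)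
  simp [f1, f2, this] at hz

end

noncomputable def cont (hc : Close i j) (hσ : IsQuasitrace σ) (hcor : Corner P Q w) (N : A) [IsStarNormal N] :
    MeasureTheory.Content ℂ where
  toFun K := ⟨lam σ i j N K, lam_nonneg hσ K⟩
  mono' K K' h := lam_mono hσ h
  sup_disjoint' K K' h h1 h2 := NNReal.coe_injective (le_antisymm
    (lam_sub hc hσ hcor K K') (lam_super hc hσ h1 h2 h))
  sup_le' K K' := lam_sub hc hσ hcor K K'

lemma cont_apply (hc : Close i j) (hσ : IsQuasitrace σ) (hcor : Corner P Q w) (N : A) [IsStarNormal N]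
    (K : TopologicalSpace.Compacts ℂ) : cont hc hσ hcor N K = ENNReal.ofReal (lam σ i j N K) := by
  rw [ENNReal.ofReal_eq_coe_nnreal (lam_nonneg hσ K)]; rfl

lemma meas_lt (hc : Close i j) (hσ : IsQuasitrace σ) (hcor : Corner P Q w) (N : A) [IsStarNormal N] {f : ℂ → ℝ}
    (hf : Continuous f) (s : ℝ) : (cont hc hσ hcor N).measure {z | s < f z} = ENNReal.ofReal (DA σ i j (cut s (FN N f))) := by
  have ho : IsOpen {z | s < f z} := isOpen_lt continuous_const hf
  rw [MeasureTheory.Content.measure_apply _ ho.measurableSet, MeasureTheory.Content.outerMeasure_of_isOpen _ _ ho,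
    FN_cut s hf]
  apply le_antisymm
  · refine iSup₂_le fun K hK => ?_
    rw [cont_apply]
    refine ENNReal.ofReal_le_ofReal (lam_le hσ (by fun_prop) (fun z => le_max_left _ _) fun z hz => ?_)
    have : s < f z := hK hz
    exact lt_max_of_lt_right (by linarith)
  · rw [ENNReal.ofReal_le_iff_le_toReal]
    · refine DA_lsc hσ FN_sa fun δ hδ => ?_
      set K : TopologicalSpace.Compacts ℂ := ⟨spectrum ℂ N ∩ {z | s + δ ≤ f z},
        (spectrum.isCompact N).inter_right (isClosed_le continuous_const hf)⟩ with hK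
      have h1 := MeasureTheory.Content.le_innerContent (cont hc hσ hcor N) K ⟨_, ho⟩ (by
        rintro z ⟨-, hz⟩
        have : s + δ ≤ f z := hz
        show s < f z
        linarith)
      rw [cont_apply, ENNReal.ofReal_le_iff_le_toReal] at h1
      · refine le_trans (le_lam hσ fun g h1 h2 h3 => ?_) h1
        rw [FN_cut _ (by fun_prop)]
        refine FN_DA_mono hσ (by fun_prop) h1 fun z hz hz' => h3 z ⟨hz, ?_⟩
        show s + δ ≤ f z
        by_contra hn
        rcases le_total (f z) s with h4 | h4
        · rw [max_eq_left (a := (0:ℝ)) (b := f z - s) (by linarith), max_eq_left (by linarith)] at hz'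
          exact lt_irrefl _ hz'
        · rw [max_eq_right (a := (0:ℝ)) (b := f z - s) (by linarith), max_eq_left (by linarith)] at hz'
          exact lt_irrefl _ hz'
      · refine ne_top_of_le_ne_top (b := ENNReal.ofReal (q σ 1)) ENNReal.ofReal_ne_top (iSup₂_le fun K hK => ?_)
        rw [cont_apply]
        exact ENNReal.ofReal_le_ofReal ((lam_le hσ continuous_const (fun _ => zero_le_one) fun _ _ => one_pos).trans (DA_le_one hσ _))
    · refine ne_top_of_le_ne_top (b := ENNReal.ofReal (q σ 1)) ENNReal.ofReal_ne_top (iSup₂_le fun K hK => ?_)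
      rw [cont_apply]
      exact ENNReal.ofReal_le_ofReal ((lam_le hσ continuous_const (fun _ => zero_le_one) fun _ _ => one_pos).trans (DA_le_one hσ _))

open MeasureTheory in
noncomputable def SI (σ : R → ℂ) (i : A →⋆ₐ[ℂ] E) (j : R →⋆ₐ[ℂ] E) (a : A) : ENNReal :=
  ∫⁻ s in Set.Ioi (0:ℝ), ENNReal.ofReal (DA σ i j (cut s a))

open MeasureTheory in
lemma SI_FN (hc : Close i j) (hσ : IsQuasitrace σ) (hcor : Corner P Q w) (N : A) [IsStarNormal N] {f : ℂ → ℝ}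
    (hf : Continuous f) (h0 : ∀ z, 0 ≤ f z) :
    SI σ i j (FN N f) = ∫⁻ z, ENNReal.ofReal (f z) ∂(cont hc hσ hcor N).measure := by
  rw [lintegral_eq_lintegral_meas_lt _ (ae_of_all _ h0) hf.aemeasurable]
  unfold SI
  simp only [meas_lt hc hσ hcor N hf]

end
end QT

namespace QT
section
open scoped ComplexStarModule
variable {R : Type*} [CStarAlgebra R] {σ : R → ℂ} [PartialOrder R] [StarOrderedRing R]
variable {A : Type*} [CStarAlgebra A] [PartialOrder A] [StarOrderedRing A]
variable {E : Type*} [CStarAlgebra E] [PartialOrder E] [StarOrderedRing E]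
variable {i : A →⋆ₐ[ℂ] E} {j : R →⋆ₐ[ℂ] E} {P Q w : R}

noncomputable def cplx (T : A → ℝ) (x : A) : ℂ := (T (ℜ x : A) : ℂ) + Complex.I * (T (ℑ x : A) : ℂ)

lemma re_sa {a : A} (ha : IsSelfAdjoint a) : (ℜ a : A) = a := ha.coe_realPart
lemma im_sa {a : A} (ha : IsSelfAdjoint a) : (ℑ a : A) = 0 := by rw [imaginaryPart_eq_zero_iff.2 ha]; rfl

lemma cplx_qt {T : A → ℝ}
    (hl : ∀ (c d : ℝ) (a b : A), IsSelfAdjoint a → IsSelfAdjoint b → Commute a b → T (c • a + d • b) = c * T a + d * T b)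
    (h0 : ∀ a, 0 ≤ a → 0 ≤ T a) (ht : ∀ x, T (star x * x) = T (x * star x)) : IsQuasitrace (cplx T) := by
  have z : T 0 = 0 := by simpa using hl 0 0 0 0 (.zero A) (.zero A) (Commute.refl _)
  have hadd : ∀ (a b : A), IsSelfAdjoint a → IsSelfAdjoint b → Commute a b → T (a + b) = T a + T b :=
    fun a b ha hb h => by simpa using hl 1 1 a b ha hb h
  have sa : ∀ a, IsSelfAdjoint a → cplx T a = T a := fun a ha => by
    rw [cplx, re_sa ha, im_sa ha, z]; simp
  have mem : ∀ (S : NonUnitalStarSubalgebra ℂ A) x, x ∈ S → (ℜ x : A) ∈ S ∧ (ℑ x : A) ∈ S := fun S x hx => by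
    rw [realPart_apply_coe, imaginaryPart_apply_coe]
    have h2 : ∀ y ∈ S, (2:ℝ)⁻¹ • y ∈ S := fun y hy => by
      have : (((2:ℝ)⁻¹ : ℝ) : ℂ) • y ∈ S := SMulMemClass.smul_mem _ hy
      rwa [Complex.coe_smul] at this
    exact ⟨h2 _ (add_mem hx (star_mem hx)), SMulMemClass.smul_mem _ (h2 _ (sub_mem hx (star_mem hx)))⟩
  refine ⟨fun x => ?_, fun x => ?_, fun a b ha hb => ?_, fun S hS x hx y hy => ?_, fun S hS c x hx => ?_⟩
  · rw [sa _ (.star_mul_self x), sa _ (.mul_star_self x), ht]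
  · rw [sa _ (.star_mul_self x)]
    exact_mod_cast h0 _ (star_mul_self_nonneg x)
  · rw [sa a ha, sa b hb, cplx]
    have e1 : (ℜ (a + Complex.I • b) : A) = a := by
      rw [map_add, realPart_I_smul, imaginaryPart_eq_zero_iff.2 hb, neg_zero, add_zero, re_sa ha]
    have e2 : (ℑ (a + Complex.I • b) : A) = b := by
      rw [map_add, imaginaryPart_I_smul, imaginaryPart_eq_zero_iff.2 ha, zero_add, re_sa hb]
    rw [e1, e2]
  · obtain ⟨a1, a2⟩ := mem S x hx
    obtain ⟨b1, b2⟩ := mem S y hy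
    have e1 : (ℜ (x + y) : A) = ℜ x + ℜ y := by rw [map_add]; rfl
    have e2 : (ℑ (x + y) : A) = ℑ x + ℑ y := by rw [map_add]; rfl
    rw [cplx, e1, e2, hadd _ _ (ℜ x).2 (ℜ y).2 (hS _ a1 _ b1), hadd _ _ (ℑ x).2 (ℑ y).2 (hS _ a2 _ b2), cplx, cplx]
    push_cast; ring
  · obtain ⟨a1, a2⟩ := mem S x hx
    have e1 : (ℜ (c • x) : A) = c.re • (ℜ x : A) + (-c.im) • (ℑ x : A) := by
      rw [realPart_smul, neg_smul, ← sub_eq_add_neg]; rfl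
    have e2 : (ℑ (c • x) : A) = c.re • (ℑ x : A) + c.im • (ℜ x : A) := by
      rw [imaginaryPart_smul]; rfl
    rw [cplx, e1, e2, hl _ _ _ _ (ℜ x).2 (ℑ x).2 (hS _ a1 _ a2), hl _ _ _ _ (ℑ x).2 (ℜ x).2 (hS _ a2 _ a1), cplx]
    apply Complex.ext
    · simp; ring
    · simp

lemma cplx_sa {T : A → ℝ} (z : T 0 = 0) {a : A} (ha : IsSelfAdjoint a) : cplx T a = T a := by
  rw [cplx, re_sa ha, im_sa ha, z]; simp

lemma DA_zero (hc : Close i j) (hσ : IsQuasitrace σ) : DA σ i j 0 = 0 := by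
  refine le_antisymm (DA_le hσ fun e b he hb => ?_) (DA_nonneg hσ _)
  obtain ⟨h0, h1, s, hs, he⟩ := he
  have := he (ramp 0 s) (ramp_cont _ _) fun t ht => ramp_one hs ht
  rw [cfc_apply_zero, ramp_zero hs le_rfl, map_zero, zero_mul] at this
  have h2 := hb.2.2
  rw [← this, map_zero, zero_sub, norm_neg, hc.nj] at h2
  have : cfc GG b = 0 := by
    rw [← cfc_zero (R := ℝ) (a := b)]
    refine cfc_congr fun t ht => ?_
    have := (spec_bd h2 ht).2
    exact ramp_zero (by norm_num) (by linarith)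
  rw [this, q_zero hσ]

lemma cut_eq_zero {a : A} {s : ℝ} (h : ‖a‖ ≤ s) : cut s a = 0 := by
  rw [cut, ← cfc_zero (R := ℝ) (a := a)]
  refine cfc_congr fun t ht => ?_
  have := (spec_bd h ht).2
  exact max_eq_left (by linarith)

lemma SI_le (hc : Close i j) (hσ : IsQuasitrace σ) (a : A) {M c : ℝ} (hM : ‖a‖ ≤ M)
    (h : ∀ s, 0 < s → DA σ i j (cut s a) ≤ c) : SI σ i j a ≤ ENNReal.ofReal (c * M) := by
  have hM0 := (norm_nonneg a).trans hM
  have hc0 : 0 ≤ c := (DA_nonneg hσ _).trans (h 1 one_pos)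
  unfold SI
  calc _ ≤ ∫⁻ s in Set.Ioi (0:ℝ), (Set.Ioc 0 M).indicator (fun _ => ENNReal.ofReal c) s := by
        refine MeasureTheory.setLIntegral_mono' measurableSet_Ioi fun s hs => ?_
        by_cases hsM : s ≤ M
        · rw [Set.indicator_of_mem (show s ∈ Set.Ioc 0 M from ⟨hs, hsM⟩)]
          exact ENNReal.ofReal_le_ofReal (h s hs)
        · rw [cut_eq_zero (hM.trans (not_le.1 hsM).le), DA_zero hc hσ]; simp
    _ ≤ ∫⁻ s, (Set.Ioc 0 M).indicator (fun _ => ENNReal.ofReal c) s := MeasureTheory.setLIntegral_le_lintegral _ _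
    _ = _ := by
        rw [MeasureTheory.lintegral_indicator measurableSet_Ioc]
        simp [ENNReal.ofReal_mul hc0]

lemma SI_ne_top (hc : Close i j) (hσ : IsQuasitrace σ) (a : A) : SI σ i j a ≠ ⊤ :=
  ne_top_of_le_ne_top ENNReal.ofReal_ne_top (SI_le hc hσ a le_rfl fun s _ => DA_le_one hσ _)

noncomputable def TT (σ : R → ℂ) (i : A →⋆ₐ[ℂ] E) (j : R →⋆ₐ[ℂ] E) (a : A) : ℝ :=
  (SI σ i j (cfc (fun t : ℝ => max 0 t) a)).toReal - (SI σ i j (cfc (fun t : ℝ => max 0 (-t)) a)).toReal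

open MeasureTheory in
lemma FN_int (hc : Close i j) (hσ : IsQuasitrace σ) (hcor : Corner P Q w) (N : A) [IsStarNormal N] {f : ℂ → ℝ}
    (hf : Continuous f) : Integrable f (cont hc hσ hcor N).measure := by
  have : Integrable (fun z => |f z|) (cont hc hσ hcor N).measure := by
    refine ⟨by fun_prop, ?_⟩
    rw [hasFiniteIntegral_iff_ofReal (ae_of_all _ fun z => abs_nonneg _), ← SI_FN hc hσ hcor N (by fun_prop) (fun z => abs_nonneg _)]
    exact (SI_ne_top hc hσ _).lt_top
  exact (integrable_norm_iff (by fun_prop)).1 this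

open MeasureTheory in
lemma TT_FN (hc : Close i j) (hσ : IsQuasitrace σ) (hcor : Corner P Q w) (N : A) [IsStarNormal N] {f : ℂ → ℝ}
    (hf : Continuous f) : TT σ i j (FN N f) = ∫ z, f z ∂(cont hc hσ hcor N).measure := by
  rw [integral_eq_lintegral_pos_part_sub_lintegral_neg_part (FN_int hc hσ hcor N hf), TT,
    FN_cfc (ψ := fun t => max 0 t) (by fun_prop) hf, FN_cfc (ψ := fun t => max 0 (-t)) (by fun_prop) hf,
    SI_FN hc hσ hcor N (by fun_prop) (fun _ => le_max_left _ _), SI_FN hc hσ hcor N (by fun_prop) (fun _ => le_max_left _ _)]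
  have : ∀ t : ℝ, ENNReal.ofReal (max 0 t) = ENNReal.ofReal t := fun t => by
    rcases le_total 0 t with h | h
    · rw [max_eq_right h]
    · rw [max_eq_left h, ENNReal.ofReal_zero, ENNReal.ofReal_of_nonpos h]
  simp only [this]

lemma TT_lin (hc : Close i j) (hσ : IsQuasitrace σ) (hcor : Corner P Q w) (c d : ℝ) (a b : A) (ha : IsSelfAdjoint a)
    (hb : IsSelfAdjoint b) (h : Commute a b) :
    TT σ i j (c • a + d • b) = c * TT σ i j a + d * TT σ i j b := by
  have e1 : (ℜ (a + Complex.I • b) : A) = a := by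
    rw [map_add, realPart_I_smul, imaginaryPart_eq_zero_iff.2 hb, neg_zero, add_zero, re_sa ha]
  have e2 : (ℑ (a + Complex.I • b) : A) = b := by
    rw [map_add, imaginaryPart_I_smul, imaginaryPart_eq_zero_iff.2 ha, zero_add, re_sa hb]
  have hN : IsStarNormal (a + Complex.I • b) := by
    rw [isStarNormal_iff_commute_realPart_imaginaryPart, e1, e2]; exact h
  set N := a + Complex.I • b
  have f1 : FN N (fun z => z.re) = a := by rw [FN, cfc_re_id N, e1]
  have f2 : FN N (fun z => z.im) = b := by rw [FN, cfc_im_id N, e2]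
  have cr := Complex.continuous_re
  have ci := Complex.continuous_im
  rw [← f1, ← f2, FN_smul c cr, FN_smul d ci, FN_add (by fun_prop) (by fun_prop), TT_FN hc hσ hcor N (by fun_prop),
    TT_FN hc hσ hcor N cr, TT_FN hc hσ hcor N ci, MeasureTheory.integral_add, MeasureTheory.integral_const_mul,
    MeasureTheory.integral_const_mul]
  · exact (FN_int hc hσ hcor N cr).const_mul c
  · exact (FN_int hc hσ hcor N ci).const_mul d

lemma SI_zero (hc : Close i j) (hσ : IsQuasitrace σ) : SI σ i j 0 = 0 := by
  have := SI_le hc hσ (0:A) (M := 0) (by simp) fun s _ => DA_le_one hσ _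
  simpa using this

lemma TT_pos (hc : Close i j) (hσ : IsQuasitrace σ) {a : A} (ha : 0 ≤ a) : TT σ i j a = (SI σ i j a).toReal := by
  have hs : IsSelfAdjoint a := .of_nonneg ha
  have e1 : cfc (fun t : ℝ => max 0 t) a = a := by
    conv_rhs => rw [← cfc_id' ℝ a]
    exact cfc_congr fun t ht => max_eq_right (spec_nonneg ha ht)
  have e2 : cfc (fun t : ℝ => max 0 (-t)) a = 0 := by
    rw [← cfc_zero (R := ℝ) (a := a)]
    exact cfc_congr fun t ht => max_eq_left (by linarith [spec_nonneg ha ht])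
  rw [TT, e1, e2, SI_zero hc hσ]; simp

noncomputable def sA (σ : R → ℂ) (i : A →⋆ₐ[ℂ] E) (j : R →⋆ₐ[ℂ] E) : A → ℂ := cplx (TT σ i j)

lemma sA_qt (hc : Close i j) (hσ : IsQuasitrace σ) (hcor : Corner P Q w) : IsQuasitrace (sA σ i j) := by
  refine cplx_qt (fun c d a b ha hb h => TT_lin hc hσ hcor c d a b ha hb h) (fun a ha => ?_) fun x => ?_
  · rw [TT_pos hc hσ ha]; exact ENNReal.toReal_nonneg
  · rw [TT_pos hc hσ (star_mul_self_nonneg x), TT_pos hc hσ (mul_star_self_nonneg x)]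
    congr 1
    unfold SI
    refine MeasureTheory.setLIntegral_congr_fun measurableSet_Ioi fun s hs => ?_
    simp only [DA_cut_swap hc hσ x hs]

lemma q_sA (hc : Close i j) (hσ : IsQuasitrace σ) {a : A} (ha : 0 ≤ a) : q (sA σ i j) a = (SI σ i j a).toReal := by
  have z : TT σ i j 0 = 0 := by rw [TT_pos hc hσ le_rfl, SI_zero hc hσ]; rfl
  rw [q, sA, cplx_sa z (.of_nonneg ha), TT_pos hc hσ ha, Complex.ofReal_re]

lemma DA_cut_mono (hσ : IsQuasitrace σ) {a : A} (ha : IsSelfAdjoint a) {s : ℝ} {f : ℝ → ℝ} (hf : Continuous f)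
    (h0 : ∀ t, t ≤ s → f t = 0) (h1 : ∀ t, 0 ≤ f t) (h2 : ∀ t, f t ≤ 1) : DA σ i j (cfc f a) ≤ DA σ i j (cut s a) := by
  refine DA_mono hσ fun e he => ?_
  have : IsStarNormal a := ha.isStarNormal
  have e1 : ∀ g : ℝ → ℝ, cfc g a = FN a fun z => g z.re := fun g => cfc_real_eq_complex g ha
  rw [e1] at he
  rw [cut, e1]
  refine FN_WB_mono (hf.comp Complex.continuous_re) (by fun_prop) (fun z _ hz => ?_) he
  by_contra hn
  have : z.re ≤ s := by
    by_contra h3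
    exact hn (lt_max_of_lt_right (by linarith))
  have hz : 0 < f z.re := hz
  rw [h0 _ this] at hz
  exact lt_irrefl _ hz

lemma q_sA_ramp (hc : Close i j) (hσ : IsQuasitrace σ) {a : A} (ha : 0 ≤ a) {s r : ℝ} (hs : 0 ≤ s) (hsr : s < r) :
    q (sA σ i j) (cfc (ramp s r) a) ≤ DA σ i j (cut s a) := by
  obtain ⟨h0, h1⟩ := cfc_unit a (ramp_nonneg s r) (ramp_le_one s r)
  have has : IsSelfAdjoint a := .of_nonneg ha
  rw [q_sA hc hσ h0]
  refine ENNReal.toReal_le_of_le_ofReal (DA_nonneg hσ _) ?_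
  have := SI_le hc hσ (cfc (ramp s r) a) (M := 1) (c := DA σ i j (cut s a)) (norm_unit h0 h1) fun u hu => ?_
  · rwa [mul_one] at this
  · rw [cut, ← cfc_comp' (fun t : ℝ => max 0 (t - u)) (ramp s r) a (by fun_prop) (ramp_cont _ _).continuousOn]
    refine DA_cut_mono hσ has ((by fun_prop : Continuous fun t : ℝ => max 0 (t - u)).comp (ramp_cont _ _)) (fun t ht => ?_) (fun t => le_max_left _ _) fun t => ?_
    · show max 0 (ramp s r t - u) = 0
      rw [ramp_zero hsr ht]; exact max_eq_left (by linarith)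
    · have := ramp_le_one s r t
      show max 0 (ramp s r t - u) ≤ 1
      exact max_le zero_le_one (by linarith)

end
end QT

namespace QT
section
open scoped ComplexStarModule
variable {R : Type*} [CStarAlgebra R] {σ : R → ℂ} [PartialOrder R] [StarOrderedRing R]
variable {A : Type*} [CStarAlgebra A] [PartialOrder A] [StarOrderedRing A]
variable {E : Type*} [CStarAlgebra E] [PartialOrder E] [StarOrderedRing E]
variable {i : A →⋆ₐ[ℂ] E} {j : R →⋆ₐ[ℂ] E} {P Q w : R}

lemma q_riemann (hσ : IsQuasitrace σ) {x : R} (h0 : 0 ≤ x) (h1 : x ≤ 1) {n : ℕ} (hn : 0 < n) :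
    q σ x = ∑ k ∈ Finset.range n, (1 / (n : ℝ)) * q σ (cfc (ramp ((k : ℝ) / n) (((k : ℝ) + 1) / n)) x) := by
  set N : ℝ := (n : ℝ)
  have h6 : ∀ m : ℕ, q σ (∑ k ∈ Finset.range m, (1 / N) • cfc (ramp ((k : ℝ) / N) (((k : ℝ) + 1) / N)) x) =
      ∑ k ∈ Finset.range m, (1 / N) * q σ (cfc (ramp ((k : ℝ) / N) (((k : ℝ) + 1) / N)) x) := by
    intro m
    induction m with
    | zero => simp [q_zero hσ]
    | succ m ih =>
      rw [Finset.sum_range_succ, Finset.sum_range_succ, q_add hσ, ih, q_smul hσ (cfc_sa _ _)]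
      · refine isSelfAdjoint_sum _ fun k _ => ?_
        exact IsSelfAdjoint.smul (by rfl) (cfc_sa _ _)
      · exact IsSelfAdjoint.smul (by rfl) (cfc_sa _ _)
      · refine Commute.sum_left _ _ _ fun k _ => ?_
        exact ((cfc_commute_cfc _ _ x).smul_left _).smul_right _
  rw [← h6]; congr 1; exact riemann_sum h0 h1 hn

lemma shift_sum (f g : ℕ → ℝ) (c : ℝ) (h1 : ∀ k, k < 80 → f k ≤ c) (h2 : ∀ k, k < 78 → f (k + 2) ≤ g k) (h3 : ∀ k, 0 ≤ g k) :
    ∑ k ∈ Finset.range 80, (1 / ((80:ℕ) : ℝ)) * f k ≤ ∑ k ∈ Finset.range 80, (1 / ((80:ℕ) : ℝ)) * g k + 1 / 40 * c := by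
  rw [← Finset.mul_sum, ← Finset.mul_sum, Finset.sum_range_succ' f, Finset.sum_range_succ' (fun k => f (k + 1)),
    Finset.sum_range_succ g, Finset.sum_range_succ g]
  have s1 : ∑ k ∈ Finset.range 78, f (k + 1 + 1) ≤ ∑ k ∈ Finset.range 78, g k :=
    Finset.sum_le_sum fun k hk => h2 k (Finset.mem_range.1 hk)
  have t0 := h1 0 (by norm_num)
  have t1 := h1 (0 + 1) (by norm_num)
  have m0 := h3 78
  have m1 := h3 79
  push_cast
  linarith

lemma sA_upper (hc : Close i j) (hσ : IsQuasitrace σ) (hcor : Corner P Q w) {a : A} {b : R} (ha0 : 0 ≤ a) (ha1 : a ≤ 1)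
    (hb0 : 0 ≤ b) (hb1 : b ≤ 1) (hab : ‖i a - j b‖ ≤ 1 / 1100) : q (sA σ i j) a ≤ q σ b + 1 / 40 * q σ 1 := by
  have hs := sA_qt hc hσ hcor
  have hbs : IsSelfAdjoint b := .of_nonneg hb0
  rw [q_riemann hs ha0 ha1 (n := 80) (by norm_num), q_riemann hσ hb0 hb1 (n := 80) (by norm_num)]
  have e1 : ∀ k : ℕ, k < 80 → q (sA σ i j) (cfc (ramp ((k:ℝ) / (80:ℕ)) (((k:ℝ) + 1) / (80:ℕ))) a) ≤ D σ (cut ((k:ℝ) / 80 - 13 / 1100) b) := by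
    intro k hk
    have hk' : (k:ℝ) < 80 := by exact_mod_cast hk
    refine (q_sA_ramp hc hσ ha0 (by positivity) (by push_cast; linarith)).trans ?_
    push_cast
    exact DA_near hc hσ ha0 ha1 hb0 hb1 hab (by positivity) (by linarith)
  have e2 : ∀ k : ℕ, k < 80 → q (sA σ i j) (cfc (ramp ((k:ℝ) / (80:ℕ)) (((k:ℝ) + 1) / (80:ℕ))) a) ≤ q σ 1 :=
    fun k hk => (e1 k hk).trans (D_le_one hσ _)
  have e3 : ∀ k : ℕ, k < 78 → q (sA σ i j) (cfc (ramp (((k + 2 : ℕ):ℝ) / (80:ℕ)) ((((k + 2 : ℕ):ℝ) + 1) / (80:ℕ))) a) ≤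
      q σ (cfc (ramp ((k:ℝ) / (80:ℕ)) (((k:ℝ) + 1) / (80:ℕ))) b) := by
    intro k hk
    refine (e1 (k + 2) (by omega)).trans (le_trans ?_ (D_cut_le_q hσ hbs (by push_cast; linarith)))
    refine D_cut_anti hσ hbs ?_
    push_cast
    linarith
  have n1 : ∀ k : ℕ, 0 ≤ q σ (cfc (ramp ((k:ℝ) / (80:ℕ)) (((k:ℝ) + 1) / (80:ℕ))) b) := fun k =>
    q_nonneg hσ (cfc_unit b (ramp_nonneg _ _) (ramp_le_one _ _)).1
  exact shift_sum _ _ _ e2 e3 n1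

lemma GG_proj {P : R} (hs : IsSelfAdjoint P) (hP : P * P = P) : cfc GG P = P := by
  have e1 := cfc_mul_eigen hs (y := P) (r := 1) (by rw [hP, one_smul]) GG_adm.cont
  have e2 := cfc_mul_eigen hs (y := 1 - P) (r := 0) (by rw [mul_sub, mul_one, hP, sub_self, zero_smul]) GG_adm.cont
  rw [GG_adm.zero 0 (by norm_num), zero_smul, mul_sub, mul_one, e1, show GG 1 = 1 from ramp_one (by norm_num) (by norm_num), one_smul] at e2
  exact sub_eq_zero.1 e2

lemma proj_unit {P : R} (hs : IsSelfAdjoint P) (hP : P * P = P) : 0 ≤ P ∧ P ≤ 1 := by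
  have h : ∀ {P : R}, IsSelfAdjoint P → P * P = P → 0 ≤ P := fun {P} hs hP => by
    have := star_mul_self_nonneg P
    rwa [hs.star_eq, hP] at this
  refine ⟨h hs hP, sub_nonneg.1 (h ((IsSelfAdjoint.one R).sub hs) ?_)⟩
  rw [mul_sub, mul_one, sub_mul, one_mul, hP, sub_self, sub_zero]

lemma sA_lower (hc : Close i j) (hσ : IsQuasitrace σ) {p : A} {P : R} (hp : IsSelfAdjoint p) (hpp : p * p = p)
    (hP : IsSelfAdjoint P) (hPP : P * P = P) (hij : i p = j P) : q σ P ≤ q (sA σ i j) p := by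
  obtain ⟨p0, p1⟩ := proj_unit hp hpp
  obtain ⟨P0, P1⟩ := proj_unit hP hPP
  rw [q_sA hc hσ p0]
  have key : ∀ s : ℝ, s < 1 → q σ P ≤ DA σ i j (cut s p) := fun s hs => by
    rw [← GG_proj hP hPP]
    refine le_DA hσ ⟨p0, p1, 1 - s, by linarith, fun ψ hψ h => ?_⟩ ⟨P0, P1, by rw [hij, sub_self, norm_zero]; norm_num⟩
    rw [cfc_cut p _ hψ hp, cfc_mul_eigen hp (r := 1) (by rw [hpp, one_smul]) (by fun_prop), h, one_smul]
    exact le_max_right _ _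
  rw [← ENNReal.ofReal_le_iff_le_toReal (SI_ne_top hc hσ p)]
  unfold SI
  calc ENNReal.ofReal (q σ P) = ∫⁻ s in Set.Ioo (0:ℝ) 1, ENNReal.ofReal (q σ P) := by simp
    _ ≤ ∫⁻ s in Set.Ioo (0:ℝ) 1, ENNReal.ofReal (DA σ i j (cut s p)) :=
      MeasureTheory.setLIntegral_mono' measurableSet_Ioo fun s hs => ENNReal.ofReal_le_ofReal (key s hs.2)
    _ ≤ _ := MeasureTheory.lintegral_mono_set fun s hs => hs.1

end
end QT

namespace QT
section
open scoped ComplexStarModule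
variable {R : Type*} [CStarAlgebra R] {σ : R → ℂ} [PartialOrder R] [StarOrderedRing R]
variable {A : Type*} [CStarAlgebra A] [PartialOrder A] [StarOrderedRing A]
variable {E : Type*} [CStarAlgebra E] [PartialOrder E] [StarOrderedRing E]
variable {i : A →⋆ₐ[ℂ] E} {j : R →⋆ₐ[ℂ] E} {P Q w : R}

/-- cone of elements whose compression has positive real part -/
def cone (p : E) : PointedCone ℝ E where
  carrier := {x | 0 ≤ star p * (x + star x) * p}
  add_mem' := by
    intro x y hx hy
    have := add_nonneg hx hy
    show 0 ≤ star p * (x + y + star (x + y)) * p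
    convert this using 1
    rw [star_add, ← add_mul, ← mul_add]
    congr 2; abel
  zero_mem' := by simp
  smul_mem' := by
    intro c x hx
    have := smul_nonneg c.2 hx
    show 0 ≤ star p * ((c:ℝ) • x + star ((c:ℝ) • x)) * p
    convert this using 1
    rw [star_smul, star_trivial (c:ℝ), ← smul_add, mul_smul_comm, smul_mul_assoc]

lemma star_map_re (i : A →⋆ₐ[ℂ] E) (x p : A) : star (i p) * (i x + star (i x)) * i p = i (star p * (x + star x) * p) := by
  simp only [map_mul, map_add, map_star]

lemma extend (ii : Function.Injective i) {p : A} (τ : A →ₗ[ℝ] ℝ) (h0 : ∀ x, 0 ≤ x → 0 ≤ τ x)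
    (hp : ∀ x, τ (star p * x * p) = τ x) (hs : ∀ x, τ (star x) = τ x) :
    ∃ φ : E →ₗ[ℝ] ℝ, (∀ x, φ (i x) = τ x) ∧ ∀ x, 0 ≤ star (i p) * (x + star x) * i p → 0 ≤ φ x := by
  let i' : A →ₗ[ℝ] E := (i : A →ₗ[ℂ] E).restrictScalars ℝ
  have hi' : ∀ x, i' x = i x := fun _ => rfl
  let e : A ≃ₗ[ℝ] LinearMap.range i' := LinearEquiv.ofInjective i' ii
  let f : E →ₗ.[ℝ] ℝ := ⟨LinearMap.range i', τ ∘ₗ e.symm.toLinearMap⟩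
  have hf : ∀ x : A, f ⟨i x, x, rfl⟩ = τ x := fun x => by
    show τ (e.symm ⟨i x, x, rfl⟩) = τ x
    congr 1
    rw [LinearEquiv.symm_apply_eq]
    rfl
  obtain ⟨φ, h1, h2⟩ := riesz_extension (cone (i p)) f (by
    rintro ⟨_, x, rfl⟩ hx
    have hx : 0 ≤ star (i p) * (i x + star (i x)) * i p := hx
    rw [star_map_re] at hx
    have hx := reflect ii (by
      have : IsSelfAdjoint (x + star x) := .add_star_self x
      exact this.conjugate' p) hx
    have := h0 _ hx
    rw [hp, map_add, hs] at this
    have e1 : f ⟨i' x, x, rfl⟩ = τ x := hf x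
    rw [e1]; linarith) (by
    intro y
    refine ⟨⟨i (algebraMap ℝ A ‖y‖), _, rfl⟩, ?_⟩
    show 0 ≤ star (i p) * (i (algebraMap ℝ A ‖y‖) + y + star (i (algebraMap ℝ A ‖y‖) + y)) * i p
    refine conj_nonneg ?_ _
    have l1 : -algebraMap ℝ E (2 * ‖y‖) ≤ y + star y := neg_le_alg (.add_star_self y) (by
      refine (norm_add_le _ _).trans ?_
      rw [norm_star]; linarith)
    rw [neg_le_iff_add_nonneg, two_mul, map_add] at l1
    rw [map_alg, star_add, (IsSelfAdjoint.algebraMap E (.all (‖y‖:ℝ))).star_eq]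
    convert l1 using 1
    abel)
  exact ⟨φ, fun x => (h1 ⟨i x, x, rfl⟩).trans (hf x), fun x hx => h2 x hx⟩

/-- II.1 -/
lemma transfer (hc : Close i j) (hc' : Close j i) (hσ : IsQuasitrace σ) (hcor : Corner P Q w) {p : A}
    (hp : IsSelfAdjoint p) (hpp : p * p = p) (hij : i p = j P) (τ : A →ₗ[ℝ] ℝ) (hτp : ∀ x, τ (p * x * p) = τ x)
    (hs : ∀ x, τ (star x) = τ x) (hτ : ∀ x, 0 ≤ x → p * x * p = x → τ x = q (sA σ i j) x) :
    ∃ φ : R →ₗ[ℝ] ℝ, (∀ x, 0 ≤ x → 0 ≤ φ x) ∧ q σ P ≤ φ P ∧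
      ∀ b, 0 ≤ b → b ≤ 1 → P * b * P = b → φ b ≤ q σ b + 1 / 16 * q σ P := by
  have hsA := sA_qt hc hσ hcor
  obtain ⟨p0, p1⟩ := proj_unit hp hpp
  obtain ⟨P0, P1⟩ := proj_unit hcor.Ps hcor.PP
  have h3 : p * p * p = p := by rw [hpp, hpp]
  have q1 : q σ 1 = 2 * q σ P := by
    rw [← hcor.add, q_add hσ hcor.Ps hcor.Qs (by rw [Commute, SemiconjBy, hcor.PQ, hcor.QP])]
    have := q_trace hσ w
    rw [hcor.ww, hcor.ww'] at this
    linarith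
  have qP := q_nonneg hσ P0
  obtain ⟨φ, f1, f2⟩ := extend (p := p) (E := E) hc'.inj τ (fun x hx => by
    rw [← hτp]
    have h := conj_nonneg hx p
    rw [hp.star_eq] at h
    rw [hτ _ h (by rw [← mul_assoc, ← mul_assoc, hpp, mul_assoc, hpp])]
    exact q_nonneg hsA h) (by rw [hp.star_eq]; exact hτp) hs
  have f0 : ∀ x : E, 0 ≤ x → 0 ≤ φ x := fun x hx => f2 x (by
    rw [(IsSelfAdjoint.of_nonneg hx).star_eq]
    exact conj_nonneg (add_nonneg hx hx) _)
  let φ' : R →ₗ[ℝ] ℝ := φ ∘ₗ ((j : R →ₗ[ℂ] E).restrictScalars ℝ)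
  have hφ' : ∀ x, φ' x = φ (j x) := fun _ => rfl
  have hP : φ' P = q (sA σ i j) p := by rw [hφ', ← hij, f1, hτ p p0 h3]
  have up := sA_upper hc hσ hcor p0 p1 P0 P1 (by rw [hij, sub_self, norm_zero]; norm_num)
  refine ⟨φ', fun x hx => f0 _ (map_nn j hx), ?_, fun b hb0 hb1 hb => ?_⟩
  · rw [hP]; exact sA_lower hc hσ hp hpp hcor.Ps hcor.PP hij
  · obtain ⟨y, y0, y1, hy⟩ := hc'.pos b hb0 hb1
    have a0 := conj_nonneg y0 p
    have a1 := conj_le y1 p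
    rw [hp.star_eq, mul_one, hpp] at a1
    rw [hp.star_eq] at a0
    set a := p * y * p with ha
    have hpa : p * a * p = a := by rw [ha, ← mul_assoc, ← mul_assoc, hpp, mul_assoc, hpp]
    have sd : IsSelfAdjoint (j b - i y) := ((IsSelfAdjoint.of_nonneg hb0).map j).sub ((IsSelfAdjoint.of_nonneg y0).map i)
    have e1 : j b - i a = star (i p) * (j b - i y) * i p := by
      rw [← map_star, hp.star_eq, mul_sub, sub_mul, ha, map_mul, map_mul]
      conv_lhs => rw [← hb, map_mul, map_mul, ← hij]
    have nip : ‖i p‖ ≤ 1 := by rw [hc.ni]; exact norm_unit p0 p1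
    have hy' : ‖i a - j b‖ ≤ 1 / 1100 := by
      rw [norm_sub_rev, e1]
      refine (norm_mul_le _ _).trans ?_
      have := norm_mul_le (star (i p)) (j b - i y)
      rw [norm_star] at this
      have n3 := norm_nonneg (j b - i y)
      have n4 := norm_nonneg (i p)
      have : ‖star (i p) * (j b - i y)‖ ≤ 1 / 1100 := by nlinarith
      nlinarith
    have u2 := sA_upper hc hσ hcor a0 (a1.trans p1) hb0 hb1 hy'
    have l1 : j b - i a ≤ (1 / 1100 : ℝ) • j P := by
      rw [e1]
      refine (conj_le (le_alg sd hy) _).trans (le_of_eq ?_)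
      rw [← Algebra.commutes, mul_assoc, ← map_star, hp.star_eq, ← map_mul, hpp, hij, Algebra.smul_def]
    have l2 := f0 _ (sub_nonneg.2 l1)
    rw [map_sub, map_sub, map_smul, f1, hτ a a0 hpa, ← hφ' b, ← hφ' P, hP, smul_eq_mul] at l2
    linarith

end
end QT

namespace QT
section
open scoped ComplexStarModule
variable {R : Type*} [CStarAlgebra R] {σ : R → ℂ} [PartialOrder R] [StarOrderedRing R]

/-- positive real-linear star invariant functionals -/
structure PL (f : R → ℝ) : Prop where
  add : ∀ x y, f (x + y) = f x + f y
  smul : ∀ (c : ℝ) x, f (c • x) = c * f x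
  st : ∀ x, f (star x) = f x
  nn : ∀ x, 0 ≤ x → 0 ≤ f x

namespace PL
variable {f g : R → ℝ}
lemma zero (h : PL f) : f 0 = 0 := by
  have := h.smul 0 0
  simpa using this
lemma neg (h : PL f) (x : R) : f (-x) = -f x := by
  have := h.smul (-1) x
  simpa using this
lemma sub (h : PL f) (x y : R) : f (x - y) = f x - f y := by
  rw [sub_eq_add_neg, h.add, h.neg]; ring
lemma mono (h : PL f) {x y : R} (hxy : x ≤ y) : f x ≤ f y := by
  have := h.nn _ (sub_nonneg.2 hxy)
  rw [h.sub] at this; linarith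
lemma alg (h : PL f) (c : ℝ) : f (algebraMap ℝ R c) = c * f 1 := by
  rw [Algebra.algebraMap_eq_smul_one, h.smul]
lemma one_nn (h : PL f) : 0 ≤ f 1 := h.nn _ zero_le_one
lemma sum (h : PL f) {ι : Type*} (s : Finset ι) (x : ι → R) : f (∑ k ∈ s, x k) = ∑ k ∈ s, f (x k) := by
  classical
  induction s using Finset.induction_on with
  | empty => simp [h.zero]
  | insert a s ha ih => rw [Finset.sum_insert ha, Finset.sum_insert ha, h.add, ih]
lemma le_norm_sa (h : PL f) {x : R} (hx : IsSelfAdjoint x) {d : ℝ} (hd : ‖x‖ ≤ d) : f x ≤ d * f 1 := by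
  rw [← h.alg]; exact h.mono (le_alg hx hd)
lemma re (h : PL f) (x : R) : f x = f ((1 / 2 : ℝ) • (x + star x)) := by
  rw [h.smul, h.add, h.st]; ring
lemma abs_le (h : PL f) (x : R) : |f x| ≤ ‖x‖ * f 1 := by
  have hs : IsSelfAdjoint ((1 / 2 : ℝ) • (x + star x)) := (IsSelfAdjoint.all (1 / 2 : ℝ)).smul (IsSelfAdjoint.add_star_self x)
  have hn : ‖(1 / 2 : ℝ) • (x + star x)‖ ≤ ‖x‖ := by
    rw [norm_smul]
    have := norm_add_le x (star x)
    rw [norm_star] at this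
    norm_num
    linarith
  rw [h.re, abs_le']
  refine ⟨h.le_norm_sa hs hn, ?_⟩
  rw [← h.neg]
  exact h.le_norm_sa hs.neg (by rwa [norm_neg])
lemma zero' : PL (fun _ : R => (0:ℝ)) := ⟨by simp, by simp, by simp, by simp⟩
lemma add' (h : PL f) (h' : PL g) : PL (fun x => f x + g x) :=
  ⟨fun x y => by rw [h.add, h'.add]; ring, fun c x => by rw [h.smul, h'.smul]; ring,
   fun x => by rw [h.st, h'.st], fun x hx => add_nonneg (h.nn x hx) (h'.nn x hx)⟩
lemma smul' (h : PL f) {c : ℝ} (hc : 0 ≤ c) : PL (fun x => c * f x) :=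
  ⟨fun x y => by rw [h.add]; ring, fun d x => by rw [h.smul]; ring,
   fun x => by rw [h.st], fun x hx => mul_nonneg hc (h.nn x hx)⟩
lemma conj (h : PL f) (z : R) : PL (fun x => f (star z * x * z)) :=
  ⟨fun x y => by rw [mul_add, add_mul, h.add], fun d x => by rw [mul_smul_comm, smul_mul_assoc, h.smul],
   fun x => by rw [← h.st]; congr 1; simp [mul_assoc], fun x hx => h.nn _ (conj_nonneg hx z)⟩
end PL

lemma isClosed_PL : IsClosed {f : R → ℝ | PL f} := by
  have e : {f : R → ℝ | PL f} = (⋂ x, ⋂ y, {f : R → ℝ | f (x + y) = f x + f y}) ∩ (⋂ c : ℝ, ⋂ x, {f : R → ℝ | f (c • x) = c * f x}) ∩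
      (⋂ x, {f : R → ℝ | f (star x) = f x}) ∩ (⋂ x : {x : R // 0 ≤ x}, {f : R → ℝ | 0 ≤ f x}) := by
    ext f
    simp only [Set.mem_inter_iff, Set.mem_iInter, Set.mem_ofPred_eq]
    exact ⟨fun h => ⟨⟨⟨h.add, h.smul⟩, h.st⟩, fun x => h.nn x x.2⟩,
      fun h => ⟨h.1.1.1, h.1.1.2, h.1.2, fun x hx => h.2 ⟨x, hx⟩⟩⟩
  rw [e]
  refine IsClosed.inter (IsClosed.inter (IsClosed.inter ?_ ?_) ?_) ?_
  · exact isClosed_iInter fun x => isClosed_iInter fun y => isClosed_eq (by fun_prop) (by fun_prop)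
  · exact isClosed_iInter fun x => isClosed_iInter fun y => isClosed_eq (by fun_prop) (by fun_prop)
  · exact isClosed_iInter fun x => isClosed_eq (continuous_apply _) (continuous_apply _)
  · exact isClosed_iInter fun x => isClosed_le continuous_const (continuous_apply _)

lemma isCompact_PL (K : ℝ) : IsCompact {f : R → ℝ | PL f ∧ f 1 ≤ K} := by
  have h1 : IsCompact (Set.pi Set.univ fun x : R => Set.Icc (-(‖x‖ * K)) (‖x‖ * K)) :=
    isCompact_univ_pi fun x => isCompact_Icc
  have h2 : IsClosed {f : R → ℝ | PL f ∧ f 1 ≤ K} := isClosed_PL.inter (isClosed_le (continuous_apply _) continuous_const)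
  refine h1.of_isClosed_subset h2 ?_
  rintro f ⟨hf, hK⟩ x -
  have := hf.abs_le x
  rw [_root_.abs_le] at this
  have hm := mul_le_mul_of_nonneg_left hK (norm_nonneg x)
  exact ⟨by linarith, by linarith⟩

lemma isClosed_bd (S : Set R) (g : R → ℝ) : IsClosed {f : R → ℝ | ∀ x ∈ S, f x ≤ g x} := by
  have : {f : R → ℝ | ∀ x ∈ S, f x ≤ g x} = ⋂ x : S, {f : R → ℝ | f x ≤ g x} := by
    ext f; simp
  rw [this]
  exact isClosed_iInter fun x => isClosed_le (continuous_apply _) continuous_const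

lemma split {y : R} (h0 : 0 ≤ y) (h1 : y ≤ 1) {s : ℝ} (hs : 0 < s) : ∃ c r : R, IsSelfAdjoint c ∧ IsSelfAdjoint r ∧ c + r = 1 ∧
    0 ≤ c ∧ c ≤ 1 ∧ cut s y * r = 0 ∧ cut s y + r * r ≤ 1 ∧ c * c ≤ (2 / s) • y ∧ c = cfc (ramp (s / 2) s) y := by
  have hlt : s / 2 < s := by linarith
  have ys := IsSelfAdjoint.of_nonneg h0
  have rc := ramp_cont (s / 2) s
  have rc1 : Continuous fun t => 1 - ramp (s / 2) s t := continuous_const.sub rc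
  have cc : Continuous fun t : ℝ => max 0 (t - s) := by fun_prop
  have spec : ∀ t ∈ spectrum ℝ y, 0 ≤ t ∧ t ≤ 1 := fun t ht =>
    ⟨spec_nonneg h0 ht, (spec_bd (norm_unit h0 h1) ht).2⟩
  obtain ⟨c0, c1⟩ := cfc_unit (f := ramp (s / 2) s) y (ramp_nonneg _ _) (ramp_le_one _ _)
  refine ⟨_, cfc (fun t => 1 - ramp (s / 2) s t) y, cfc_sa _ _, cfc_sa _ _, ?_, c0, c1, ?_, ?_, ?_, rfl⟩
  · rw [← one_sub_cfc ys rc]; abel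
  · unfold cut
    rw [cmul y cc rc1, ← cfc_zero ℝ y]
    apply cfc_congr
    intro t _
    show max 0 (t - s) * (1 - ramp (s / 2) s t) = 0
    rcases le_total t s with h | h
    · rw [max_eq_left (by linarith), zero_mul]
    · rw [ramp_one hlt h, sub_self, mul_zero]
  · unfold cut
    rw [cmul y rc1 rc1, cadd y cc (g := fun t => (1 - ramp (s / 2) s t) * (1 - ramp (s / 2) s t)) (rc1.mul rc1), ← cfc_one ℝ y]
    apply cfc_mono
    · intro t ht
      obtain ⟨t0, t1⟩ := spec t ht
      show max 0 (t - s) + (1 - ramp (s / 2) s t) * (1 - ramp (s / 2) s t) ≤ 1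
      have a0 := ramp_nonneg (s / 2) s t
      have a1 := ramp_le_one (s / 2) s t
      rcases le_total t s with h | h
      · rw [max_eq_left (by linarith)]; nlinarith
      · rw [ramp_one hlt h, max_eq_right (by linarith)]; linarith
    · exact (cc.add (rc1.mul rc1)).continuousOn
    · exact continuousOn_const
  · rw [cmul y rc rc]
    have : (2 / s) • y = cfc (fun t : ℝ => (2 / s) * t) y := by
      rw [cfc_const_mul (2 / s) (fun t : ℝ => t) y (by fun_prop), cfc_id' ℝ y]
    rw [this]
    apply cfc_mono
    · intro t ht
      obtain ⟨t0, t1⟩ := spec t ht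
      show ramp (s / 2) s t * ramp (s / 2) s t ≤ 2 / s * t
      have a0 := ramp_nonneg (s / 2) s t
      have a1 := ramp_le_one (s / 2) s t
      rcases le_total t (s / 2) with h | h
      · rw [ramp_zero hlt h]
        have : 0 ≤ 2 / s * t := by positivity
        linarith
      · have : 1 ≤ 2 / s * t := by rw [div_mul_eq_mul_div, le_div_iff₀ hs]; linarith
        nlinarith
    · exact (rc.mul rc).continuousOn
    · exact (continuous_const.mul continuous_id).continuousOn

lemma D_zero (hσ : IsQuasitrace σ) : D σ (0 : R) = 0 := by
  have := D_orth hσ (x := 0) (y := 0) (.zero R) (.zero R) (mul_zero _)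
  rw [add_zero] at this; linarith

/-- II.2 approximate form -/
lemma dom_approx (hσ : IsQuasitrace σ) {f : R → ℝ} (hf : PL f) (h1 : q σ 1 ≤ f 1)
    (hb : ∀ b, 0 ≤ b → b ≤ 1 → f b ≤ q σ b + 1 / 16 * q σ 1) (hp : 0 < q σ 1) {ε : ℝ} (he : 0 < ε) :
    ∃ g : R → ℝ, PL g ∧ g 1 ≤ 2 * q σ 1 ∧ q σ 1 / 2 ≤ g 1 ∧ ∀ b, 0 ≤ b → b ≤ 1 → g b ≤ 16 * D σ b + ε := by
  set S : Set ℝ := {t | ∃ y : R, 0 ≤ y ∧ y ≤ 1 ∧ t = f y - 16 * D σ y} with hS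
  have hf1 := hb 1 zero_le_one le_rfl
  have bdd : BddAbove S := ⟨f 1, by
    rintro t ⟨y, y0, y1, rfl⟩
    have := hf.mono y1
    have := D_nonneg hσ y
    linarith⟩
  have h0S : (0:ℝ) ∈ S := ⟨0, le_rfl, zero_le_one, by rw [hf.zero, D_zero hσ]; ring⟩
  have m0 : 0 ≤ sSup S := le_csSup bdd h0S
  set η := min (ε / 2) (q σ 1) with hη
  have η0 : 0 < η := lt_min (by linarith) hp
  have η1 : η ≤ ε / 2 := min_le_left _ _
  have η2 : η ≤ q σ 1 := min_le_right _ _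
  obtain ⟨_, ⟨y, y0, y1, rfl⟩, hy⟩ := exists_lt_of_lt_csSup ⟨_, h0S⟩ (show sSup S - η < sSup S by linarith)
  have F0 := hf.one_nn
  set s := ε / (2 * (f 1 + 1)) with hs
  have s0 : 0 < s := by positivity
  have sf : s * f 1 ≤ ε / 2 := by
    rw [hs, div_mul_eq_mul_div, div_le_iff₀ (by positivity)]
    nlinarith
  obtain ⟨c, r, cs, rs, cr, c0, c1, hyr, hyr1, cc, hc⟩ := split y0 y1 s0
  have qc : q σ c ≤ D σ y := by rw [hc]; exact q_ramp_le_D hσ y (by linarith) (by linarith)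
  have fy := hf.mono y1
  have fc := hb c c0 c1
  have rr : r * r = 1 - (2:ℝ) • c + c * c := by
    rw [eq_sub_of_add_eq' cr, two_smul]; noncomm_ring
  have fcc : 0 ≤ f (c * c) := hf.nn _ (by have := star_mul_self_nonneg c; rwa [cs.star_eq] at this)
  refine ⟨_, hf.conj r, ?_, ?_, fun b b0 b1 => ?_⟩
  · show f (star r * 1 * r) ≤ _
    rw [mul_one, rs.star_eq]
    have : r * r ≤ 1 := by
      refine le_trans ?_ hyr1
      have := cut_nonneg s y
      exact le_add_of_nonneg_left this
    have := hf.mono this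
    linarith
  · show _ ≤ f (star r * 1 * r)
    rw [mul_one, rs.star_eq, rr, hf.add, hf.sub, hf.smul]
    linarith
  · show f (star r * b * r) ≤ _
    have z0 := conj_nonneg b0 r
    have z1 := conj_le b1 r
    rw [mul_one] at z1
    have zD := D_mono_conj hσ (IsSelfAdjoint.of_nonneg z0) b0 r le_rfl
    rw [rs.star_eq] at z0 z1 zD ⊢
    have orth : cut s y * (r * b * r) = 0 := by rw [← mul_assoc, ← mul_assoc, hyr, zero_mul, zero_mul]
    have DD := D_orth hσ (cfc_sa _ _) (IsSelfAdjoint.of_nonneg z0) orth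
    have Dc := D_cut_le hσ y0 s0.le
    have mem : f (cut s y + r * b * r) - 16 * D σ (cut s y + r * b * r) ≤ sSup S :=
      le_csSup bdd ⟨_, add_nonneg (cut_nonneg s y) z0, (add_le_add_right z1 _).trans hyr1, rfl⟩
    have e1 : D σ (cut s y + r * b * r) = D σ (cut s y) + D σ (r * b * r) := DD
    have e2 := hf.mono (le_cut (IsSelfAdjoint.of_nonneg y0) s)
    rw [hf.add, hf.alg] at e2
    rw [hf.add, e1] at mem
    linarith

/-- domination up to a constant on positive elements -/
def Dom (σ : R → ℂ) (C : ℝ) (f : R → ℝ) : Prop := ∀ x, 0 ≤ x → f x ≤ C * q σ x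

lemma scale_unit {x : R} (hx : 0 ≤ x) : ∃ (c : ℝ) (y : R), 0 ≤ c ∧ 0 ≤ y ∧ y ≤ 1 ∧ x = c • y := by
  have hc : 0 < ‖x‖ + 1 := by positivity
  refine ⟨‖x‖ + 1, (‖x‖ + 1)⁻¹ • x, hc.le, smul_nonneg (by positivity) hx, ?_, by rw [smul_smul, mul_inv_cancel₀ hc.ne', one_smul]⟩
  have := smul_le_smul_of_nonneg_left (le_alg (IsSelfAdjoint.of_nonneg hx) (show ‖x‖ ≤ ‖x‖ + 1 by linarith)) (show (0:ℝ) ≤ (‖x‖ + 1)⁻¹ by positivity)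
  rwa [Algebra.algebraMap_eq_smul_one, smul_smul, inv_mul_cancel₀ hc.ne', one_smul] at this

lemma dom_of_unit (hσ : IsQuasitrace σ) {f : R → ℝ} (hf : ∀ (c : ℝ) x, f (c • x) = c * f x) {C : ℝ}
    (h : ∀ x, 0 ≤ x → x ≤ 1 → f x ≤ C * q σ x) : Dom σ C f := by
  intro x hx
  obtain ⟨c, y, c0, y0, y1, rfl⟩ := scale_unit hx
  rw [hf, q_smul hσ (IsSelfAdjoint.of_nonneg y0)]
  have := mul_le_mul_of_nonneg_left (h y y0 y1) c0
  linarith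

lemma dom_of_D (hσ : IsQuasitrace σ) {f : R → ℝ} (hf : PL f) {C : ℝ} (hC : 0 ≤ C)
    (h : ∀ x, 0 ≤ x → x ≤ 1 → f x ≤ C * D σ x) : Dom σ C f := by
  refine dom_of_unit hσ hf.smul fun x x0 x1 => riemann_compare hσ x0 x1 (K := f 1) (fun n hn => ?_) (fun y y0 y1 => hf.mono y1) h hC
  conv_lhs => rw [riemann_sum x0 x1 hn]
  rw [hf.sum]
  simp_rw [hf.smul]

lemma dom_exists (hσ : IsQuasitrace σ) {f : R → ℝ} (hf : PL f) (h1 : q σ 1 ≤ f 1)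
    (hb : ∀ b, 0 ≤ b → b ≤ 1 → f b ≤ q σ b + 1 / 16 * q σ 1) (hp : 0 < q σ 1) :
    ∃ g : R → ℝ, PL g ∧ 0 < g 1 ∧ Dom σ 16 g := by
  let F : ℕ → Set (R → ℝ) := fun n => ({g | PL g ∧ g 1 ≤ 2 * q σ 1} ∩ {g | q σ 1 / 2 ≤ g 1}) ∩
    {g | ∀ b ∈ {b : R | 0 ≤ b ∧ b ≤ 1}, g b ≤ 16 * D σ b + 1 / ((n:ℝ) + 1)}
  have hc : IsClosed {g : R → ℝ | q σ 1 / 2 ≤ g 1} := isClosed_le continuous_const (continuous_apply _)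
  have hcl : ∀ n, IsClosed (F n) := fun n => ((isCompact_PL _).isClosed.inter hc).inter (isClosed_bd _ _)
  obtain ⟨g, hg⟩ := IsCompact.nonempty_iInter_of_sequence_nonempty_isCompact_isClosed F (by
    rintro n g ⟨hg, hg'⟩
    refine ⟨hg, fun b hb => (hg' b hb).trans ?_⟩
    have : 1 / (((n + 1 : ℕ):ℝ) + 1) ≤ 1 / ((n:ℝ) + 1) := by
      apply one_div_le_one_div_of_le (by positivity)
      push_cast; linarith
    linarith) (by
    intro n
    obtain ⟨g, g1, g2, g3, g4⟩ := dom_approx hσ hf h1 hb hp (show 0 < 1 / ((n:ℝ) + 1) by positivity)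
    exact ⟨g, ⟨⟨g1, g2⟩, g3⟩, fun b hb => g4 b hb.1 hb.2⟩)
    (((isCompact_PL _).inter_right hc).inter_right (isClosed_bd _ _)) hcl
  rw [Set.mem_iInter] at hg
  have hg0 := (hg 0).1
  refine ⟨g, hg0.1.1, lt_of_lt_of_le (half_pos hp) hg0.2, dom_of_D hσ hg0.1.1 (by norm_num) fun x x0 x1 => ?_⟩
  refine le_of_forall_pos_le_add fun ε he => ?_
  obtain ⟨n, hn⟩ := exists_nat_one_div_lt he
  have := (hg n).2 x ⟨x0, x1⟩
  linarith

end
end QT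

namespace QT
section
open scoped ComplexStarModule
variable {R : Type*} [CStarAlgebra R] {σ : R → ℂ} [PartialOrder R] [StarOrderedRing R]

lemma cut_sa (s : ℝ) (b : R) : IsSelfAdjoint (cut s b) := cfc_sa _ _

lemma q_cut_ge (hσ : IsQuasitrace σ) {b : R} (hb : IsSelfAdjoint b) (s : ℝ) : q σ b ≤ q σ (cut s b) + s * q σ 1 := by
  have hc : Commute (cut s b) b := by
    unfold cut
    have := cfc_commute_cfc (fun t => max 0 (t - s)) (fun t : ℝ => t) b
    rwa [cfc_id' ℝ b] at this
  rw [← q_smul hσ (.one R), ← q_add hσ (cut_sa s b) ((IsSelfAdjoint.all s).smul (.one R)) ((Commute.one_right _).smul_right s)]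
  refine q_mono hσ hb ((cut_sa s b).add ((IsSelfAdjoint.all s).smul (.one R))) (hc.symm.add_right ((Commute.one_right _).smul_right s)) ?_
  rw [← Algebra.algebraMap_eq_smul_one]
  exact le_cut hb s

lemma par1 {b c r : R} (hb : 0 ≤ b) (hc : IsSelfAdjoint c) (hr : IsSelfAdjoint r) (h : c + r = 1) :
    b ≤ (2:ℝ) • (r * b * r) + (2:ℝ) • (c * b * c) := by
  have := conj_nonneg hb (r - c)
  rw [(hr.sub hc).star_eq] at this
  rw [← sub_nonneg]
  convert this using 1
  rw [eq_sub_of_add_eq' h]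
  simp only [two_smul]
  noncomm_ring

lemma par2 {b c r : R} (hb : 0 ≤ b) (hc : IsSelfAdjoint c) (h : c + r = 1) :
    r * b * r ≤ (2:ℝ) • b + (2:ℝ) • (c * b * c) := by
  have := conj_nonneg hb (1 + c)
  rw [((IsSelfAdjoint.one R).add hc).star_eq] at this
  rw [← sub_nonneg]
  convert this using 1
  rw [eq_sub_of_add_eq' h]
  simp only [two_smul]
  noncomm_ring

lemma conj_sa {b c : R} (hc : IsSelfAdjoint c) (hb : b ≤ 1) : c * b * c ≤ c * c := by
  have := conj_le hb c
  rwa [hc.star_eq, mul_one] at this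

lemma conj_sa0 {b c : R} (hc : IsSelfAdjoint c) (hb : 0 ≤ b) : 0 ≤ c * b * c := by
  have := conj_nonneg hb c
  rwa [hc.star_eq] at this

lemma Dom.add {f g : R → ℝ} {C D : ℝ} (hf : Dom σ C f) (hg : Dom σ D g) : Dom σ (C + D) (fun x => f x + g x) :=
  fun x hx => by have := hf x hx; have := hg x hx; show f x + g x ≤ _; linarith

lemma Dom.smul {f : R → ℝ} {C c : ℝ} (hf : Dom σ C f) (hc : 0 ≤ c) : Dom σ (c * C) (fun x => c * f x) :=
  fun x hx => by
    have := mul_le_mul_of_nonneg_left (hf x hx) hc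
    show c * f x ≤ _; linarith

lemma uac (hσ : IsQuasitrace σ) {C ε : ℝ} (hC : 0 < C) (he : 0 < ε) : ∃ Φ : R → ℝ, PL Φ ∧ (∃ C', Dom σ C' Φ) ∧
    ∀ φ : R → ℝ, PL φ → Dom σ C φ → ∀ b, 0 ≤ b → b ≤ 1 → Φ b < 1 → φ b < ε := by
  by_contra! H
  set T : Set ℝ := {t | ∃ Φ : R → ℝ, PL Φ ∧ (∃ C', Dom σ C' Φ) ∧ ∀ b, 0 ≤ b → b ≤ 1 → Φ b < 1 → q σ b ≤ t} with hT
  have bdd : BddBelow T := ⟨0, by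
    rintro t ⟨Φ, h1, h2, h3⟩
    have := h3 0 le_rfl zero_le_one (by rw [h1.zero]; exact one_pos)
    rwa [q_zero hσ] at this⟩
  have ne : T.Nonempty := ⟨q σ 1, fun _ => 0, PL.zero', ⟨0, fun x hx => by simp⟩, fun b b0 b1 _ => q_le_one hσ b0 b1⟩
  set θ := ε / (32 * C) with hθ
  have θ0 : 0 < θ := by positivity
  have θC : θ * C = ε / 32 := by rw [hθ]; field_simp
  obtain ⟨t, ⟨Φ, hΦ, ⟨C', hC'⟩, hΦt⟩, htd⟩ := exists_lt_of_csInf_lt ne (show sInf T < sInf T + θ by linarith)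
  obtain ⟨φ, hφ, hφC, b₀, b00, b01, hb0, hb0'⟩ := H (fun x => 4 * Φ x) (hΦ.smul' (by norm_num)) ⟨_, hC'.smul (by norm_num)⟩
  have hb0 : 4 * Φ b₀ < 1 := hb0
  have q1 := q1_nonneg hσ
  set s := θ / (q σ 1 + 1) with hs
  have s0 : 0 < s := by positivity
  have sq : s * q σ 1 ≤ θ := by
    rw [hs, div_mul_eq_mul_div, div_le_iff₀ (by positivity)]
    nlinarith
  set N := 16 / s + 16 / (s * ε) + 8 with hN
  have a1 : 0 < 16 / s := by positivity
  have a2 : 0 < 16 / (s * ε) := by positivity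
  have hnot : sInf T - θ ∉ T := fun h => by have := csInf_le bdd h; linarith
  have hΦ' : PL fun x => N * (Φ x + φ x) := (hΦ.add' hφ).smul' (by linarith)
  have hex : ∃ b, 0 ≤ b ∧ b ≤ 1 ∧ N * (Φ b + φ b) < 1 ∧ sInf T - θ < q σ b := by
    by_contra! hh
    exact hnot ⟨fun x => N * (Φ x + φ x), hΦ', ⟨_, (hC'.add hφC).smul (by linarith)⟩, hh⟩
  obtain ⟨b, hb, hb1, hbN, hbq⟩ := hex
  have u0 := hΦ.nn b hb
  have v0 := hφ.nn b hb
  obtain ⟨c, r, cs, rs, cr, c0, c1, hyr, hyr1, cc, -⟩ := split hb hb1 s0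
  have Φcc : Φ (c * c) ≤ 1 / 8 := by
    refine (hΦ.mono cc).trans ?_
    rw [hΦ.smul]
    have : 16 / s * Φ b ≤ 1 := by nlinarith
    have e : 2 / s * Φ b = (16 / s * Φ b) / 8 := by ring
    linarith
  have Φb : Φ b ≤ 1 / 8 := by nlinarith
  have φcc : φ (c * c) ≤ ε / 8 := by
    refine (hφ.mono cc).trans ?_
    rw [hφ.smul]
    have : 16 / (s * ε) * φ b ≤ 1 := by nlinarith
    have e : 2 / s * φ b = (16 / (s * ε) * φ b) * (ε / 8) := by field_simp; ring
    rw [e]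
    nlinarith
  have p1 := hφ.mono (par1 b00 cs rs cr)
  have p2 := hΦ.mono (par2 b00 cs cr)
  have p3 := hφ.mono (conj_sa cs b01)
  have p4 := hΦ.mono (conj_sa cs b01)
  rw [hφ.add, hφ.smul, hφ.smul] at p1
  rw [hΦ.add, hΦ.smul, hΦ.smul] at p2
  have z0 := conj_sa0 rs b00
  have z1 := conj_sa rs b01
  have orth : cut s b * (r * b₀ * r) = 0 := by rw [← mul_assoc, ← mul_assoc, hyr, zero_mul, zero_mul]
  have hcutle : Φ (cut s b) ≤ Φ b := by
    apply hΦ.mono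
    unfold cut
    conv_rhs => rw [← cfc_id' ℝ b]
    apply cfc_mono
    · intro t ht
      have := spec_nonneg hb ht
      exact max_le this (by linarith)
    · exact (show Continuous fun t : ℝ => max 0 (t - s) by fun_prop).continuousOn
    · exact continuousOn_id
  have Y := hΦt (cut s b + r * b₀ * r) (add_nonneg (cut_nonneg s b) z0) ((add_le_add_right z1 _).trans hyr1) (by
    rw [hΦ.add]; linarith)
  rw [q_add hσ (cut_sa s b) (.of_nonneg z0) (orth_comm (cut_sa s b) (.of_nonneg z0) orth)] at Y
  have g1 := q_cut_ge hσ (IsSelfAdjoint.of_nonneg hb) s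
  have g2 := hφC _ z0
  have g3 : q σ (r * b₀ * r) < 4 * θ := by linarith
  have : C * q σ (r * b₀ * r) < C * (4 * θ) := mul_lt_mul_of_pos_left g3 hC
  linarith
end
end QT

namespace QT
section
open scoped ComplexStarModule
variable {R : Type*} [CStarAlgebra R] {σ : R → ℂ} [PartialOrder R] [StarOrderedRing R]

lemma norm_le_of_two {x : R} (hx : IsSelfAdjoint x) {M : ℝ} (hM : 0 ≤ M) (h1 : x ≤ algebraMap ℝ R M)
    (h2 : -algebraMap ℝ R M ≤ x) : ‖x‖ ≤ M := by
  rw [← cfc_id' ℝ x]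
  refine norm_cfc_le hM fun t ht => ?_
  rw [Real.norm_eq_abs, _root_.abs_le]
  rw [← map_neg, algebraMap_le_iff_le_spectrum] at h2
  rw [le_algebraMap_iff_spectrum_le] at h1
  exact ⟨h2 t ht, h1 t ht⟩

lemma sa_le_one {c : R} (hc : IsSelfAdjoint c) (h : ‖c‖ ≤ 1) : c ≤ 1 := by
  have := le_alg hc h
  rwa [map_one] at this

lemma trunc {b : R} (hb : IsSelfAdjoint b) {M : ℝ} (hM : 0 < M) (hbM : ‖b‖ ≤ M) : ∃ k r : R, IsSelfAdjoint k ∧ IsSelfAdjoint r ∧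
    k + r = 1 ∧ 0 ≤ r ∧ r ≤ 1 ∧ k * k ≤ 1 ∧ r ≤ (16 / M ^ 2) • (b * b) ∧
    ∀ c : R, IsSelfAdjoint c → ‖c‖ ≤ 1 → ∀ l : ℝ, 0 ≤ l → l ≤ M / 2 → ‖b + l • (k * c * k)‖ ≤ M := by
  set f : ℝ → ℝ := fun t => ramp (M / 4) (M / 2) |t| with hf
  have fc : Continuous f := (ramp_cont _ _).comp continuous_abs
  have f0 : ∀ t, 0 ≤ f t := fun t => ramp_nonneg _ _ _
  have f1 : ∀ t, f t ≤ 1 := fun t => ramp_le_one _ _ _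
  have hlt : M / 4 < M / 2 := by linarith
  have gc : Continuous fun t => 1 - f t := continuous_const.sub fc
  obtain ⟨r0, r1⟩ := cfc_unit b f0 f1
  obtain ⟨k0, k1⟩ := cfc_unit (f := fun t => 1 - f t) b (fun t => by linarith [f1 t]) (fun t => by linarith [f0 t])
  set k := cfc (fun t => 1 - f t) b with hk
  have ks : IsSelfAdjoint k := cfc_sa _ _
  have hkk : k * k = cfc (fun t => (1 - f t) * (1 - f t)) b := cmul b gc gc
  have key : ∀ b' : R, IsSelfAdjoint b' → ‖b'‖ ≤ M → ∀ l : ℝ, 0 ≤ l → l ≤ M / 2 → 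
      b' + l • cfc (fun t => (1 - f t) * (1 - f t)) b' ≤ algebraMap ℝ R M := by
    intro b' hb' hbM' l l0 l1
    rw [csmul l b' (f := fun t => (1 - f t) * (1 - f t)) (gc.mul gc)]
    conv_lhs => enter [1]; rw [← cfc_id' ℝ b']
    rw [cadd b' (f := fun t => t) (g := fun t => l * ((1 - f t) * (1 - f t))) continuous_id (continuous_const.mul (gc.mul gc)),
      ← cfc_const M b' hb']
    apply cfc_mono
    · intro t ht
      have := spec_bd hbM' ht
      show t + l * ((1 - f t) * (1 - f t)) ≤ M
      rcases le_total |t| (M / 2) with h | h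
      · have := le_abs_self t
        have h3 : (1 - f t) * (1 - f t) ≤ 1 := by nlinarith [f0 t, f1 t]
        have : l * ((1 - f t) * (1 - f t)) ≤ l * 1 := mul_le_mul_of_nonneg_left h3 l0
        linarith
      · have : f t = 1 := ramp_one hlt h
        rw [this]; linarith [(spec_bd hbM' ht).2]
    · exact (continuous_id.add (continuous_const.mul (gc.mul gc))).continuousOn
    · exact continuousOn_const
  have fneg : cfc (fun t => (1 - f t) * (1 - f t)) (-b) = k * k := by
    rw [hkk, ← cfc_comp_neg (f := fun t => (1 - f t) * (1 - f t)) (a := b) (hf := (gc.mul gc).continuousOn)]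
    congr 1
    ext t
    simp only [hf, abs_neg]
  refine ⟨k, cfc f b, ks, cfc_sa _ _, ?_, r0, r1, ?_, ?_, fun c cs cn l l0 l1 => ?_⟩
  · rw [hk, ← one_sub_cfc hb fc]; abel
  · rw [hkk]; exact (cfc_unit b (fun t => mul_self_nonneg _) (fun t => by nlinarith [f0 t, f1 t])).2
  · have : (16 / M ^ 2) • (b * b) = cfc (fun t : ℝ => 16 / M ^ 2 * (t * t)) b := by
      rw [← csmul _ b (f := fun t : ℝ => t * t) (continuous_id.mul continuous_id), ← cmul b (f := fun t : ℝ => t) (g := fun t : ℝ => t) continuous_id continuous_id, cfc_id' ℝ b]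
    rw [this]
    apply cfc_mono
    · intro t ht
      show f t ≤ 16 / M ^ 2 * (t * t)
      rcases le_total |t| (M / 4) with h | h
      · have : f t = 0 := ramp_zero hlt h
        rw [this]; have := mul_self_nonneg t; positivity
      · refine (f1 t).trans ?_
        rw [div_mul_eq_mul_div, le_div_iff₀ (by positivity), ← abs_mul_abs_self t]
        nlinarith
    · exact fc.continuousOn
    · exact (continuous_const.mul (continuous_id.mul continuous_id)).continuousOn
  · have ds : IsSelfAdjoint (k * c * k) := by
      have := cs.conjugate' k
      rwa [ks.star_eq] at this
    have d1 := conj_sa ks (sa_le_one cs cn)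
    have d2 := conj_sa ks (sa_le_one cs.neg (by rwa [norm_neg]))
    refine norm_le_of_two (hb.add ((IsSelfAdjoint.all l).smul ds)) hM.le ?_ ?_
    · have := key b hb hbM l l0 l1
      rw [← hkk] at this
      exact (add_le_add_right (smul_le_smul_of_nonneg_left d1 l0) b).trans this
    · have := key (-b) hb.neg (by rwa [norm_neg]) l l0 l1
      rw [fneg] at this
      have h3 := (add_le_add_right (smul_le_smul_of_nonneg_left d2 l0) (-b)).trans this
      rw [neg_le]
      refine le_trans (le_of_eq ?_) h3
      rw [mul_neg, neg_mul, smul_neg, neg_add]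

lemma PL.trunc_le {φ : R → ℝ} (h : PL φ) {c k r : R} (hc : IsSelfAdjoint c) (hn : ‖c‖ ≤ 1) (hr : IsSelfAdjoint r)
    (hkr : k + r = 1) {θ : ℝ} (hθ : 0 < θ) : φ c - φ (k * c * k) ≤ θ * φ 1 + (1 / θ + 1) * φ (r * r) := by
  have h1 := h.nn _ (star_mul_self_nonneg (θ • c - r))
  have e1 : star (θ • c - r) * (θ • c - r) = θ ^ 2 • (c * c) - θ • (r * c + c * r) + r * r := by
    rw [(((IsSelfAdjoint.all θ).smul hc).sub hr).star_eq, sub_mul, mul_sub, mul_sub, smul_mul_smul_comm, smul_mul_assoc, mul_smul_comm, smul_add, sq]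
    abel
  rw [e1, h.add, h.sub, h.smul, h.smul] at h1
  have h2 := star_mul_le c
  rw [hc.star_eq] at h2
  have h2 := h.mono h2
  rw [h.alg] at h2
  have h3 := h.mono (conj_sa hr (sa_le_one hc.neg (by rwa [norm_neg])))
  rw [mul_neg, neg_mul, h.neg] at h3
  have e2 : c - k * c * k = (r * c + c * r) - r * c * r := by
    rw [eq_sub_of_add_eq hkr]; noncomm_ring
  rw [← h.sub, e2, h.sub]
  have F := h.one_nn
  have h5 : ‖c‖ ^ 2 * φ 1 ≤ φ 1 := by
    have : ‖c‖ ^ 2 ≤ 1 := by nlinarith [norm_nonneg c]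
    nlinarith
  have h4 : φ (r * c + c * r) ≤ θ * φ 1 + 1 / θ * φ (r * r) := by
    have : θ * φ (r * c + c * r) ≤ θ * (θ * φ 1 + 1 / θ * φ (r * r)) := by
      have e : θ * (θ * φ 1 + 1 / θ * φ (r * r)) = θ ^ 2 * φ 1 + φ (r * r) := by field_simp
      rw [e]
      have : θ ^ 2 * φ (c * c) ≤ θ ^ 2 * φ 1 := mul_le_mul_of_nonneg_left (h2.trans h5) (by positivity)
      linarith
    exact le_of_mul_le_mul_left this hθ
  linarith

lemma PL.sq_expand {φ : R → ℝ} (h : PL φ) (b d : R) (l : ℝ) : φ ((b + l • d) * (b + l • d)) = φ (b * b) + l * φ (b * d + d * b) + l ^ 2 * φ (d * d) := by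
  rw [← h.smul, ← h.smul, ← h.add, ← h.add]
  congr 1
  rw [add_mul, mul_add, mul_add, smul_mul_smul_comm, mul_smul_comm, smul_mul_assoc, smul_add, sq]
  abel

lemma q_conj (hσ : IsQuasitrace σ) {b u : R} (hb : 0 ≤ b) (hu : u * star u = 1) : q σ (star u * b * u) = q σ b := by
  have hs : IsSelfAdjoint (cfc Real.sqrt b) := cfc_sa _ _
  have := q_trace hσ (cfc Real.sqrt b * u)
  rw [star_mul, hs.star_eq] at this
  rw [show star u * cfc Real.sqrt b * (cfc Real.sqrt b * u) = star u * b * u by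
    rw [mul_assoc, ← mul_assoc (cfc Real.sqrt b), sq_sqrt hb, mul_assoc], 
    show cfc Real.sqrt b * u * (star u * cfc Real.sqrt b) = b by
    rw [mul_assoc, ← mul_assoc u, hu, one_mul, sq_sqrt hb]] at this
  exact this

end
end QT

namespace QT
section
open scoped ComplexStarModule
variable {R : Type*} [CStarAlgebra R] {σ : R → ℂ} [PartialOrder R] [StarOrderedRing R]

lemma conj_dom (hσ : IsQuasitrace σ) {C : ℝ} {f : R → ℝ} (h : Dom σ C f) {u : R} (hu : u * star u = 1) :
    Dom σ C (fun x => f (star u * x * u)) := fun x hx => by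
  have := h _ (conj_nonneg hx u)
  rwa [q_conj hσ hx hu] at this

lemma conj_norm {c u : R} (hu : u * star u = 1) : ‖u * c * star u‖ ≤ ‖c‖ := by
  have h : ‖u‖ ≤ 1 := by
    have := CStarRing.norm_self_mul_star (x := u)
    rw [hu] at this
    have h1 : ‖(1:R)‖ ≤ 1 := norm_unit zero_le_one le_rfl
    nlinarith [norm_nonneg u]
  have h1 := norm_mul_le (u * c) (star u)
  have h2 := norm_mul_le u c
  rw [norm_star] at h1
  have := norm_nonneg c
  have := norm_nonneg u
  have := norm_nonneg (u * c)
  nlinarith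

set_option maxHeartbeats 1000000 in
/-- the perturbation argument -/
lemma rn_step (hσ : IsQuasitrace σ) {C : ℝ} (hC : 0 < C) {ι : Type*} [Fintype ι] [DecidableEq ι] (u : ι → R) (hu : ∀ i, star (u i) * u i = 1)
    (hu' : ∀ i, u i * star (u i) = 1) {x : R → ℝ} (hx : PL x) (hxC : Dom σ C x)
    (hfix : ∀ y, (Fintype.card ι : ℝ) * x y = ∑ i, x (star (u i) * y * u i)) (i₀ : ι) {c : R} (hc : IsSelfAdjoint c) (hcn : ‖c‖ ≤ 1) :
    x (star (u i₀) * c * u i₀) ≤ x c := by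
  by_contra! hlt
  set ε := x (star (u i₀) * c * u i₀) - x c with hε
  have ε0 : 0 < ε := sub_pos.2 hlt
  have c0 := hx.one_nn
  set θ' := ε / (8 * (x 1 + 1)) with hθ'
  have θ'0 : 0 < θ' := by positivity
  have θ'x : θ' * x 1 ≤ ε / 8 := by
    rw [hθ', div_mul_eq_mul_div, div_le_div_iff₀ (by positivity) (by norm_num)]
    nlinarith
  set e1 := ε / (8 * (1 / θ' + 1)) with he1
  have e10 : 0 < e1 := by positivity
  have e1x : (1 / θ' + 1) * e1 = ε / 8 := by rw [he1]; field_simp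
  obtain ⟨Φ, hΦ, -, hΦC⟩ := uac hσ hC e10
  set M := 64 * (x 1 + 1) with hM
  have M0 : 0 < M := by positivity
  have M1 : 64 ≤ M := by linarith
  have V0 := hΦ.one_nn
  set l := min (M / 2) (ε / (4 * (Φ 1 + 1))) with hl
  have l0 : 0 < l := lt_min (by positivity) (by positivity)
  have lM : l ≤ M / 2 := min_le_left _ _
  have lV : l * (Φ 1 + 1) ≤ ε / 4 := by
    have : l ≤ ε / (4 * (Φ 1 + 1)) := min_le_right _ _
    rw [le_div_iff₀ (by positivity)] at this
    linarith
  set n : ℝ := (Fintype.card ι : ℝ) with hn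
  have n0 : 0 ≤ n := Nat.cast_nonneg _
  set θ := min 1 (l * ε / (4 * (n + 1))) with hθ
  have θ0 : 0 < θ := lt_min one_pos (by positivity)
  have θ1 : θ ≤ 1 := min_le_left _ _
  have θn : (n + 1) * θ ≤ l * ε / 4 := by
    have : θ ≤ l * ε / (4 * (n + 1)) := min_le_right _ _
    rw [le_div_iff₀ (by positivity)] at this
    linarith
  set S : Set ℝ := {t | ∃ g b : R, star g * g = 1 ∧ g * star g = 1 ∧ IsSelfAdjoint b ∧ ‖b‖ ≤ M ∧
    t = 2 * x (star g * b * g) - Φ (b * b)} with hS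
  have bb0 : ∀ b : R, IsSelfAdjoint b → 0 ≤ b * b := fun b hb => by
    have := star_mul_self_nonneg b
    rwa [hb.star_eq] at this
  have xb : ∀ g b : R, star g * g = 1 → IsSelfAdjoint b → ‖b‖ ≤ M → x (star g * b * g) ≤ M * x 1 := by
    intro g b hg hb hbM
    have := (hx.conj g).le_norm_sa hb hbM
    rwa [mul_one, hg] at this
  have bdd : BddAbove S := ⟨2 * (M * x 1), by
    rintro t ⟨g, b, hg, hg', hb, hbM, rfl⟩
    have := xb g b hg hb hbM
    have := hΦ.nn _ (bb0 b hb)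
    linarith⟩
  have m0 : (0:ℝ) ∈ S := ⟨1, 0, by simp, by simp, .zero R, by simpa using M0.le, by simp [hx.zero, hΦ.zero]⟩
  obtain ⟨_, ⟨g, b, hg, hg', hb, hbM, rfl⟩, hgb⟩ := exists_lt_of_lt_csSup ⟨_, m0⟩ (show sSup S - θ < sSup S by linarith)
  have sS := le_csSup bdd m0
  obtain ⟨k, r, ks, rs, kr, r0, r1, kk1, rb, feas⟩ := trunc hb M0 hbM
  have Φb : Φ (b * b) ≤ 2 * (M * x 1) + 1 := by
    have := xb g b hg hb hbM
    linarith
  have Φr : Φ r < 1 := by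
    refine (hΦ.mono rb).trans_lt ?_
    rw [hΦ.smul, div_mul_eq_mul_div, div_lt_one (by positivity)]
    nlinarith
  have rr : r * r ≤ r := by
    have := conj_sa0 rs (sub_nonneg.2 r1)
    have h2 := conj_sa0 ks r0
    have : r - r * r = r * (1 - r) * r + k * r * k := by
      rw [eq_sub_of_add_eq kr]; noncomm_ring
    rw [← sub_nonneg, this]
    positivity
  set d' := g * c * star g with hd'
  have d's : IsSelfAdjoint d' := hc.conjugate g
  have d'n : ‖d'‖ ≤ 1 := (conj_norm hg').trans hcn
  set d := k * d' * k with hd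
  have ds : IsSelfAdjoint d := by
    have := d's.conjugate' k
    rwa [ks.star_eq] at this
  have hdd : Φ (d * d) ≤ Φ 1 := by
    apply hΦ.mono
    have e : d * d = k * (d' * (k * k) * d') * k := by rw [hd]; noncomm_ring
    have h1 := conj_sa d's kk1
    have h2 := star_mul_le d'
    rw [d's.star_eq] at h2
    have h3 : d' * (k * k) * d' ≤ 1 := by
      refine h1.trans (h2.trans ?_)
      rw [← map_one (algebraMap ℝ R)]
      exact alg_mono (by nlinarith [norm_nonneg d'])
    rw [e]
    exact (conj_sa ks h3).trans kk1
  -- the two functionals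
  have Pa := hx.conj g
  have Ca := conj_dom hσ hxC hg'
  have g1 : ∀ i, star (g * u i) * (g * u i) = 1 := fun i => by
    rw [star_mul, mul_assoc, ← mul_assoc (star g), hg, one_mul, hu]
  have g2 : ∀ i, (g * u i) * star (g * u i) = 1 := fun i => by
    rw [star_mul, mul_assoc, ← mul_assoc (u i), hu', one_mul, hg']
  have P1 := hx.conj (g * u i₀)
  have C1 := conj_dom hσ hxC (g2 i₀)
  have bound : ∀ φ : R → ℝ, PL φ → Dom σ C φ → φ 1 = x 1 → |φ d' - φ d| ≤ ε / 4 := by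
    intro φ hφ hφC h1
    have hr := hΦC φ hφ hφC r r0 r1 Φr
    have hrr := hφ.mono rr
    have t1 := hφ.trunc_le d's d'n rs kr θ'0
    have t2 := hφ.trunc_le d's.neg (by rwa [norm_neg]) rs kr θ'0
    rw [mul_neg, neg_mul, hφ.neg, hφ.neg] at t2
    rw [h1] at t1 t2
    have : (1 / θ' + 1) * φ (r * r) ≤ (1 / θ' + 1) * e1 := mul_le_mul_of_nonneg_left (by linarith) (by positivity)
    rw [_root_.abs_le]
    constructor <;> linarith
  have ba := bound _ Pa Ca (by rw [mul_one, hg])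
  have b1 := bound _ P1 C1 (by rw [mul_one, g1])
  have ea : star g * d' * g = c := by
    rw [hd', show star g * (g * c * star g) * g = (star g * g) * c * (star g * g) by noncomm_ring, hg, one_mul, mul_one]
  have e3 : ∀ (i : ι) (y : R), star (g * u i) * y * (g * u i) = star (u i) * (star g * y * g) * u i := fun i y => by
    rw [star_mul]; noncomm_ring
  rw [ea] at ba
  rw [e3, ea] at b1
  have gap : ε / 2 ≤ x (star (g * u i₀) * d * (g * u i₀)) - x (star g * d * g) := by
    rw [_root_.abs_le] at ba b1
    linarith [ba.1, ba.2, b1.1, b1.2]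
  -- perturbation at the base point
  have mem : ∀ (g' b' : R), star g' * g' = 1 → g' * star g' = 1 → IsSelfAdjoint b' → ‖b'‖ ≤ M → 
      2 * x (star g' * b' * g') - Φ (b' * b') ≤ sSup S := fun g' b' h1 h2 h3 h4 => le_csSup bdd ⟨g', b', h1, h2, h3, h4, rfl⟩
  have mneg := mem g (b + l • (k * (-d') * k)) hg hg' (hb.add ((IsSelfAdjoint.all l).smul (by rw [mul_neg, neg_mul]; exact ds.neg)))
    (feas _ d's.neg (by rwa [norm_neg]) l l0.le lM)
  have mpos := mem (g * u i₀) (b + l • d) (g1 _) (g2 _) (hb.add ((IsSelfAdjoint.all l).smul ds)) (feas _ d's d'n l l0.le lM)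
  rw [mul_neg, neg_mul, ← hd, hΦ.sq_expand] at mneg
  rw [hΦ.sq_expand] at mpos
  have x1 : x (star g * (b + l • -d) * g) = x (star g * b * g) - l * x (star g * d * g) := by
    have := Pa.add b (l • -d)
    rw [this, Pa.smul, Pa.neg]; ring
  have x2 : x (star (g * u i₀) * (b + l • d) * (g * u i₀)) = x (star (g * u i₀) * b * (g * u i₀)) + l * x (star (g * u i₀) * d * (g * u i₀)) := by
    have := P1.add b (l • d)
    rw [this, P1.smul]
  rw [x1, mul_neg, neg_mul, ← neg_add, hΦ.neg, neg_mul_neg] at mneg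
  rw [x2] at mpos
  have avg := hfix (star g * b * g)
  simp_rw [← e3] at avg
  have others : ∑ i ∈ Finset.univ.erase i₀, (2 * x (star (g * u i) * b * (g * u i)) - Φ (b * b)) ≤ (n - 1) * sSup S := by
    refine (Finset.sum_le_card_nsmul _ _ (sSup S) fun i _ => mem _ _ (g1 i) (g2 i) hb hbM).trans ?_
    rw [Finset.card_erase_of_mem (Finset.mem_univ _), nsmul_eq_mul, Finset.card_univ, Nat.cast_sub, Nat.cast_one]
    exact Fintype.card_pos_iff.2 ⟨i₀⟩
  have tot : ∑ i, (2 * x (star (g * u i) * b * (g * u i)) - Φ (b * b)) = n * (2 * x (star g * b * g) - Φ (b * b)) := by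
    rw [Finset.sum_sub_distrib, ← Finset.mul_sum, ← avg, Finset.sum_const, Finset.card_univ, nsmul_eq_mul]
    ring
  rw [← Finset.add_sum_erase _ _ (Finset.mem_univ i₀)] at tot
  have n1 : n * (sSup S - θ) ≤ n * (2 * x (star g * b * g) - Φ (b * b)) := mul_le_mul_of_nonneg_left hgb.le n0
  have f1 : l * (ε / 2) ≤ l * (x (star (g * u i₀) * d * (g * u i₀)) - x (star g * d * g)) := mul_le_mul_of_nonneg_left gap l0.le
  have f2 : l ^ 2 * Φ (d * d) ≤ l * (ε / 4) := by
    have : l ^ 2 * Φ (d * d) ≤ l ^ 2 * (Φ 1 + 1) := mul_le_mul_of_nonneg_left (by linarith) (by positivity)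
    have : l * (l * (Φ 1 + 1)) ≤ l * (ε / 4) := mul_le_mul_of_nonneg_left lV l0.le
    have e : l ^ 2 * (Φ 1 + 1) = l * (l * (Φ 1 + 1)) := by ring
    linarith
  have f3 : 0 < l * ε := by positivity
  linarith

end
end QT

namespace QT
section
open scoped ComplexStarModule
variable {R : Type*} [CStarAlgebra R] {σ : R → ℂ} [PartialOrder R] [StarOrderedRing R]

/-- compact convex set of dominated functionals of given mass -/
def WW (σ : R → ℂ) (C c₀ : ℝ) : Set (R → ℝ) := {f | PL f ∧ Dom σ C f ∧ f 1 = c₀}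

lemma WW_compact (σ : R → ℂ) (C c₀ : ℝ) : IsCompact (WW σ C c₀) := by
  have e : WW σ C c₀ = ({f | PL f ∧ f 1 ≤ c₀} ∩ {f | ∀ x ∈ {x : R | 0 ≤ x}, f x ≤ C * q σ x}) ∩ {f | f 1 = c₀} := by
    ext f
    exact ⟨fun h => ⟨⟨⟨h.1, h.2.2.le⟩, h.2.1⟩, h.2.2⟩, fun h => ⟨h.1.1.1, h.1.2, h.2⟩⟩
  rw [e]
  exact ((isCompact_PL _).inter_right (isClosed_bd _ _)).inter_right (isClosed_eq (continuous_apply _) continuous_const)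

lemma WW_conj (hσ : IsQuasitrace σ) {C c₀ : ℝ} {f : R → ℝ} (h : f ∈ WW σ C c₀) {u : R} (hu : star u * u = 1) (hu' : u * star u = 1) :
    (fun y => f (star u * y * u)) ∈ WW σ C c₀ :=
  ⟨h.1.conj u, conj_dom hσ h.2.1 hu', by show f (star u * 1 * u) = _; rw [mul_one, hu, h.2.2]⟩

lemma PL.sum' {κ : Type*} (s : Finset κ) (f : κ → R → ℝ) (h : ∀ k, PL (f k)) : PL (fun y => ∑ k ∈ s, f k y) := by
  classical
  induction s using Finset.induction_on with
  | empty => simpa using PL.zero'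
  | insert a s ha ih =>
    simp_rw [Finset.sum_insert ha]
    exact (h a).add' ih

lemma WW_avg {C c₀ : ℝ} {κ : Type*} (s : Finset κ) (hs : s.Nonempty) (f : κ → R → ℝ) (h : ∀ k, f k ∈ WW σ C c₀) :
    (fun y => 1 / (s.card : ℝ) * ∑ k ∈ s, f k y) ∈ WW σ C c₀ := by
  have hn : (0:ℝ) < s.card := by exact_mod_cast hs.card_pos
  refine ⟨(PL.sum' s f fun k => (h k).1).smul' (by positivity), fun x hx => ?_, ?_⟩
  · show 1 / (s.card : ℝ) * ∑ k ∈ s, f k x ≤ _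
    have := Finset.sum_le_card_nsmul s (fun k => f k x) (C * q σ x) fun k _ => (h k).2.1 x hx
    rw [nsmul_eq_mul] at this
    rw [one_div, inv_mul_le_iff₀ hn]
    exact this
  · show 1 / (s.card : ℝ) * ∑ k ∈ s, f k 1 = _
    rw [Finset.sum_congr rfl fun k _ => (h k).2.2, Finset.sum_const, nsmul_eq_mul]
    field_simp

/-- average over a finite family of inner automorphisms -/
noncomputable def avgOp {ι : Type*} [Fintype ι] (u : ι → R) (f : R → ℝ) : R → ℝ := fun y => 1 / ((Finset.univ : Finset ι).card : ℝ) * ∑ i, f (star (u i) * y * u i)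

lemma avg_fix (hσ : IsQuasitrace σ) {C c₀ : ℝ} {ι : Type*} [Fintype ι] [Nonempty ι] (u : ι → R) (hu : ∀ i, star (u i) * u i = 1)
    (hu' : ∀ i, u i * star (u i) = 1) {f : R → ℝ} (hf : f ∈ WW σ C c₀) :
    ∃ x ∈ WW σ C c₀, ∀ y, (Fintype.card ι : ℝ) * x y = ∑ i, x (star (u i) * y * u i) := by
  have hS : ∀ g ∈ WW σ C c₀, avgOp u g ∈ WW σ C c₀ := fun g hg =>
    WW_avg Finset.univ Finset.univ_nonempty (fun i y => g (star (u i) * y * u i)) fun i => WW_conj hσ hg (hu i) (hu' i)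
  let a : ℕ → R → ℝ := fun k => (avgOp u)^[k] f
  have ha : ∀ k, a k ∈ WW σ C c₀ := by
    intro k
    induction k with
    | zero => exact hf
    | succ k ih =>
      show (avgOp u)^[k+1] f ∈ _
      rw [Function.iterate_succ_apply']
      exact hS _ ih
  have hc0 : 0 ≤ c₀ := by rw [← hf.2.2]; exact hf.1.one_nn
  let F : ℕ → Set (R → ℝ) := fun n => WW σ C c₀ ∩ ⋂ y, {x | |avgOp u x y - x y| ≤ 1 / ((n:ℝ) + 1) * (2 * (‖y‖ * c₀))}
  have hcl : ∀ n, IsClosed (⋂ y, {x : R → ℝ | |avgOp u x y - x y| ≤ 1 / ((n:ℝ) + 1) * (2 * (‖y‖ * c₀))}) := fun n =>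
    isClosed_iInter fun y => isClosed_le (by unfold avgOp; fun_prop) continuous_const
  obtain ⟨x, hx⟩ := IsCompact.nonempty_iInter_of_sequence_nonempty_isCompact_isClosed F (by
    rintro n g ⟨hg, hg'⟩
    refine ⟨hg, Set.mem_iInter.2 fun y => ?_⟩
    have h0 : |avgOp u g y - g y| ≤ 1 / (((n + 1 : ℕ):ℝ) + 1) * (2 * (‖y‖ * c₀)) := Set.mem_iInter.1 hg' y
    show |avgOp u g y - g y| ≤ 1 / ((n:ℝ) + 1) * (2 * (‖y‖ * c₀))
    refine h0.trans ?_
    have : 1 / (((n + 1 : ℕ):ℝ) + 1) ≤ 1 / ((n:ℝ) + 1) := by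
      apply one_div_le_one_div_of_le (by positivity)
      push_cast; linarith
    exact mul_le_mul_of_nonneg_right this (by positivity)) (by
    intro n
    refine ⟨_, WW_avg (Finset.range (n + 1)) (by simp) a ha, Set.mem_iInter.2 fun y => ?_⟩
    show |avgOp u (fun y => 1 / ((Finset.range (n+1)).card : ℝ) * ∑ k ∈ Finset.range (n+1), a k y) y - 1 / ((Finset.range (n+1)).card : ℝ) * ∑ k ∈ Finset.range (n+1), a k y| ≤ _
    have e1 : avgOp u (fun y => 1 / ((Finset.range (n+1)).card : ℝ) * ∑ k ∈ Finset.range (n+1), a k y) y =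
        1 / ((Finset.range (n+1)).card : ℝ) * ∑ k ∈ Finset.range (n+1), a (k + 1) y := by
      have : ∀ k, a (k + 1) y = avgOp u (a k) y := fun k => by
        show (avgOp u)^[k+1] f y = _
        rw [Function.iterate_succ_apply']
      simp_rw [this]
      unfold avgOp
      rw [← Finset.mul_sum, ← Finset.mul_sum, Finset.sum_comm]
      ring
    rw [e1, ← mul_sub, ← Finset.sum_sub_distrib, Finset.sum_range_sub (fun k => a k y), Finset.card_range, abs_mul, abs_of_nonneg (by positivity)]
    push_cast
    refine mul_le_mul_of_nonneg_left ?_ (by positivity)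
    have h1 := (ha (n + 1)).1.abs_le y
    have h2 := (ha 0).1.abs_le y
    rw [(ha _).2.2] at h1 h2
    have := abs_sub (a (n + 1) y) (a 0 y)
    linarith) ((WW_compact σ C c₀).inter_right (by exact_mod_cast hcl 0)) (fun n => (WW_compact σ C c₀).isClosed.inter (hcl n))
  rw [Set.mem_iInter] at hx
  refine ⟨x, (hx 0).1, fun y => ?_⟩
  have h0 : |avgOp u x y - x y| ≤ 0 := by
    have lim : Tendsto (fun n : ℕ => 1 / ((n:ℝ) + 1) * (2 * (‖y‖ * c₀))) atTop (𝓝 (0 * (2 * (‖y‖ * c₀)))) :=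
      tendsto_one_div_add_atTop_nhds_zero_nat.mul_const _
    rw [zero_mul] at lim
    exact ge_of_tendsto' lim fun n => Set.mem_iInter.1 (hx n).2 y
  have h1 := sub_eq_zero.1 (abs_nonpos_iff.1 h0)
  rw [← h1, avgOp, Finset.card_univ]
  have : (Fintype.card ι : ℝ) ≠ 0 := by exact_mod_cast Fintype.card_ne_zero
  field_simp

lemma inv_sa (hσ : IsQuasitrace σ) {C : ℝ} (hC : 0 < C) {ι : Type*} [Fintype ι] [DecidableEq ι] (u : ι → R) (hu : ∀ i, star (u i) * u i = 1)
    (hu' : ∀ i, u i * star (u i) = 1) {x : R → ℝ} (hx : PL x) (hxC : Dom σ C x)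
    (hfix : ∀ y, (Fintype.card ι : ℝ) * x y = ∑ i, x (star (u i) * y * u i)) (i : ι) (y : R) : x (star (u i) * y * u i) = x y := by
  have hle : ∀ c, IsSelfAdjoint c → x (star (u i) * c * u i) ≤ x c := by
    intro c hc
    have hp : 0 < ‖c‖ + 1 := by positivity
    have := rn_step hσ hC u hu hu' hx hxC hfix i (c := (‖c‖ + 1)⁻¹ • c) ((IsSelfAdjoint.all _).smul hc) (by
      rw [norm_smul, norm_inv, Real.norm_of_nonneg hp.le, inv_mul_le_iff₀ hp]; linarith)
    rw [mul_smul_comm, smul_mul_assoc, hx.smul, hx.smul] at this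
    exact le_of_mul_le_mul_left this (by positivity)
  have heq : ∀ c, IsSelfAdjoint c → x (star (u i) * c * u i) = x c := fun c hc => by
    have := hle _ hc.neg
    rw [mul_neg, neg_mul, hx.neg, hx.neg] at this
    exact le_antisymm (hle c hc) (by linarith)
  have h1 := (hx.conj (u i)).re y
  have h2 := hx.re y
  rw [h1, h2]
  exact heq _ ((IsSelfAdjoint.all (1 / 2 : ℝ)).smul (IsSelfAdjoint.add_star_self y))

/-- II.4 -/
lemma inv_exists (hσ : IsQuasitrace σ) {C c₀ : ℝ} (hC : 0 < C) {f : R → ℝ} (hf : f ∈ WW σ C c₀) :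
    ∃ x ∈ WW σ C c₀, ∀ u : R, star u * u = 1 → u * star u = 1 → ∀ y, x (star u * y * u) = x y := by
  classical
  let U := {u : R // star u * u = 1 ∧ u * star u = 1}
  let t : U → Set (R → ℝ) := fun u => ⋂ y, {x | x (star u.1 * y * u.1) = x y}
  obtain ⟨x, hx, hx'⟩ := (WW_compact σ C c₀).inter_iInter_nonempty t (fun u => isClosed_iInter fun y =>
    isClosed_eq (continuous_apply _) (continuous_apply _)) (by
    intro s
    let one : U := ⟨1, by simp, by simp⟩
    let ι := {u // u ∈ insert one s}
    have : Nonempty ι := ⟨⟨one, Finset.mem_insert_self _ _⟩⟩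
    obtain ⟨x, hx, hfix⟩ := avg_fix hσ (fun i : ι => i.1.1) (fun i => i.1.2.1) (fun i => i.1.2.2) hf
    refine ⟨x, hx, ?_⟩
    simp only [Set.mem_iInter]
    intro u hu
    refine Set.mem_iInter.2 fun y => ?_
    exact inv_sa hσ hC (fun i : ι => i.1.1) (fun i => i.1.2.1) (fun i => i.1.2.2) hx.1 hx.2.1 hfix ⟨u, Finset.mem_insert_of_mem hu⟩ y)
  refine ⟨x, hx, fun u h1 h2 y => ?_⟩
  exact Set.mem_iInter.1 (Set.mem_iInter.1 hx' ⟨u, h1, h2⟩) y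

lemma tracial {x : R → ℝ} (hx : PL x) (h : ∀ u : R, star u * u = 1 → u * star u = 1 → ∀ y, x (star u * y * u) = x y) (a b : R) :
    x (a * b) = x (b * a) := by
  have ha : a ∈ Submodule.span ℂ (unitary R : Set R) := by rw [CStarAlgebra.span_unitary]; trivial
  revert b
  induction ha using Submodule.span_induction with
  | mem u hu =>
    intro b
    have := h u hu.1 hu.2 (u * b)
    rw [← mul_assoc, hu.1, one_mul] at this
    exact this.symm
  | zero => intro b; rw [zero_mul, mul_zero]
  | add u v _ _ hu hv => intro b; rw [add_mul, mul_add, hx.add, hx.add, hu, hv]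
  | smul c u _ hu => intro b; rw [smul_mul_assoc, ← mul_smul_comm, hu, smul_mul_assoc, mul_smul_comm]

lemma trace_exists (hσ : IsQuasitrace σ) {f : R → ℝ} (hf : PL f) (h1 : q σ 1 ≤ f 1)
    (hb : ∀ b, 0 ≤ b → b ≤ 1 → f b ≤ q σ b + 1 / 16 * q σ 1) (hp : 0 < q σ 1) :
    ∃ t : R → ℝ, PL t ∧ 0 < t 1 ∧ Dom σ 1 t ∧ ∀ a b, t (a * b) = t (b * a) := by
  obtain ⟨g, hg, g1, gD⟩ := dom_exists hσ hf h1 hb hp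
  obtain ⟨x, hx, hu⟩ := inv_exists hσ (by norm_num) (show g ∈ WW σ 16 (g 1) from ⟨hg, gD, rfl⟩)
  refine ⟨fun y => 1 / 16 * x y, hx.1.smul' (by norm_num), ?_, ?_, fun a b => by show 1 / 16 * x (a * b) = 1 / 16 * x (b * a); rw [tracial hx.1 hu]⟩
  · show 0 < 1 / 16 * x 1
    rw [hx.2.2]; linarith
  · intro y hy
    have := hx.2.1 y hy
    show 1 / 16 * x y ≤ _
    linarith

end
end QT

namespace QT
section
open scoped ComplexStarModule
variable {R : Type*} [CStarAlgebra R] {σ : R → ℂ} [PartialOrder R] [StarOrderedRing R]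

/-- two by two matrices, as a C*-algebra -/
def M2 (R : Type*) := CStarMatrix (Fin 2) (Fin 2) R

noncomputable instance : CStarAlgebra (M2 R) := inferInstanceAs (CStarAlgebra (CStarMatrix (Fin 2) (Fin 2) R))
noncomputable instance : PartialOrder (M2 R) := inferInstanceAs (PartialOrder (CStarMatrix (Fin 2) (Fin 2) R))
instance : StarOrderedRing (M2 R) := inferInstanceAs (StarOrderedRing (CStarMatrix (Fin 2) (Fin 2) R))

def ent (x : M2 R) (i j : Fin 2) : R := x i j

lemma qt_m2 {σ : Matrix (Fin 2) (Fin 2) R → ℂ} (h : IsQuasitrace σ) : IsQuasitrace (R := M2 R) σ := h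
lemma m2_qt {σ : M2 R → ℂ} (h : IsQuasitrace σ) : IsQuasitrace (R := Matrix (Fin 2) (Fin 2) R) σ := h

lemma m2_ext {x y : M2 R} (h00 : ent x 0 0 = ent y 0 0) (h01 : ent x 0 1 = ent y 0 1) (h10 : ent x 1 0 = ent y 1 0)
    (h11 : ent x 1 1 = ent y 1 1) : x = y := by
  refine CStarMatrix.ext (M₁ := x) (M₂ := y) fun i j => ?_
  fin_cases i <;> fin_cases j
  · exact h00
  · exact h01
  · exact h10
  · exact h11

lemma m2_mul (x y : M2 R) (i j : Fin 2) : ent (x * y) i j = ent x i 0 * ent y 0 j + ent x i 1 * ent y 1 j :=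
  (CStarMatrix.mul_apply (M := x) (N := y) (i := i) (k := j)).trans (Fin.sum_univ_two _)
lemma m2_star (x : M2 R) (i j : Fin 2) : ent (star x) i j = star (ent x j i) := rfl
lemma m2_add (x y : M2 R) (i j : Fin 2) : ent (x + y) i j = ent x i j + ent y i j := rfl
lemma m2_zero (i j : Fin 2) : ent (0 : M2 R) i j = 0 := rfl
lemma m2_one (i j : Fin 2) : ent (1 : M2 R) i j = if i = j then 1 else 0 := rfl
lemma m2_smul (c : ℂ) (x : M2 R) (i j : Fin 2) : ent (c • x) i j = c • ent x i j := rfl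
lemma m2_rsmul (c : ℝ) (x : M2 R) (i j : Fin 2) : ent (c • x) i j = c • ent x i j := by
  rw [← Complex.coe_smul, m2_smul, Complex.coe_smul]

/-- restriction of quasitraces along non-unital star homomorphisms -/
lemma qt_comap {A B : Type*} [NonUnitalRing A] [StarRing A] [Module ℂ A] [NonUnitalRing B] [StarRing B] [Module ℂ B]
    [IsScalarTower ℂ A A] [SMulCommClass ℂ A A] [StarModule ℂ A] [IsScalarTower ℂ B B] [SMulCommClass ℂ B B] [StarModule ℂ B]
    (e : A →⋆ₙₐ[ℂ] B) {τ : B → ℂ} (h : IsQuasitrace τ) : IsQuasitrace (fun x => τ (e x)) := by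
  refine ⟨fun x => ?_, fun x => ?_, fun a b ha hb => ?_, fun S hS x hx y hy => ?_, fun S hS c x hx => ?_⟩
  · show τ (e _) = τ (e _)
    rw [map_mul, map_mul, map_star]; exact h.trace_eq _
  · show 0 ≤ τ (e _)
    rw [map_mul, map_star]; exact h.nonneg _
  · show τ (e _) = τ (e _) + _ * τ (e _)
    rw [map_add, map_smul]
    exact h.sa_add _ _ (ha.map e) (hb.map e)
  · show τ (e _) = τ (e _) + τ (e _)
    rw [map_add]
    refine h.comm_add (S.map e) ?_ _ ⟨x, hx, rfl⟩ _ ⟨y, hy, rfl⟩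
    rintro _ ⟨u, hu, rfl⟩ _ ⟨v, hv, rfl⟩
    have := congrArg e (hS u hu v hv)
    rw [map_mul, map_mul] at this
    exact this
  · show τ (e _) = _ * τ (e _)
    rw [map_smul]
    refine h.comm_smul (S.map e) ?_ c _ ⟨x, hx, rfl⟩
    rintro _ ⟨u, hu, rfl⟩ _ ⟨v, hv, rfl⟩
    have := congrArg e (hS u hu v hv)
    rw [map_mul, map_mul] at this
    exact this

lemma qt_sub {τ : R → ℂ} (hσ : IsQuasitrace σ) (hτ : IsQuasitrace τ) (h : ∀ x, 0 ≤ x → q τ x ≤ q σ x) :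
    IsQuasitrace (fun x => σ x - τ x) := by
  refine ⟨fun x => ?_, fun x => ?_, fun a b ha hb => ?_, fun S hS x hx y hy => ?_, fun S hS c x hx => ?_⟩
  · simp only [hσ.trace_eq, hτ.trace_eq]
  · have := h _ (star_mul_self_nonneg x)
    show 0 ≤ σ _ - τ _
    rw [σ_real_nonneg hσ (star_mul_self_nonneg x), σ_real_nonneg hτ (star_mul_self_nonneg x)]
    rw [sub_nonneg]
    exact_mod_cast this
  · simp only [hσ.sa_add a b ha hb, hτ.sa_add a b ha hb]; ring
  · simp only [hσ.comm_add S hS x hx y hy, hτ.comm_add S hS x hx y hy]; ring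
  · simp only [hσ.comm_smul S hS c x hx, hτ.comm_smul S hS c x hx]; ring

lemma σ_sa (hσ : IsQuasitrace σ) {a : R} (ha : IsSelfAdjoint a) : σ a = q σ a := by
  have hb : 0 ≤ algebraMap ℝ R ‖a‖ + a := by
    have := neg_le_alg ha le_rfl
    first
      | exact neg_le_iff_add_nonneg.1 this
      | exact neg_le_iff_add_nonneg'.1 this
  have hs : IsSelfAdjoint (algebraMap ℝ R ‖a‖) := IsSelfAdjoint.algebraMap R (IsSelfAdjoint.all _)
  have h0 : 0 ≤ algebraMap ℝ R ‖a‖ := algebraMap_nonneg _ (norm_nonneg a)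
  have h1 := σ_real_nonneg hσ hb
  have h2 := σ_real_nonneg hσ h0
  have hc : Commute (algebraMap ℝ R ‖a‖) a := Algebra.commutes _ _
  rw [σ_add hσ hs ha hc, q_add hσ hs ha hc, h2] at h1
  push_cast at h1
  exact add_left_cancel h1

lemma σ_abs (hσ : IsQuasitrace σ) (h : q σ 1 = 0) (x : R) : σ x = 0 := by
  have key : ∀ a : R, IsSelfAdjoint a → σ a = 0 := by
    intro a ha
    have k : ∀ b : R, IsSelfAdjoint b → q σ b ≤ 0 := fun b hb => by
      have hs : IsSelfAdjoint (algebraMap ℝ R ‖b‖) := IsSelfAdjoint.algebraMap R (IsSelfAdjoint.all _)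
      have := q_mono hσ hb hs (Algebra.commutes _ _).symm (le_alg hb le_rfl)
      rwa [Algebra.algebraMap_eq_smul_one, q_smul hσ (.one R), h, mul_zero] at this
    have h1 := k a ha
    have h2 := k _ ((IsSelfAdjoint.all (-1:ℝ)).smul ha)
    rw [q_smul hσ ha] at h2
    rw [σ_sa hσ ha]
    have : q σ a = 0 := by linarith
    rw [this]; simp
  rw [← realPart_add_I_smul_imaginaryPart x, hσ.sa_add _ _ (ℜ x).2 (ℑ x).2, key _ (ℜ x).2, key _ (ℑ x).2]
  simp

lemma cplx_add {t : R → ℝ} (h : PL t) (x y : R) : cplx t (x + y) = cplx t x + cplx t y := by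
  have e1 : (ℜ (x + y) : R) = ℜ x + ℜ y := by rw [map_add]; rfl
  have e2 : (ℑ (x + y) : R) = ℑ x + ℑ y := by rw [map_add]; rfl
  rw [cplx, e1, e2, h.add, h.add, cplx, cplx]; push_cast; ring

lemma cplx_smul {t : R → ℝ} (h : PL t) (c : ℂ) (x : R) : cplx t (c • x) = c * cplx t x := by
  have e1 : (ℜ (c • x) : R) = c.re • (ℜ x : R) + (-c.im) • (ℑ x : R) := by
    rw [realPart_smul, neg_smul, ← sub_eq_add_neg]; rfl
  have e2 : (ℑ (c • x) : R) = c.re • (ℑ x : R) + c.im • (ℜ x : R) := by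
    rw [imaginaryPart_smul]; rfl
  rw [cplx, e1, e2, h.add, h.add, h.smul, h.smul, h.smul, h.smul, cplx]
  apply Complex.ext
  · simp; ring
  · simp

lemma PL.qt {t : R → ℝ} (h : PL t) (ht : ∀ a b, t (a * b) = t (b * a)) : IsQuasitrace (cplx t) :=
  cplx_qt (fun c d a b _ _ _ => by rw [h.add, h.smul, h.smul]) h.nn fun x => ht _ _

lemma PL.q_cplx {t : R → ℝ} (h : PL t) {x : R} (hx : IsSelfAdjoint x) : q (cplx t) x = t x := by
  rw [q, cplx_sa h.zero hx]; simp

def sgl (a b : Fin 2) (x : R) : M2 R := (Matrix.single a b x : Matrix (Fin 2) (Fin 2) R)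
lemma ent_sgl (a b : Fin 2) (x : R) (i j : Fin 2) : ent (sgl a b x) i j = if a = i ∧ b = j then x else 0 := by
  show (Matrix.single a b x : Matrix (Fin 2) (Fin 2) R) i j = _
  rw [Matrix.single_apply]

/-- the upper left corner embedding -/
def e00 (R : Type*) [CStarAlgebra R] [PartialOrder R] [StarOrderedRing R] : R →⋆ₙₐ[ℂ] M2 R where
  toFun x := sgl 0 0 x
  map_smul' c x := by apply m2_ext <;> simp [m2_smul, ent_sgl]
  map_zero' := by apply m2_ext <;> simp [m2_zero, ent_sgl]
  map_add' x y := by apply m2_ext <;> simp [m2_add, ent_sgl]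
  map_mul' x y := by apply m2_ext <;> simp [m2_mul, ent_sgl]
  map_star' x := by apply m2_ext <;> simp [m2_star, ent_sgl]

lemma e00_ap (x : R) : e00 R x = sgl 0 0 x := rfl
lemma e00_00 (x : R) : ent (e00 R x) 0 0 = x := by simp [e00_ap, ent_sgl]
lemma e00_11 (x : R) : ent (e00 R x) 1 1 = 0 := by simp [e00_ap, ent_sgl]

lemma m2_corner : Corner (e00 R 1) (sgl 1 1 (1 : R)) (sgl 1 0 (1 : R)) := by
  refine ⟨?_, ?_, ?_, ?_⟩
  · apply m2_ext <;> simp [m2_mul, m2_star, e00_ap, ent_sgl]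
  · apply m2_ext <;> simp [m2_mul, m2_star, e00_ap, ent_sgl]
  · apply m2_ext <;> simp [m2_add, m2_one, e00_ap, ent_sgl]
  · apply m2_ext <;> simp [m2_mul, e00_ap, ent_sgl]

lemma m2_conj (x : M2 R) : e00 R 1 * x * e00 R 1 = e00 R (ent x 0 0) := by
  apply m2_ext <;> simp [m2_mul, e00_ap, ent_sgl]

def t2 (t : R → ℝ) (x : M2 R) : ℝ := t (ent x 0 0) + t (ent x 1 1)

lemma PL.two {t : R → ℝ} (h : PL t) : PL (t2 t) := by
  refine ⟨fun x y => ?_, fun c x => ?_, fun x => ?_, fun x hx => ?_⟩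
  · simp only [t2, m2_add, h.add]; ring
  · simp only [t2, m2_rsmul, h.smul]; ring
  · simp only [t2, m2_star, h.st]
  · obtain ⟨y, rfl⟩ := CStarAlgebra.nonneg_iff_eq_star_mul_self.1 hx
    simp only [t2, m2_mul, m2_star]
    have := fun i j => star_mul_self_nonneg (ent y i j)
    exact add_nonneg (h.nn _ (add_nonneg (this _ _) (this _ _))) (h.nn _ (add_nonneg (this _ _) (this _ _)))

lemma t2_tr {t : R → ℝ} (h : PL t) (ht : ∀ a b, t (a * b) = t (b * a)) (x y : M2 R) : t2 t (x * y) = t2 t (y * x) := by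
  simp only [t2, m2_mul, h.add]
  rw [ht (ent x 0 0), ht (ent x 0 1), ht (ent x 1 0), ht (ent x 1 1)]; ring

lemma e00_cont : Continuous (e00 R) := by
  have h : ∀ x, ‖e00 R x‖ ≤ ‖x‖ := fun x => NonUnitalStarAlgHom.norm_apply_le (e00 R) x
  exact AddMonoidHomClass.continuous_of_bound (e00 R) 1 (by simpa using h)

lemma e00_cfc {f : ℝ → ℝ} (hf : Continuous f) (h0 : f 0 = 0) {b : R} (hb : IsSelfAdjoint b) :
    cfc f (e00 R b) = e00 R (cfc f b) := by
  rw [← cfcₙ_eq_cfc hf.continuousOn h0, ← cfcₙ_eq_cfc hf.continuousOn h0]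
  exact (NonUnitalStarAlgHomClass.map_cfcₙ (S := ℂ) (e00 R) f b hf.continuousOn h0 e00_cont hb (hb.map (e00 R))).symm

lemma e00_nonneg {b : R} (hb : 0 ≤ b) : 0 ≤ e00 R b := by
  obtain ⟨y, rfl⟩ := CStarAlgebra.nonneg_iff_eq_star_mul_self.1 hb
  rw [map_mul, map_star]; exact star_mul_self_nonneg _

lemma entry_nonneg {x : M2 R} (hx : 0 ≤ x) : 0 ≤ ent x 0 0 := by
  obtain ⟨y, rfl⟩ := CStarAlgebra.nonneg_iff_eq_star_mul_self.1 hx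
  simp only [m2_mul, m2_star]
  exact add_nonneg (star_mul_self_nonneg _) (star_mul_self_nonneg _)

lemma sub_two {ψ : R → ℂ} (hψ : Is2Quasitrace ψ) {t : R → ℝ} (h : PL t) (ht : ∀ a b, t (a * b) = t (b * a))
    (hd : Dom ψ 1 t) : Is2Quasitrace (fun x => ψ x - cplx t x) := by
  obtain ⟨h1, σ, hσ, hs⟩ := hψ
  have hσ' : IsQuasitrace (R := M2 R) σ := hσ
  have hle : ∀ x, 0 ≤ x → q (cplx t) x ≤ q ψ x := fun x hx => by
    have := hd x hx
    rw [h.q_cplx (.of_nonneg hx)]; linarith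
  have q2 := h.two.qt (t2_tr h ht)
  have hle2 : ∀ x : M2 R, 0 ≤ x → q (cplx (t2 t)) x ≤ q (R := M2 R) σ x := by
    have : Dom (R := M2 R) σ 1 (t2 t) := by
      refine dom_of_D (R := M2 R) hσ' h.two zero_le_one fun x x0 x1 => ?_
      rw [one_mul, ← h.two.q_cplx (.of_nonneg x0)]
      refine (q_le_D q2 x0 x1).trans ?_
      refine D_compare (R := M2 R) hσ' q2 m2_corner (fun y y0 yP => ?_) x0
      have hPy : e00 R 1 * y = y := by
        have := congrArg star yP
        rwa [star_mul, (IsSelfAdjoint.of_nonneg y0).star_eq, m2_corner.Ps.star_eq] at this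
      have hy : y = e00 R (ent y 0 0) := by rw [← m2_conj, hPy, yP]
      have yn := entry_nonneg y0
      generalize ent y 0 0 = b at hy yn
      subst hy
      refine D_le fun s hs' => ?_
      refine le_trans ?_ (q_ramp_le_D hσ' _ hs' (show s < 2 * s by linarith))
      rw [e00_cfc (ramp_cont _ _) (ramp_zero (by linarith) hs'.le) (.of_nonneg yn)]
      have hu := cfc_unit b (ramp_nonneg s (2 * s)) (ramp_le_one s (2 * s))
      rw [h.two.q_cplx (.of_nonneg (e00_nonneg hu.1))]
      have e : q (R := M2 R) σ (e00 R (cfc (ramp s (2 * s)) b)) = q ψ (cfc (ramp s (2 * s)) b) := by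
        show (σ (Matrix.single 0 0 _)).re = (ψ _).re
        rw [hs]
      rw [e, t2, e00_00, e00_11, h.zero, add_zero]
      have := hd _ hu.1
      linarith
    intro x hx
    have := this x hx
    rw [h.two.q_cplx (.of_nonneg hx)]; linarith
  refine ⟨qt_sub h1 (h.qt ht) hle, fun x => σ x - cplx (A := M2 R) (t2 t) x, qt_sub (R := M2 R) hσ' q2 hle2, fun x => ?_⟩
  show σ (Matrix.single 0 0 x) - cplx (t2 t) (e00 R x) = _
  rw [hs]
  congr 1
  have r1 : (ℜ (e00 R x) : M2 R) = e00 R (ℜ x) := by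
    simp only [realPart_apply_coe]
    rw [← map_star, ← map_add]
    exact (map_smul ((e00 R).restrictScalars ℝ) _ _).symm
  have r2 : (ℑ (e00 R x) : M2 R) = e00 R (ℑ x) := by
    simp only [imaginaryPart_apply_coe]
    rw [← map_star, ← map_sub, map_smul]
    congr 1
    exact (map_smul ((e00 R).restrictScalars ℝ) _ _).symm
  rw [cplx, r1, r2, cplx]
  simp only [t2, e00_00, e00_11, h.zero, add_zero]

theorem partII (hyp : ∀ ψ : R → ℂ, Is2Quasitrace ψ → ∃ f, PL f ∧ q ψ 1 ≤ f 1 ∧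
      ∀ b, 0 ≤ b → b ≤ 1 → f b ≤ q ψ b + 1 / 16 * q ψ 1) (ψ : R → ℂ) (hψ : Is2Quasitrace ψ) :
    ∃ t, PL t ∧ ψ = cplx t := by
  let T : Set (R → ℝ) := ({t | PL t ∧ t 1 ≤ q ψ 1} ∩ {t | ∀ a b, t (a * b) = t (b * a)}) ∩ {t | ∀ x ∈ {x : R | 0 ≤ x}, t x ≤ q ψ x}
  have hT : IsCompact T := by
    refine ((isCompact_PL _).inter_right ?_).inter_right (isClosed_bd _ _)
    have : {t : R → ℝ | ∀ a b, t (a * b) = t (b * a)} = ⋂ a, ⋂ b, {t : R → ℝ | t (a * b) = t (b * a)} := by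
      ext t; simp
    rw [this]
    exact isClosed_iInter fun a => isClosed_iInter fun b => isClosed_eq (continuous_apply _) (continuous_apply _)
  have hne : T.Nonempty := ⟨fun _ => 0, ⟨⟨PL.zero', q1_nonneg hψ.1⟩, fun _ _ => rfl⟩, fun x hx => q_nonneg hψ.1 hx⟩
  obtain ⟨t, ⟨⟨⟨h, h1⟩, ht⟩, hd⟩, hmax⟩ := hT.exists_isMaxOn hne (f := fun t => t 1) (continuous_apply _).continuousOn
  have hd' : Dom ψ 1 t := fun x hx => by rw [one_mul]; exact hd x hx
  have h2 := sub_two hψ h ht hd'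
  have hq : ∀ x, 0 ≤ x → q (fun x => ψ x - cplx t x) x = q ψ x - t x := fun x hx => by
    have := h.q_cplx (.of_nonneg hx)
    simp only [q, Complex.sub_re] at this ⊢
    rw [this]
  refine ⟨t, h, ?_⟩
  by_cases h0 : q (fun x => ψ x - cplx t x) 1 = 0
  · funext x
    exact sub_eq_zero.1 (σ_abs h2.1 h0 x)
  exfalso
  have hp : 0 < q (fun x => ψ x - cplx t x) 1 := lt_of_le_of_ne (q1_nonneg h2.1) (Ne.symm h0)
  obtain ⟨f, hf, f1, fb⟩ := hyp _ h2
  obtain ⟨t', g1, g2, g3, g4⟩ := trace_exists h2.1 hf f1 fb hp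
  have key : ∀ x, 0 ≤ x → t x + t' x ≤ q ψ x := fun x hx => by
    have := g3 x hx
    rw [hq x hx] at this; linarith
  have hm : (fun x => t x + t' x) ∈ T :=
    ⟨⟨⟨h.add' g1, key 1 zero_le_one⟩, fun a b => by show t _ + t' _ = t _ + t' _; rw [ht, g4]⟩, key⟩
  have := hmax hm
  have this : t 1 + t' 1 ≤ t 1 := this
  linarith

end
end QT

namespace QT
section
open scoped ComplexStarModule
variable {R : Type*} [CStarAlgebra R] {σ : R → ℂ} [PartialOrder R] [StarOrderedRing R]
variable {A : Type*} [CStarAlgebra A] [PartialOrder A] [StarOrderedRing A]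
variable {E : Type*} [CStarAlgebra E] [PartialOrder E] [StarOrderedRing E]

lemma q_abs_le (hσ : IsQuasitrace σ) {a : R} (ha : IsSelfAdjoint a) : |q σ a| ≤ ‖a‖ * q σ 1 := by
  have k : ∀ b : R, IsSelfAdjoint b → q σ b ≤ ‖b‖ * q σ 1 := fun b hb => by
    have hs : IsSelfAdjoint (algebraMap ℝ R ‖b‖) := IsSelfAdjoint.algebraMap R (IsSelfAdjoint.all _)
    have := q_mono hσ hb hs (Algebra.commutes _ _).symm (le_alg hb le_rfl)
    rwa [Algebra.algebraMap_eq_smul_one, q_smul hσ (.one R)] at this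
  have h2 := k _ ((IsSelfAdjoint.all (-1:ℝ)).smul ha)
  rw [q_smul hσ ha, neg_one_smul, norm_neg] at h2
  exact abs_le.2 ⟨by linarith, k a ha⟩

lemma q_re (hσ : IsQuasitrace σ) (x : R) : q σ x = q σ (ℜ x : R) := by
  have h := hσ.sa_add _ _ (ℜ x).2 (ℑ x).2
  rw [realPart_add_I_smul_imaginaryPart x, σ_sa hσ (ℑ x).2] at h
  rw [q, q, h]; simp

lemma q_star (hσ : IsQuasitrace σ) (x : R) : q σ (star x) = q σ x := by
  rw [q_re hσ x, q_re hσ (star x)]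
  congr 1
  simp only [realPart_apply_coe, star_star, add_comm]

lemma σ_bdd (hσ : IsQuasitrace σ) : ∃ C : ℝ, ∀ x, ‖x‖ ≤ 1 → ‖σ x‖ ≤ C := by
  refine ⟨2 * q σ 1, fun x hx => ?_⟩
  have h := hσ.sa_add _ _ (ℜ x).2 (ℑ x).2
  rw [realPart_add_I_smul_imaginaryPart x, σ_sa hσ (ℑ x).2, σ_sa hσ (ℜ x).2] at h
  have h1 := q_abs_le hσ (ℜ x).2
  have h2 := q_abs_le hσ (ℑ x).2
  have n1 : ‖(ℜ x : R)‖ ≤ 1 := (realPart.norm_le x).trans hx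
  have n2 : ‖(ℑ x : R)‖ ≤ 1 := (imaginaryPart.norm_le x).trans hx
  have q1 := q1_nonneg hσ
  rw [h]
  refine (norm_add_le _ _).trans ?_
  rw [norm_mul, Complex.norm_I, one_mul, Complex.norm_real, Complex.norm_real, Real.norm_eq_abs, Real.norm_eq_abs]
  have m1 := mul_le_mul_of_nonneg_right n1 q1
  have m2 := mul_le_mul_of_nonneg_right n2 q1
  linarith

theorem absMain (i : M2 A →⋆ₐ[ℂ] E) (j : M2 R →⋆ₐ[ℂ] E) (hc : Close i j) (hc' : Close j i)
    (hij : i (e00 A 1) = j (e00 R 1))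
    (hA : ∀ τ : A → ℂ, Is2Quasitrace τ → (∃ C : ℝ, ∀ x, ‖x‖ ≤ 1 → ‖τ x‖ ≤ C) →
      (∀ x y, τ (x + y) = τ x + τ y) ∧ ∀ (c : ℂ) x, τ (c • x) = c * τ x)
    (ψ : R → ℂ) (hψ : Is2Quasitrace ψ) : ∃ t, PL t ∧ ψ = cplx t := by
  refine partII (fun ψ hψ => ?_) ψ hψ
  obtain ⟨h1, σ', hσ', hs⟩ := hψ
  obtain ⟨σ, rfl⟩ : ∃ σ : M2 R → ℂ, σ = σ' := ⟨σ', rfl⟩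
  have hσ : IsQuasitrace σ := hσ'
  have hs : ∀ x, σ (e00 R x) = ψ x := hs
  have hsA := sA_qt hc hσ m2_corner
  have hτ := qt_comap (e00 A) hsA
  obtain ⟨l1, l2⟩ := hA _ ⟨hτ, sA (A := M2 A) σ i j, hsA, fun x => rfl⟩ (σ_bdd hτ)
  let τ : M2 A →ₗ[ℝ] ℝ :=
    { toFun := fun x => q (fun x => sA σ i j (e00 A x)) (ent x 0 0)
      map_add' := fun x y => by
        simp only [q, m2_add]
        rw [l1, Complex.add_re]
      map_smul' := fun c x => by
        simp only [q, m2_rsmul]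
        rw [← Complex.coe_smul, l2, Complex.re_ofReal_mul]; rfl }
  have hτa : ∀ x, τ x = q (fun x => sA σ i j (e00 A x)) (ent x 0 0) := fun x => rfl
  obtain ⟨φ, f0, f1, f2⟩ := transfer hc hc' hσ m2_corner m2_corner.Ps m2_corner.PP hij τ
    (fun x => by rw [hτa, hτa, m2_conj, e00_00])
    (fun x => by rw [hτa, hτa, m2_star, q_star hτ])
    (fun x hx hpx => by
      rw [hτa]
      rw [m2_conj] at hpx
      show q (sA σ i j) (e00 A _) = _
      rw [hpx])
  have eR : ∀ (c : ℝ) x, e00 R (c • x) = c • e00 R x := fun c x => by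
    rw [← Complex.coe_smul, map_smul, Complex.coe_smul]
  refine ⟨fun x => (1/2) * (φ (e00 R x) + φ (e00 R (star x))), ⟨fun x y => ?_, fun c x => ?_, fun x => ?_, fun x hx => ?_⟩, ?_, fun b b0 b1 => ?_⟩
  · simp only [star_add, map_add]; ring
  · have : star (c • x) = c • star x := by rw [star_smul]; simp
    simp only [this, eR, map_smul, smul_eq_mul]; ring
  · simp only [star_star]; ring
  · have := f0 _ (e00_nonneg hx)
    have hs := (IsSelfAdjoint.of_nonneg hx).star_eq
    simp only [hs]
    linarith
  · have e : q σ (e00 R 1) = q ψ 1 := by rw [q, q, hs]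
    rw [e] at f1
    simp only [star_one]
    linarith
  · have e : q σ (e00 R 1) = q ψ 1 := by rw [q, q, hs]
    have e' : q σ (e00 R b) = q ψ b := by rw [q, q, hs]
    have hs := (IsSelfAdjoint.of_nonneg b0).star_eq
    simp only [hs]
    have b1' : e00 R b ≤ 1 := by
      refine le_trans ?_ (proj_unit (m2_corner (R := R)).Ps m2_corner.PP).2
      rw [← sub_nonneg, ← map_sub]
      exact e00_nonneg (sub_nonneg.2 b1)
    have := f2 _ (e00_nonneg b0) b1' (by rw [m2_conj, e00_00])
    rw [e, e'] at this
    linarith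

lemma closeMk {i : A →⋆ₐ[ℂ] E} {j : R →⋆ₐ[ℂ] E} (hi : ∀ x, ‖i x‖ = ‖x‖) (hj : ∀ x, ‖j x‖ = ‖x‖)
    (h : ∀ x, ‖x‖ ≤ 1 → ∃ y, ‖y‖ ≤ 1 ∧ ‖i x - j y‖ ≤ 1 / 2200) : Close i j := by
  refine ⟨hi, hj, fun x hx => ?_, fun x x0 x1 => ?_⟩
  · obtain ⟨y, h1, h2⟩ := h x hx
    exact ⟨y, h1, h2.trans (by norm_num)⟩
  · have xs := IsSelfAdjoint.of_nonneg x0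
    have us : IsSelfAdjoint ((2:ℝ) • x - 1) := ((IsSelfAdjoint.all (2:ℝ)).smul xs).sub (.one A)
    have un : ‖(2:ℝ) • x - 1‖ ≤ 1 := by
      refine norm_le_of_two us zero_le_one ?_ ?_
      · rw [map_one, sub_le_iff_le_add]
        calc (2:ℝ) • x ≤ (2:ℝ) • (1:A) := smul_le_smul_of_nonneg_left x1 (by norm_num)
          _ = 1 + 1 := by module
      · rw [map_one]
        have : 0 ≤ (2:ℝ) • x := smul_nonneg (by norm_num) x0
        calc (-1:A) = 0 - 1 := by rw [zero_sub]
          _ ≤ (2:ℝ) • x - 1 := sub_le_sub_right this 1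
    obtain ⟨z, z1, z2⟩ := h _ un
    have hz : ‖(ℜ z : R)‖ ≤ 1 := (realPart.norm_le z).trans z1
    have hz2 : ‖i ((2:ℝ) • x - 1) - j (ℜ z : R)‖ ≤ 1 / 2200 := by
      have e : i ((2:ℝ) • x - 1) - j (ℜ z : R) = (ℜ (i ((2:ℝ) • x - 1) - j z) : E) := by
        have := (us.map i).star_eq
        simp only [realPart_apply_coe, star_sub, this, ← map_star]
        rw [show j ((2:ℝ)⁻¹ • (z + star z)) = (2:ℝ)⁻¹ • (j z + j (star z)) by
          rw [← map_add, ← Complex.coe_smul, map_smul, Complex.coe_smul]]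
        module
      rw [e]
      exact (realPart.norm_le _).trans z2
    have zl : (ℜ z : R) ≤ 1 := by simpa using le_alg (ℜ z).2 hz
    have zg : -1 ≤ (ℜ z : R) := by simpa using neg_le_alg (ℜ z).2 hz
    refine ⟨(1/2:ℝ) • (1 + (ℜ z : R)), smul_nonneg (by norm_num) ?_, ?_, ?_⟩
    · exact neg_le_iff_add_nonneg'.1 zg
    · calc (1/2:ℝ) • (1 + (ℜ z : R)) ≤ (1/2:ℝ) • (1 + 1 : R) := by
            exact smul_le_smul_of_nonneg_left (by gcongr) (by norm_num)
        _ = 1 := by module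
    · have ri : ∀ (c : ℝ) x, i (c • x) = c • i x := fun c x => by
        rw [← Complex.coe_smul, map_smul, Complex.coe_smul]
      have rj : ∀ (c : ℝ) x, j (c • x) = c • j x := fun c x => by
        rw [← Complex.coe_smul, map_smul, Complex.coe_smul]
      have e : i x - j ((1/2:ℝ) • (1 + (ℜ z : R))) = (1/2:ℝ) • (i ((2:ℝ) • x - 1) - j (ℜ z : R)) := by
        rw [rj, map_sub, ri, map_add, map_one, map_one]; module
      rw [e, norm_smul]
      norm_num at hz2 ⊢
      linarith

end
end QT

namespace QT
section
open scoped ComplexStarModule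

lemma mo_apply {n : ℕ} (a : Fin n → Fin n → (H →L[ℂ] H)) (v : PiLp 2 fun _ : Fin n => H) (k : Fin n) :
    matrixOp a v k = ∑ l, a k l (v l) := by
  simp [matrixOp]

lemma mo_ext {n : ℕ} {S T : (PiLp 2 fun _ : Fin n => H) →L[ℂ] (PiLp 2 fun _ : Fin n => H)}
    (h : ∀ v k, S v k = T v k) : S = T := by
  ext v k; exact h v k

lemma mo_star {n : ℕ} (a : Fin n → Fin n → (H →L[ℂ] H)) : star (matrixOp a) = matrixOp (fun k l => star (a l k)) := by
  symm
  rw [ContinuousLinearMap.star_eq_adjoint, ContinuousLinearMap.eq_adjoint_iff]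
  intro x y
  simp only [PiLp.inner_apply, mo_apply, sum_inner, inner_sum]
  rw [Finset.sum_comm]
  refine Finset.sum_congr rfl fun k _ => Finset.sum_congr rfl fun l _ => ?_
  rw [ContinuousLinearMap.star_eq_adjoint, ContinuousLinearMap.adjoint_inner_left]

lemma mo_inj {n : ℕ} {a b : Fin n → Fin n → (H →L[ℂ] H)} (h : matrixOp a = matrixOp b) : a = b := by
  funext k l
  ext v
  have := congrArg (fun T : (PiLp 2 fun _ : Fin n => H) →L[ℂ] (PiLp 2 fun _ : Fin n => H) => T (PiLp.single 2 l v) k) h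
  simp only [mo_apply] at this
  rw [Finset.sum_eq_single l, Finset.sum_eq_single l] at this
  · simpa using this
  · intro m _ hm; simp [hm]
  · simp
  · intro m _ hm; simp [hm]
  · simp

variable (S : StarSubalgebra ℂ (H →L[ℂ] H)) [hS : IsClosed (S : Set (H →L[ℂ] H))] [PartialOrder S] [StarOrderedRing S]

noncomputable def amp : M2 S →⋆ₐ[ℂ] ((PiLp 2 fun _ : Fin 2 => H) →L[ℂ] (PiLp 2 fun _ : Fin 2 => H)) where
  toFun x := matrixOp fun k l => ((ent x k l : S) : H →L[ℂ] H)
  map_one' := by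
    refine mo_ext fun v k => ?_
    rw [mo_apply]
    fin_cases k <;> simp [m2_one]
  map_zero' := by
    refine mo_ext fun v k => ?_
    rw [mo_apply]
    fin_cases k <;> simp [m2_zero]
  map_add' x y := by
    refine mo_ext fun v k => ?_
    simp only [add_apply, PiLp.add_apply]
    simp only [mo_apply]
    simp [m2_add, Fin.sum_univ_two]
    abel
  map_mul' x y := by
    refine mo_ext fun v k => ?_
    simp only [mul_apply_eq_comp]
    simp only [mo_apply]
    simp [m2_mul, Fin.sum_univ_two]
    abel
  commutes' c := by
    rw [Algebra.algebraMap_eq_smul_one, Algebra.algebraMap_eq_smul_one]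
    refine mo_ext fun v k => ?_
    rw [mo_apply]
    fin_cases k <;> simp [m2_smul, m2_one]
  map_star' x := by
    rw [mo_star]
    rfl

lemma amp_apply (x : M2 S) : amp S x = matrixOp fun k l => ((ent x k l : S) : H →L[ℂ] H) := rfl

lemma amp_norm (x : M2 S) : ‖amp S x‖ = ‖x‖ := by
  refine NonUnitalStarAlgHom.norm_map (amp S) (fun x y h => ?_) x
  have := mo_inj h
  have k : ∀ a b, ent x a b = ent y a b := fun a b => Subtype.ext (congrFun (congrFun this a) b)
  exact m2_ext (k _ _) (k _ _) (k _ _) (k _ _)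

lemma amp_surj {a : Fin 2 → Fin 2 → (H →L[ℂ] H)} (ha : ∀ k l, a k l ∈ S) : ∃ x, amp S x = matrixOp a :=
  ⟨(Matrix.of fun k l => (⟨a k l, ha k l⟩ : S) : Matrix (Fin 2) (Fin 2) S), rfl⟩

lemma approx {A B : NonUnitalStarSubalgebra ℂ (H →L[ℂ] H)} {γ : ℝ} (hd : KKdist (MatrixAmp 2 A) (MatrixAmp 2 B) < γ)
    {x} (hx : x ∈ MatrixAmp 2 A) (h1 : ‖x‖ ≤ 1) : ∃ y ∈ MatrixAmp 2 B, ‖y‖ ≤ 1 ∧ ‖x - y‖ < γ := by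
  have z : ∀ A : NonUnitalStarSubalgebra ℂ (H →L[ℂ] H), (MatrixAmp 2 A ∩ closedBall 0 1).Nonempty := fun A =>
    ⟨0, ⟨fun _ _ => 0, fun _ _ => zero_mem _, by
      refine mo_ext fun v k => ?_
      rw [mo_apply]; simp⟩, by simp⟩
  have b : ∀ A : NonUnitalStarSubalgebra ℂ (H →L[ℂ] H), Bornology.IsBounded (MatrixAmp 2 A ∩ closedBall 0 1) := fun A =>
    isBounded_closedBall.subset Set.inter_subset_right
  obtain ⟨y, ⟨hy, hy1⟩, hxy⟩ := exists_dist_lt_of_hausdorffDist_lt (x := x)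
    (s := MatrixAmp 2 A ∩ closedBall 0 1) (t := MatrixAmp 2 B ∩ closedBall 0 1) ⟨hx, by simpa using h1⟩ hd
    (hausdorffEDist_ne_top_of_nonempty_of_bounded (z A) (z B) (b A) (b B))
  exact ⟨y, hy, by simpa using hy1, by rwa [dist_eq_norm] at hxy⟩

end
end QT

theorem stmt15 (A B : NonUnitalStarSubalgebra ℂ (H →L[ℂ] H))
    (hAc : IsClosed (A : Set (H →L[ℂ] H))) (hBc : IsClosed (B : Set (H →L[ℂ] H)))
    (hA1 : (1 : H →L[ℂ] H) ∈ A) (hB1 : (1 : H →L[ℂ] H) ∈ B)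
    (hAnd : Nondegenerate A) (hBnd : Nondegenerate B)
    (γ : ℝ) (hγ : γ < 1 / 2200)
    (hd : ∀ n : ℕ, KKdist (MatrixAmp n A) (MatrixAmp n B) < γ)
    (hA : ∀ τ : A → ℂ, Is2Quasitrace τ →
      (∃ C : ℝ, ∀ x : A, ‖(x : H →L[ℂ] H)‖ ≤ 1 → ‖τ x‖ ≤ C) →
      (∀ x y : A, τ (x + y) = τ x + τ y) ∧ (∀ (c : ℂ) (x : A), τ (c • x) = c * τ x)) :
    ∀ τ : B → ℂ, Is2Quasitrace τ →
      (∃ C : ℝ, ∀ x : B, ‖(x : H →L[ℂ] H)‖ ≤ 1 → ‖τ x‖ ≤ C) →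
      (∀ x y : B, τ (x + y) = τ x + τ y) ∧ (∀ (c : ℂ) (x : B), τ (c • x) = c * τ x) := by
  let A₁ : StarSubalgebra ℂ (H →L[ℂ] H) := A.toStarSubalgebra hA1
  let B₁ : StarSubalgebra ℂ (H →L[ℂ] H) := B.toStarSubalgebra hB1
  haveI : IsClosed (A₁ : Set (H →L[ℂ] H)) := hAc
  haveI : IsClosed (B₁ : Set (H →L[ℂ] H)) := hBc
  letI : PartialOrder A₁ := CStarAlgebra.spectralOrder A₁
  haveI : StarOrderedRing A₁ := CStarAlgebra.spectralOrderedRing A₁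
  letI : PartialOrder B₁ := CStarAlgebra.spectralOrder B₁
  haveI : StarOrderedRing B₁ := CStarAlgebra.spectralOrderedRing B₁
  have hd2 := hd 2
  have hd2' : KKdist (MatrixAmp 2 B) (MatrixAmp 2 A) < γ := by
    rw [KKdist, hausdorffDist_comm]; exact hd2
  have mA : ∀ x : QT.M2 A₁, QT.amp A₁ x ∈ MatrixAmp 2 A := fun x =>
    ⟨fun k l => ((QT.ent x k l : A₁) : H →L[ℂ] H), fun k l => (QT.ent x k l).2, rfl⟩
  have mB : ∀ x : QT.M2 B₁, QT.amp B₁ x ∈ MatrixAmp 2 B := fun x =>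
    ⟨fun k l => ((QT.ent x k l : B₁) : H →L[ℂ] H), fun k l => (QT.ent x k l).2, rfl⟩
  have hc : QT.Close (QT.amp A₁) (QT.amp B₁) := by
    refine QT.closeMk (QT.amp_norm A₁) (QT.amp_norm B₁) fun x hx => ?_
    obtain ⟨y, ⟨b, hb, rfl⟩, y1, y2⟩ := QT.approx hd2 (mA x) (by rwa [QT.amp_norm])
    obtain ⟨z, hz⟩ := QT.amp_surj B₁ (a := b) hb
    rw [← hz] at y1 y2
    exact ⟨z, by rwa [QT.amp_norm] at y1, (y2.trans hγ).le⟩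
  have hc' : QT.Close (QT.amp B₁) (QT.amp A₁) := by
    refine QT.closeMk (QT.amp_norm B₁) (QT.amp_norm A₁) fun x hx => ?_
    obtain ⟨y, ⟨b, hb, rfl⟩, y1, y2⟩ := QT.approx hd2' (mB x) (by rwa [QT.amp_norm])
    obtain ⟨z, hz⟩ := QT.amp_surj A₁ (a := b) hb
    rw [← hz] at y1 y2
    exact ⟨z, by rwa [QT.amp_norm] at y1, (y2.trans hγ).le⟩
  have hij : QT.amp A₁ (QT.e00 A₁ 1) = QT.amp B₁ (QT.e00 B₁ 1) := by
    rw [QT.amp_apply, QT.amp_apply]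
    congr 1
    funext k l
    rw [QT.e00_ap, QT.e00_ap, QT.ent_sgl, QT.ent_sgl]
    split_ifs <;> rfl
  intro τ hτ _
  obtain ⟨t, ht, h⟩ := QT.absMain (QT.amp A₁) (QT.amp B₁) hc hc' hij
    (fun τ h1 h2 => hA τ h1 h2) τ hτ
  have h1 := QT.cplx_add ht
  have h2 := QT.cplx_smul ht
  rw [← h] at h1 h2
  exact ⟨h1, h2⟩
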